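/- arXiv:0803.0707 — 3 statements merged into one kernel-verified Lean document; each statement's English description precedes it below -/
import Mathlib

section
/- Let n be a positive integer and p = 2n. For k ≥ 1 let a_{p,k} be the number of pairings μ of [p] such that the permutation μ∘γ_p^{-1} has exactly k cycles in its disjoint cycle representation, and let A_p(x) = Σ_{k≥1} a_{p,k} x^k. Then, as an identity of polynomials in x (equivalently, for every real number x), A_p(x) = (2n−1)!! · Σ_{k≥1} 2^{k−1} · binom(n, k−1) · binom(x, k), where (2n−1)!! = Π_{j=1}^{n} (2j−1) and binom(x,k) = x(x−1)⋯(x−k+1)/k!. -/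
/-- The number of cycles (orbits, counting fixed points as 1-cycles) in the disjoint
cycle representation of a permutation `σ` of a finite set. -/
noncomputable def cycleCount {α : Type*} [Fintype α] (σ : Equiv.Perm α) : ℕ :=
  Nat.card (Quotient (MulAction.orbitRel (Subgroup.zpowers σ) α))

/-- The generalized binomial coefficient `binom(x, k) = x(x-1)⋯(x-k+1)/k!` for real `x`. -/
noncomputable def realChoose (x : ℝ) (k : ℕ) : ℝ :=
  (∏ t ∈ Finset.range k, (x - t)) / (Nat.factorial k)

/-- `hzCount p k` is the number of pairings (fixed-point-free involutions) `μ` of `[p]`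
such that `μ ∘ γ_p⁻¹` has exactly `k` cycles, where `γ_p = (1 2 … p)`. -/
noncomputable def hzCount (p k : ℕ) : ℕ :=
  Nat.card {μ : Equiv.Perm (Fin p) //
    (∀ i, μ (μ i) = i) ∧ (∀ i, μ i ≠ i) ∧ cycleCount (μ * (finRotate p)⁻¹) = k}


section Helpers

open Equiv Equiv.Perm

lemma cc_eq {α : Type*} [Fintype α] (σ : Perm α) :
    cycleCount σ = Nat.card (Quotient (SameCycle.setoid σ)) := by
  have : MulAction.orbitRel (Subgroup.zpowers σ) α = SameCycle.setoid σ := by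
    ext a b
    rw [MulAction.orbitRel_apply, MulAction.mem_orbit_iff]
    constructor
    · rintro ⟨⟨g, k, rfl⟩, h⟩
      exact SameCycle.symm ⟨k, h⟩
    · intro h
      obtain ⟨k, hk⟩ := SameCycle.symm h
      exact ⟨⟨σ ^ k, k, rfl⟩, hk⟩
  unfold cycleCount
  rw [this]

lemma inv_sameCycle {α : Type*} (σ : Perm α) (f : α → Bool) (hf : ∀ a, f (σ a) = f a)
    {a b : α} (h : SameCycle σ a b) : f a = f b := by
  obtain ⟨k, rfl⟩ := h
  have h1 : ∀ (n : ℕ) a, f ((σ ^ n) a) = f a := by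
    intro n
    induction n with
    | zero => simp
    | succ n ih => intro a; rw [pow_succ, Perm.mul_apply, ih, hf]
  rcases k with n | n
  · simp [h1]
  · rw [zpow_negSucc]
    have := h1 (n+1) (((σ ^ (n+1))⁻¹) a)
    rw [← this]
    congr 1
    simp

lemma two_pow_cc {α : Type*} [Fintype α] (σ : Perm α) :
    Nat.card {f : α → Bool // ∀ a, f (σ a) = f a} = 2 ^ cycleCount σ := by
  rw [cc_eq]
  have e : {f : α → Bool // ∀ a, f (σ a) = f a} ≃ (Quotient (SameCycle.setoid σ) → Bool) :=
    { toFun := fun f q => Quotient.lift f.1 (fun a b h => inv_sameCycle σ f.1 f.2 h) q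
      invFun := fun g => ⟨fun a => g (Quotient.mk _ a), fun a => by
        apply congrArg
        apply Quotient.sound
        exact sameCycle_apply_left.2 (SameCycle.refl σ a)⟩
      left_inv := fun f => by ext a; rfl
      right_inv := fun g => by
        funext q
        induction q using Quotient.inductionOn
        rfl }
  rw [Nat.card_congr e, Nat.card_fun]
  simp

lemma cc_of_equiv {α β : Type*} [Fintype α] [Fintype β] (σ : Perm α) (τ : Perm β)
    (e : α ≃ β) (h : ∀ a, e (σ a) = τ (e a)) : cycleCount σ = cycleCount τ := by
  apply Nat.pow_right_injective le_rfl
  simp only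
  rw [← two_pow_cc, ← two_pow_cc]
  refine Nat.card_congr (Equiv.subtypeEquiv (e.arrowCongr (Equiv.refl _)) ?_)
  intro f
  constructor
  · intro hf b
    have := hf (e.symm b)
    simp only [Equiv.arrowCongr_apply, Function.comp]
    have h2 := h (e.symm b)
    simp only [Equiv.apply_symm_apply] at h2
    rw [← h2]; simpa using this
  · intro hf a
    have := hf (e a)
    rw [← h] at this
    simpa using this

lemma cc_conj {α : Type*} [Fintype α] (g σ : Perm α) :
    cycleCount (g * σ * g⁻¹) = cycleCount σ :=
  (cc_of_equiv σ (g * σ * g⁻¹) g (by simp)).symm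

lemma cc_subtypeCongr {α : Type*} [Fintype α] (p : α → Prop) [DecidablePred p]
    (s : Perm {a // p a}) (t : Perm {a // ¬ p a}) :
    cycleCount (Perm.subtypeCongr s t) = cycleCount s + cycleCount t := by
  apply Nat.pow_right_injective le_rfl
  simp only
  rw [pow_add, ← two_pow_cc, ← two_pow_cc, ← two_pow_cc, ← Nat.card_prod]
  refine Nat.card_congr
    { toFun := fun f => (⟨fun a => f.1 a, fun a => by
          have := f.2 a; simpa using this⟩, ⟨fun a => f.1 a, fun a => by
          have := f.2 a; simpa using this⟩)
      invFun := fun g => ⟨fun a => if h : p a then g.1.1 ⟨a, h⟩ else g.2.1 ⟨a, h⟩, fun a => ?_⟩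
      left_inv := fun f => ?_
      right_inv := fun g => ?_ }
  · by_cases h : p a
    · have h2 := (s ⟨a, h⟩).2
      simp only [Perm.subtypeCongr.left_apply _ _ h, h2, h, dif_pos]
      exact g.1.2 _
    · have h2 := (t ⟨a, h⟩).2
      simp only [Perm.subtypeCongr.right_apply _ _ h, h2, h, dif_neg, not_false_eq_true]
      exact g.2.2 _
  · ext a; by_cases h : p a <;> simp [h]
  · ext a
    · have := a.2; simp [this]
    · have := a.2; simp [this]

lemma card_update {Q : Type*} [Finite Q] (q1 q2 : Q) (h : q1 ≠ q2) :
    Nat.card {f : Q → Bool // f q1 = f q2} * 2 = 2 ^ Nat.card Q := by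
  classical
  have e : {f : Q → Bool // f q1 = f q2} × Bool ≃ (Q → Bool) :=
    { toFun := fun x => Function.update x.1.1 q1 x.2
      invFun := fun g => (⟨Function.update g q1 (g q2), by simp [h.symm]⟩, g q1)
      left_inv := by
        rintro ⟨⟨f, hf⟩, b⟩
        simp [h.symm, ← hf]
      right_inv := by intro g; simp }
  have := Nat.card_congr e
  rw [Nat.card_prod, Nat.card_fun] at this
  simpa using this

lemma cc_join {α : Type*} [Fintype α] [DecidableEq α] (σ : Perm α) (a b : α)
    (h : ¬ SameCycle σ a b) : cycleCount (swap a b * σ) + 1 = cycleCount σ := by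
  apply Nat.pow_right_injective le_rfl
  simp only
  rw [pow_succ, ← two_pow_cc, cc_eq, ← card_update (Quotient.mk (SameCycle.setoid σ) a)
    (Quotient.mk (SameCycle.setoid σ) b) (fun h' => h (Quotient.exact h'))]
  congr 1
  have key : ∀ f : α → Bool, (∀ x, f ((swap a b * σ) x) = f x) ↔
      ((∀ x, f (σ x) = f x) ∧ f a = f b) := by
    intro f
    constructor
    · intro hf
      have hab : f a = f b := by
        have h1 : ∀ k : ℕ, (∃ j ≤ k, 0 < j ∧ (σ ^ j) a = a) ∨ f ((σ ^ k) a) = f a := by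
          intro k
          induction k with
          | zero => right; simp
          | succ k ih =>
            rcases ih with ⟨j, hj, hj'⟩ | ih
            · exact Or.inl ⟨j, by omega, hj'⟩
            · by_cases hk : (σ ^ (k+1)) a = a
              · exact Or.inl ⟨k+1, le_rfl, by omega, hk⟩
              · right
                rw [← ih, ← hf ((σ ^ k) a)]
                rw [Perm.mul_apply, ← Perm.mul_apply σ, ← pow_succ', swap_apply_of_ne_of_ne hk]
                intro hb
                exact h ⟨(k+1 : ℕ), by rw [zpow_natCast]; exact hb⟩
        have hex : ∃ j, 0 < j ∧ (σ ^ j) a = a :=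
          ⟨orderOf σ, orderOf_pos σ, by rw [pow_orderOf_eq_one]; rfl⟩
        classical
        have hm := Nat.find_spec hex
        set m := Nat.find hex with hmdef
        obtain ⟨k, hk⟩ : ∃ k, m = k + 1 := ⟨m - 1, by omega⟩
        rcases h1 k with ⟨j, hj, hj'⟩ | h2
        · exact absurd hj' (Nat.find_min hex (by omega))
        · rw [← h2, ← hf ((σ ^ k) a), Perm.mul_apply, ← Perm.mul_apply σ, ← pow_succ', ← hk, hm.2,
            swap_apply_left]
      refine ⟨fun x => ?_, hab⟩
      rw [← hf x, Perm.mul_apply]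
      by_cases h1 : σ x = a
      · rw [h1, swap_apply_left, hab]
      · by_cases h2 : σ x = b
        · rw [h2, swap_apply_right, hab]
        · rw [swap_apply_of_ne_of_ne h1 h2]
    · rintro ⟨hf, hab⟩ x
      rw [← hf x, Perm.mul_apply]
      by_cases h1 : σ x = a
      · rw [h1, swap_apply_left, hab]
      · by_cases h2 : σ x = b
        · rw [h2, swap_apply_right, hab]
        · rw [swap_apply_of_ne_of_ne h1 h2]
  refine Nat.card_congr
    { toFun := fun f => ⟨fun q => Quotient.lift f.1
        (fun x y h => inv_sameCycle σ f.1 ((key f.1).1 f.2).1 h) q, ((key f.1).1 f.2).2⟩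
      invFun := fun g => ⟨fun a => g.1 (Quotient.mk _ a), (key (fun a => g.1 (Quotient.mk _ a))).2 ⟨fun a => by
        apply congrArg g.1
        apply Quotient.sound
        exact sameCycle_apply_left.2 (SameCycle.refl σ a), g.2⟩⟩
      left_inv := fun f => by ext a; rfl
      right_inv := fun g => by
        ext q
        induction q using Quotient.inductionOn
        rfl }

lemma cc_optionCongr {α : Type*} [Fintype α] (σ : Perm α) :
    cycleCount (optionCongr σ) = cycleCount σ + 1 := by
  apply Nat.pow_right_injective le_rfl
  simp only
  rw [pow_succ, ← two_pow_cc, ← two_pow_cc]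
  have : Nat.card Bool = 2 := by simp
  conv_rhs => rw [← this]
  rw [← Nat.card_prod]
  refine Nat.card_congr
    { toFun := fun f => (⟨fun a => f.1 (some a), fun a => by simpa using f.2 (some a)⟩, f.1 none)
      invFun := fun g => ⟨fun a => a.elim g.2 g.1.1, fun a => by
        cases a with
        | none => rfl
        | some a => exact g.1.2 a⟩
      left_inv := fun f => by ext a; cases a <;> rfl
      right_inv := fun g => rfl }

lemma not_sameCycle_none {α : Type*} (σ : Perm α) (i : α) :
    ¬ SameCycle (optionCongr σ) none (some i) := by
  intro h
  have := inv_sameCycle (optionCongr σ) (fun a => a.isSome) (by rintro (_|a) <;> simp) h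
  simp at this

lemma sign_cc_sum (x : ℝ) (m : ℕ) : ∀ (α : Type) [Fintype α] [DecidableEq α],
    Fintype.card α = m →
    ((∀ σ : Perm α, ((-1 : ℝ)) ^ cycleCount σ = (-1) ^ m * ((sign σ : ℤ) : ℝ)) ∧
    ∑ σ : Perm α, x ^ cycleCount σ = ∏ i ∈ Finset.range m, (x + i)) := by
  induction m with
  | zero =>
    intro α _ _ h
    have : IsEmpty α := Fintype.card_eq_zero_iff.1 h
    have hc : ∀ σ : Perm α, cycleCount σ = 0 := fun σ => by
      rw [cc_eq]
      have : IsEmpty (Quotient (SameCycle.setoid σ)) :=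
        ⟨fun q => Quotient.inductionOn q (fun a => IsEmpty.false a)⟩
      simp
    constructor
    · intro σ
      have : σ = 1 := Subsingleton.elim _ _
      rw [hc, this]; simp
    · simp [hc]
  | succ m ih =>
    intro α _ _ h
    let β := Fin m
    have ⟨e⟩ : Nonempty (Option β ≃ α) := ⟨Fintype.equivOfCardEq (by simp [β, h])⟩
    obtain ⟨ih1, ih2⟩ := ih β (by simp [β])
    have hA : ∀ (i : Option β) (τ : Perm β), cycleCount (decomposeOption.symm (i, τ)) =
        cycleCount τ + if i = none then 1 else 0 := by
      intro i τ
      rw [decomposeOption_symm_apply]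
      cases i with
      | none =>
        simp only [swap_self, if_true]
        rw [← cc_optionCongr]; rfl
      | some i =>
        have := cc_join _ _ _ (not_sameCycle_none τ i)
        rw [cc_optionCongr] at this
        simp only [reduceCtorEq, if_false]
        omega
    constructor
    · intro σ
      let σ' : Perm (Option β) := e.symm.permCongr σ
      have h1 : cycleCount σ' = cycleCount σ := cc_of_equiv _ _ e (by intro a; simp [σ'])
      have h2 : sign σ' = sign σ := by simp [σ']
      rw [← h1, ← h2]
      obtain ⟨⟨i, τ⟩, hi⟩ := decomposeOption.symm.surjective σ'
      rw [← hi, hA, pow_add, ih1]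
      rw [decomposeOption_symm_apply, Perm.sign_mul]
      cases i with
      | none => simp [pow_succ]
      | some i => simp [pow_succ]
    · have : ∑ σ : Perm α, x ^ cycleCount σ = ∑ σ : Perm (Option β), x ^ cycleCount σ := by
        refine Fintype.sum_equiv e.symm.permCongr _ _ ?_
        intro σ
        rw [cc_of_equiv (e.symm.permCongr σ) σ e (by intro a; simp)]
      rw [this, ← decomposeOption.symm.sum_comp, Fintype.sum_prod_type]
      simp_rw [hA, Fintype.sum_option]
      simp only [if_true, reduceCtorEq, if_false, add_zero, Finset.sum_const, pow_succ,
        ← Finset.sum_mul, ih2, Finset.prod_range_succ]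
      simp [β]
      ring


lemma cc_subtypePerm {α : Type} [Fintype α] [DecidableEq α] (σ : Perm α)
    (T : Finset (Quotient (SameCycle.setoid σ))) (S : Finset α)
    (hS : ∀ a, a ∈ S ↔ Quotient.mk _ a ∈ T)
    (h : ∀ a, σ a ∈ S ↔ a ∈ S) :
    cycleCount (σ.subtypePerm (p := fun a => a ∈ S) h) = T.card := by
  rw [cc_eq]
  let f : Quotient (SameCycle.setoid (σ.subtypePerm (p := fun a => a ∈ S) h)) → {q // q ∈ T} :=
    fun q => Quotient.liftOn q (fun a => ⟨Quotient.mk _ a.1, (hS _).1 a.2⟩) (by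
      intro a b hab
      apply Subtype.ext
      apply Quotient.sound
      exact sameCycle_subtypePerm.1 hab)
  have hf : Function.Bijective f := by
    constructor
    · intro q q'
      induction q using Quotient.inductionOn
      induction q' using Quotient.inductionOn
      intro hq
      apply Quotient.sound
      apply sameCycle_subtypePerm.2
      exact Quotient.exact (congrArg Subtype.val hq)
    · rintro ⟨q, hq⟩
      induction q using Quotient.inductionOn with
      | _ a => exact ⟨Quotient.mk _ ⟨a, (hS a).2 hq⟩, rfl⟩
  rw [Nat.card_congr (Equiv.ofBijective f hf)]
  simp

lemma subtypeCongr_mem {α : Type} [DecidableEq α] (S : Finset α)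
    (s : Perm {a // a ∈ S}) (t : Perm {a // ¬ a ∈ S}) (a : α) :
    Perm.subtypeCongr s t a ∈ S ↔ a ∈ S := by
  by_cases h : a ∈ S
  · rw [Perm.subtypeCongr.left_apply _ _ h]
    simp [h]
  · rw [Perm.subtypeCongr.right_apply _ _ h]
    have := (t ⟨a, h⟩).2
    simp [h, this]

lemma subtypeCongr_subtypePerm {α : Type} [DecidableEq α] (S : Finset α) (σ : Perm α)
    (h : ∀ a, σ a ∈ S ↔ a ∈ S) :
    Perm.subtypeCongr (σ.subtypePerm (p := fun a => a ∈ S) h)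
      (σ.subtypePerm (p := fun a => ¬ a ∈ S) (fun a => not_congr (h a))) = σ := by
  ext a
  by_cases h : a ∈ S
  · rw [Perm.subtypeCongr.left_apply _ _ h]; rfl
  · rw [Perm.subtypeCongr.right_apply _ _ h]; rfl

lemma indicator {α : Type} [Fintype α] [DecidableEq α] (σ : Perm α) (o : α) :
    ∑ S ∈ (Finset.univ : Finset (Finset α)).filter (fun S => o ∉ S),
      ∑ st : Perm {a // a ∈ S} × Perm {a // ¬ a ∈ S},
        (if Perm.subtypeCongr st.1 st.2 = σ then (-1 : ℝ) ^ cycleCount st.1 else 0) =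
      if cycleCount σ = 1 then 1 else 0 := by
  classical
  let Q := Quotient (SameCycle.setoid σ)
  let : Fintype Q := Fintype.ofFinite Q
  let qo : Q := Quotient.mk _ o
  have h1 : ∑ T ∈ (Finset.univ.erase qo).powerset, (-1 : ℤ) ^ T.card =
      if cycleCount σ = 1 then 1 else 0 := by
    rw [Finset.sum_powerset_neg_one_pow_card]
    have : (Finset.univ.erase qo = ∅) ↔ cycleCount σ = 1 := by
      rw [cc_eq, Nat.card_eq_fintype_card, ← Finset.card_eq_zero,
        Finset.card_erase_of_mem (Finset.mem_univ _), Finset.card_univ]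
      have : 0 < Fintype.card Q := Fintype.card_pos_iff.2 ⟨qo⟩
      show Fintype.card Q - 1 = 0 ↔ Fintype.card Q = 1
      omega
    simp [this]
  have h2 : ∑ T ∈ (Finset.univ.erase qo).powerset, (-1 : ℝ) ^ T.card =
      if cycleCount σ = 1 then 1 else 0 := by
    have := congrArg (fun z : ℤ => (z : ℝ)) h1
    push_cast at this
    exact this
  rw [← h2]
  symm
  refine Finset.sum_of_injOn
    (fun T => Finset.univ.filter (fun a : α => (Quotient.mk _ a : Q) ∈ T)) ?_ ?_ ?_ ?_
  · intro T _ T' _ hT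
    ext q
    induction q using Quotient.inductionOn with
    | _ a =>
      have := congrArg (fun S => a ∈ S) hT
      simpa using this
  · intro T hT
    have : T ⊆ Finset.univ.erase qo := Finset.mem_powerset.1 (by exact_mod_cast hT)
    simp only [Finset.coe_filter, Finset.mem_univ, true_and, Set.mem_ofPred_eq, Finset.mem_filter]
    intro h
    exact absurd (this h) (by simp [qo])
  · intro S hS hS'
    apply Finset.sum_eq_zero
    rintro ⟨s, t⟩ _
    rw [if_neg]
    intro h
    apply hS'
    have hinv : ∀ a b, SameCycle σ a b → (a ∈ S ↔ b ∈ S) := by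
      intro a b hab
      have := inv_sameCycle σ (fun a => decide (a ∈ S)) (fun a => by
        rw [decide_eq_decide, ← h]; exact subtypeCongr_mem S s t a) hab
      simpa using this
    have hmem : ∀ a, (Quotient.mk _ a : Q) ∈ S.image (fun a => (Quotient.mk _ a : Q)) ↔ a ∈ S := by
      intro a
      rw [Finset.mem_image]
      constructor
      · rintro ⟨b, hb, hab⟩
        exact (hinv _ _ (Quotient.exact hab)).1 hb
      · intro ha; exact ⟨a, ha, rfl⟩
    refine ⟨S.image (fun a => (Quotient.mk _ a : Q)), ?_, ?_⟩
    · simp only [Finset.coe_powerset, Set.mem_preimage, Set.mem_powerset_iff, Finset.coe_subset]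
      intro q hq
      rw [Finset.mem_erase]
      refine ⟨?_, Finset.mem_univ _⟩
      rintro rfl
      simp only [Finset.mem_filter, Finset.mem_univ, true_and] at hS
      exact hS ((hmem o).1 hq)
    · ext a
      simp only [Finset.mem_filter, Finset.mem_univ, true_and]
      exact hmem a
  · intro T hT
    set S := Finset.univ.filter (fun a : α => (Quotient.mk _ a : Q) ∈ T) with hSdef
    have hS : ∀ a, a ∈ S ↔ (Quotient.mk _ a : Q) ∈ T := by intro a; simp [hSdef]
    have hq : ∀ a, (Quotient.mk _ (σ a) : Q) = Quotient.mk _ a := fun a =>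
      Quotient.sound (sameCycle_apply_left.2 (SameCycle.refl σ a))
    have hσ : ∀ a, σ a ∈ S ↔ a ∈ S := by
      intro a; rw [hS, hS, hq]
    rw [Finset.sum_eq_single (σ.subtypePerm (p := fun a => a ∈ S) hσ,
      σ.subtypePerm (p := fun a => ¬ a ∈ S) (fun a => not_congr (hσ a)))]
    · rw [if_pos (subtypeCongr_subtypePerm S σ hσ), cc_subtypePerm σ T S hS hσ]
    · rintro st _ hst
      rw [if_neg]
      intro h
      apply hst
      apply subtypeCongrHom_injective (fun a => a ∈ S)
      simp only [subtypeCongrHom_apply]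
      rw [h, subtypeCongr_subtypePerm]
    · simp

/-- weight of a set -/
noncomputable def WW {α : Type} [Fintype α] [DecidableEq α] (g : Perm α → ℝ) (S : Finset α) : ℝ :=
  ∑ st : Perm {a // a ∈ S} × Perm {a // ¬ a ∈ S},
    (-1 : ℝ) ^ cycleCount st.1 * g (Perm.subtypeCongr st.1 st.2)

lemma full_sum {α : Type} [Fintype α] [DecidableEq α] (g : Perm α → ℝ) :
    (Fintype.card α : ℝ) * ∑ σ : Perm α, (if cycleCount σ = 1 then g σ else 0) =
      ∑ S : Finset α, ((Fintype.card α : ℝ) - S.card) * WW g S := by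
  have h1 : ∀ o : α, ∑ σ : Perm α, (if cycleCount σ = 1 then g σ else 0) =
      ∑ S : Finset α, (if o ∉ S then WW g S else 0) := by
    intro o
    have : ∀ σ : Perm α, (if cycleCount σ = 1 then g σ else 0) =
        ∑ S : Finset α, (if o ∉ S then ∑ st : Perm {a // a ∈ S} × Perm {a // ¬ a ∈ S},
        (if Perm.subtypeCongr st.1 st.2 = σ then (-1 : ℝ) ^ cycleCount st.1 else 0) * g σ else 0) := by
      intro σ
      have := indicator σ o
      rw [Finset.sum_filter] at this
      have h3 : (if cycleCount σ = 1 then g σ else 0) =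
        (if cycleCount σ = 1 then 1 else 0) * g σ := by simp
      rw [h3, ← this, Finset.sum_mul]
      refine Finset.sum_congr rfl fun S _ => ?_
      split_ifs <;> simp [Finset.sum_mul]
    simp_rw [this]
    rw [Finset.sum_comm]
    refine Finset.sum_congr rfl fun S _ => ?_
    by_cases ho : o ∈ S
    · simp [ho]
    · simp only [ho, not_false_eq_true, if_true]
      rw [Finset.sum_comm, WW]
      refine Finset.sum_congr rfl fun st _ => ?_
      simp [ite_mul]
  have h2 : (Fintype.card α : ℝ) * ∑ σ : Perm α, (if cycleCount σ = 1 then g σ else 0) =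
      ∑ o : α, ∑ S : Finset α, (if o ∉ S then WW g S else 0) := by
    rw [← Finset.sum_congr rfl (fun o _ => h1 o)]
    simp
  rw [h2, Finset.sum_comm]
  refine Finset.sum_congr rfl fun S _ => ?_
  rw [← Finset.sum_filter, Finset.sum_const, nsmul_eq_mul]
  congr 1
  have : (Finset.univ.filter (fun o => o ∉ S)) = Sᶜ := by ext; simp
  rw [this, Finset.card_compl, Nat.cast_sub (Finset.card_le_univ S)]

lemma alt_sum {β : Type} [Fintype β] [DecidableEq β] (x : ℝ) (ν : Perm β) :
    ∑ s : Perm β, (-1 : ℝ) ^ cycleCount s * x ^ cycleCount (ν * s⁻¹) =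
      (-1) ^ cycleCount ν * ∏ i ∈ Finset.range (Fintype.card β), (x - i) := by
  obtain ⟨h1, -⟩ := sign_cc_sum x _ β rfl
  obtain ⟨-, h2⟩ := sign_cc_sum (-x) _ β rfl
  have e : Perm β ≃ Perm β := (Equiv.inv (Perm β)).trans (Equiv.mulRight ν)
  have : ∑ s : Perm β, (-1 : ℝ) ^ cycleCount s * x ^ cycleCount (ν * s⁻¹) =
      ∑ s : Perm β, (-1 : ℝ) ^ cycleCount (s⁻¹ * ν) * x ^ cycleCount s := by
    symm
    refine Fintype.sum_equiv ((Equiv.inv (Perm β)).trans (Equiv.mulRight ν)) _ _ ?_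
    intro s
    simp
  rw [this]
  have h3 : ∀ s : Perm β, (-1 : ℝ) ^ cycleCount (s⁻¹ * ν) * x ^ cycleCount s =
      (-1) ^ cycleCount ν * (-1) ^ (Fintype.card β) * (-x) ^ cycleCount s := by
    intro s
    rw [neg_pow x, h1, h1, h1, Perm.sign_mul, sign_inv]
    have : ((-1 : ℝ) ^ Fintype.card β) * ((-1 : ℝ) ^ Fintype.card β) = 1 := by
      rw [← mul_pow]; simp
    push_cast
    linear_combination (-(((-1 : ℝ) ^ Fintype.card β) * ((sign ν : ℤ) : ℝ) * ((sign s : ℤ) : ℝ) *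
      x ^ cycleCount s)) * this
  simp_rw [h3]
  rw [← Finset.mul_sum, h2, mul_assoc]
  congr 1
  have : ∀ i ∈ Finset.range (Fintype.card β), (x - i) = (-1) * (-x + i) := by
    intro i _; ring
  rw [Finset.prod_congr rfl this, Finset.prod_mul_distrib]
  simp

lemma pos_sum {β : Type} [Fintype β] [DecidableEq β] (x : ℝ) (ν : Perm β) :
    ∑ s : Perm β, x ^ cycleCount (ν * s⁻¹) = ∏ i ∈ Finset.range (Fintype.card β), (x + i) := by
  obtain ⟨-, h2⟩ := sign_cc_sum x _ β rfl
  rw [← h2]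
  exact Fintype.sum_equiv ((Equiv.inv (Perm β)).trans (Equiv.mulLeft ν)) _ _ (fun s => by simp)

lemma WW_A {α : Type} [Fintype α] [DecidableEq α] (x : ℝ) (ν : Perm α) (S : Finset α)
    (h : ∀ a, ν a ∈ S ↔ a ∈ S) :
    WW (fun σ => x ^ cycleCount (ν * σ⁻¹)) S =
      (-1) ^ cycleCount (ν.subtypePerm (p := fun a => a ∈ S) h) *
        (∏ i ∈ Finset.range S.card, (x - i)) *
        ∏ i ∈ Finset.range (Fintype.card α - S.card), (x + i) := by
  unfold WW
  set ν1 := ν.subtypePerm (p := fun a => a ∈ S) h with hν1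
  set ν2 := ν.subtypePerm (p := fun a => ¬ a ∈ S) (fun a => not_congr (h a)) with hν2
  have h1 : ∀ st : Perm {a // a ∈ S} × Perm {a // ¬ a ∈ S},
      (-1 : ℝ) ^ cycleCount st.1 * x ^ cycleCount (ν * (Perm.subtypeCongr st.1 st.2)⁻¹) =
      ((-1 : ℝ) ^ cycleCount st.1 * x ^ cycleCount (ν1 * st.1⁻¹)) *
        x ^ cycleCount (ν2 * st.2⁻¹) := by
    rintro ⟨s, t⟩
    have : ν * (Perm.subtypeCongr s t)⁻¹ = Perm.subtypeCongr (ν1 * s⁻¹) (ν2 * t⁻¹) := by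
      rw [← subtypeCongr_subtypePerm S ν h]
      have := ((subtypeCongrHom (fun a => a ∈ S)).map_mul (ν1, ν2) (s, t)⁻¹)
      rw [map_inv] at this
      exact this.symm
    simp only
    rw [this, cc_subtypeCongr, pow_add, mul_assoc]
    rfl
  simp_rw [h1]
  rw [Fintype.sum_prod_type]
  simp_rw [← Finset.mul_sum]
  rw [← Finset.sum_mul, alt_sum, pos_sum]
  have c1 : Fintype.card {a // a ∈ S} = S.card := by simp
  have c2 : Fintype.card {a // ¬ a ∈ S} = Fintype.card α - S.card := by
    rw [Fintype.card_subtype_compl]; simp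
  rw [c1, c2]

lemma WW_B {α : Type} [Fintype α] [DecidableEq α] (x : ℝ) (μ : Perm α) (S : Finset α)
    (a b : α) (ha : a ∈ S) (hb : b ∉ S)
    (h : ∀ z, (swap a b * μ) z ∈ S ↔ z ∈ S) :
    x * WW (fun σ => x ^ cycleCount (μ * σ⁻¹)) S =
      (-1) ^ cycleCount ((swap a b * μ).subtypePerm (p := fun a => a ∈ S) h) *
        (∏ i ∈ Finset.range S.card, (x - i)) *
        ∏ i ∈ Finset.range (Fintype.card α - S.card), (x + i) := by
  rw [← WW_A x (swap a b * μ) S h]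
  unfold WW
  rw [Finset.mul_sum]
  refine Finset.sum_congr rfl ?_
  rintro ⟨s, t⟩ _
  simp only
  set σ := Perm.subtypeCongr s t with hσ
  have hns : ¬ SameCycle ((swap a b * μ) * σ⁻¹) a b := by
    intro hs
    have := inv_sameCycle ((swap a b * μ) * σ⁻¹) (fun z => decide (z ∈ S)) (fun z => by
      rw [decide_eq_decide, Perm.mul_apply, h]
      have := subtypeCongr_mem S s t (σ⁻¹ z)
      rw [← this, ← hσ]
      simp) hs
    simp [ha, hb] at this
  have := cc_join _ _ _ hns
  have h3 : swap a b * (swap a b * μ * σ⁻¹) = μ * σ⁻¹ := by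
    rw [mul_assoc, ← mul_assoc, swap_mul_self, one_mul]
  rw [h3] at this
  rw [← this, pow_succ]
  ring

lemma WW_C {α : Type} [Fintype α] [DecidableEq α] (x : ℝ) (μ : Perm α) (S : Finset α)
    (a a' : α) (ha : a ∈ S) (ha' : a' ∈ S) (hne : a ≠ a') (hb : μ a ∉ S) (hb' : μ a' ∉ S) :
    WW (fun σ => x ^ cycleCount (μ * σ⁻¹)) S = 0 := by
  have key : WW (fun σ => x ^ cycleCount (μ * σ⁻¹)) S =
      - WW (fun σ => x ^ cycleCount (μ * σ⁻¹)) S := by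
    conv_rhs => unfold WW
    rw [← Finset.sum_neg_distrib]
    unfold WW
    refine Fintype.sum_equiv ((Equiv.mulRight (swap (⟨a, ha⟩ : {a // a ∈ S}) ⟨a', ha'⟩)).prodCongr
      (Equiv.mulLeft (swap (⟨μ a, hb⟩ : {a // ¬ a ∈ S}) ⟨μ a', hb'⟩))) _ _ ?_
    rintro ⟨s, t⟩
    simp only [Equiv.prodCongr_apply, Prod.map, Equiv.coe_mulRight, Equiv.coe_mulLeft]
    have h1 := (sign_cc_sum x _ {a // a ∈ S} rfl).1
    have hs : (-1 : ℝ) ^ cycleCount (s * swap (⟨a, ha⟩ : {a // a ∈ S}) ⟨a', ha'⟩) =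
        - (-1 : ℝ) ^ cycleCount s := by
      rw [h1, h1, Perm.sign_mul, sign_swap (by simpa using hne)]
      simp
    have e : Perm.subtypeCongr (s * swap (⟨a, ha⟩ : {a // a ∈ S}) ⟨a', ha'⟩)
        (swap (⟨μ a, hb⟩ : {a // ¬ a ∈ S}) ⟨μ a', hb'⟩ * t) =
        swap (μ a) (μ a') * Perm.subtypeCongr s t * swap a a' := by
      have e1 : swap a a' = Perm.subtypeCongr (swap (⟨a, ha⟩ : {a // a ∈ S}) ⟨a', ha'⟩)
          (1 : Perm {a // ¬ a ∈ S}) := by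
        ext z
        by_cases hz : z ∈ S
        · rw [Perm.subtypeCongr.left_apply _ _ hz]
          simp only [swap_apply_def, Subtype.mk.injEq]
          split_ifs <;> rfl
        · rw [Perm.subtypeCongr.right_apply _ _ hz, swap_apply_of_ne_of_ne]
          · rfl
          · rintro rfl; exact hz ha
          · rintro rfl; exact hz ha'
      have e2 : swap (μ a) (μ a') = Perm.subtypeCongr (1 : Perm {a // a ∈ S})
          (swap (⟨μ a, hb⟩ : {a // ¬ a ∈ S}) ⟨μ a', hb'⟩) := by
        ext z
        by_cases hz : z ∈ S
        · rw [Perm.subtypeCongr.left_apply _ _ hz, swap_apply_of_ne_of_ne]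
          · rfl
          · rintro rfl; exact hb hz
          · rintro rfl; exact hb' hz
        · rw [Perm.subtypeCongr.right_apply _ _ hz]
          simp only [swap_apply_def, Subtype.mk.injEq]
          split_ifs <;> rfl
      rw [e1, e2]
      have m := (subtypeCongrHom (fun a => a ∈ S)).map_mul
      have m1 := m (1, swap (⟨μ a, hb⟩ : {a // ¬ a ∈ S}) ⟨μ a', hb'⟩) (s, t)
      have m2 := m (s, swap (⟨μ a, hb⟩ : {a // ¬ a ∈ S}) ⟨μ a', hb'⟩ * t)
        (swap (⟨a, ha⟩ : {a // a ∈ S}) ⟨a', ha'⟩, 1)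
      simp only [subtypeCongrHom_apply, Prod.mk_mul_mk, one_mul, mul_one] at m1 m2
      rw [← m1, ← m2]
    rw [hs, e]
    have e3 : μ * (swap (μ a) (μ a') * Perm.subtypeCongr s t * swap a a')⁻¹ =
        swap (μ a) (μ a') * (μ * (Perm.subtypeCongr s t)⁻¹) * (swap (μ a) (μ a'))⁻¹ := by
      rw [mul_inv_rev, mul_inv_rev, swap_inv, swap_inv, ← mul_assoc, Equiv.mul_swap_eq_swap_mul]
      group
    rw [e3, cc_conj]
    ring
  linarith


/-- the standard pairing -/
def mu0 (n : ℕ) : Perm (Fin n × Bool) where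
  toFun a := (a.1, !a.2)
  invFun a := (a.1, !a.2)
  left_inv a := by simp
  right_inv a := by simp

lemma mu0_apply (n : ℕ) (a : Fin n × Bool) : mu0 n a = (a.1, !a.2) := rfl

lemma cc_image {n : ℕ} (ν : Perm (Fin n × Bool)) (S : Finset (Fin n × Bool))
    (h : ∀ a, ν a ∈ S ↔ a ∈ S) (h1 : ∀ a ∈ S, (ν a).1 = a.1)
    (h2 : ∀ a ∈ S, ∀ b ∈ S, a.1 = b.1 → a = b ∨ ν a = b) :
    cycleCount (ν.subtypePerm (p := fun a => a ∈ S) h) = (S.image Prod.fst).card := by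
  rw [cc_eq]
  let f : Quotient (SameCycle.setoid (ν.subtypePerm (p := fun a => a ∈ S) h)) →
      {q // q ∈ S.image Prod.fst} :=
    fun q => Quotient.liftOn q (fun a => ⟨a.1.1, Finset.mem_image_of_mem _ a.2⟩) (by
      intro a b hab
      apply Subtype.ext
      have := inv_sameCycle _ (fun z : {a // a ∈ S} => decide (z.1.1 = a.1.1)) (by
        intro z
        simp [h1 z.1 z.2]) hab
      simpa [eq_comm] using this)
  have hf : Function.Bijective f := by
    constructor
    · intro q q'
      induction q using Quotient.inductionOn with
      | _ a =>
      induction q' using Quotient.inductionOn with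
      | _ b =>
      intro hq
      apply Quotient.sound
      apply sameCycle_subtypePerm.2
      rcases h2 a.1 a.2 b.1 b.2 (congrArg Subtype.val hq) with h | h
      · rw [h]
      · exact ⟨1, by simpa using h⟩
    · rintro ⟨q, hq⟩
      obtain ⟨a, ha, rfl⟩ := Finset.mem_image.1 hq
      exact ⟨Quotient.mk _ ⟨a, ha⟩, rfl⟩
  rw [Nat.card_congr (Equiv.ofBijective f hf), Nat.card_eq_fintype_card, Fintype.card_coe]

/-- falling times rising -/
noncomputable def LR (x : ℝ) (p r : ℕ) : ℝ :=
  (∏ i ∈ Finset.range r, (x - i)) * ∏ i ∈ Finset.range (p - r), (x + i)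

lemma WW_A0 {n : ℕ} (x : ℝ) (T : Finset (Fin n)) :
    WW (fun σ => x ^ cycleCount (mu0 n * σ⁻¹)) (T ×ˢ Finset.univ) =
      (-1) ^ T.card * LR x (2 * n) (2 * T.card) := by
  rw [WW_A x (mu0 n) (T ×ˢ Finset.univ) (by intro a; simp [mu0_apply]), cc_image]
  · have : (T ×ˢ (Finset.univ : Finset Bool)).image Prod.fst = T := by
      ext i; simp
    rw [this, LR, Finset.card_product]
    simp [mul_comm n 2, mul_comm T.card 2, mul_assoc]
  · intro a _; rfl
  · rintro ⟨i, b⟩ _ ⟨j, c⟩ _ hij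
    simp only at hij
    subst hij
    cases b <;> cases c <;> simp [mu0_apply]

lemma WW_B0 {n : ℕ} (x : ℝ) (T : Finset (Fin n)) (a : Fin n × Bool) (ha : a.1 ∉ T) :
    x * WW (fun σ => x ^ cycleCount (mu0 n * σ⁻¹)) (insert a (T ×ˢ Finset.univ)) =
      (-1) ^ (T.card + 1) * LR x (2 * n) (2 * T.card + 1) := by
  obtain ⟨i, c⟩ := a
  simp only at ha
  have hν : ∀ z : Fin n × Bool, (swap (i, c) (i, !c) * mu0 n) z = if z.1 = i then z else mu0 n z := by
    rintro ⟨j, d⟩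
    by_cases hj : j = i
    · subst hj
      cases c <;> cases d <;> simp [mu0_apply]
    · rw [Perm.mul_apply, mu0_apply, if_neg hj, swap_apply_of_ne_of_ne] <;> simp [hj]
  rw [WW_B x (mu0 n) _ (i, c) (i, !c) (by simp) (by simp [ha]) (by
    rintro ⟨j, d⟩
    rw [hν]
    by_cases hj : j = i
    · simp [hj]
    · simp [hj, mu0_apply]), cc_image]
  · have : (insert (i, c) (T ×ˢ (Finset.univ : Finset Bool))).image Prod.fst = insert i T := by
      ext j; simp
    rw [this, LR, Finset.card_insert_of_notMem ha, Finset.card_insert_of_notMem (by simp [ha]),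
      Finset.card_product]
    simp [mul_comm n 2, mul_comm T.card 2, mul_assoc]
  · intro a _; rw [hν]; split_ifs <;> rfl
  · rintro ⟨j, b⟩ hj ⟨k, d⟩ hk hij
    simp only at hij
    subst hij
    rw [hν]
    simp only [Finset.mem_insert, Prod.mk.injEq, Finset.mem_product, Finset.mem_univ, and_true] at hj hk
    by_cases hji : j = i
    · subst hji
      left
      simp only [ha, or_false, true_and] at hj hk
      rw [hj, hk]
    · cases b <;> cases d <;> simp [mu0_apply, hji]

lemma sum_sets {n : ℕ} (g : Finset (Fin n × Bool) → ℝ)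
    (hg : ∀ S a a', a ∈ S → a' ∈ S → a ≠ a' → mu0 n a ∉ S → mu0 n a' ∉ S → g S = 0) :
    ∑ S, g S = ∑ T : Finset (Fin n), g (T ×ˢ Finset.univ) +
      ∑ T : Finset (Fin n), ∑ a : Fin n × Bool,
        if a.1 ∉ T then g (insert a (T ×ˢ Finset.univ)) else 0 := by
  classical
  have aux : ∀ (S : Finset (Fin n × Bool)) j b c, (j, c) ∈ S → (j, !c) ∈ S → (j, b) ∈ S := by
    intro S j b c h h'
    cases b <;> cases c <;> first | exact h | exact h'
  rw [← Finset.sum_filter_add_sum_filter_not Finset.univ (fun S => ∀ a ∈ S, mu0 n a ∈ S)]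
  congr 1
  · symm
    refine Finset.sum_bij (fun T _ => T ×ˢ Finset.univ) ?_ ?_ ?_ ?_
    · intro T _
      simp [mu0_apply]
    · intro T _ T' _ h
      ext i
      have := congrArg (fun S => (i, true) ∈ S) h
      simpa using this
    · intro S hS
      simp only [Finset.mem_filter, Finset.mem_univ, true_and] at hS
      refine ⟨S.image Prod.fst, Finset.mem_univ _, ?_⟩
      ext ⟨i, b⟩
      simp only [Finset.mem_product, Finset.mem_image, Finset.mem_univ, and_true]
      constructor
      · rintro ⟨⟨j, c⟩, h1, rfl⟩
        have := hS _ h1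
        rw [mu0_apply] at this
        exact aux S j b c h1 this
      · intro h
        exact ⟨_, h, rfl⟩
    · intro T _; rfl
  · rw [← Finset.sum_product', ← Finset.sum_filter]
    symm
    refine Finset.sum_of_injOn (fun Ta => insert Ta.2 (Ta.1 ×ˢ Finset.univ)) ?_ ?_ ?_ ?_
    · rintro ⟨T, i, b⟩ h ⟨T', i', b'⟩ h' heq
      simp only [Finset.coe_filter, Finset.mem_product, Finset.mem_univ, true_and, and_true,
        Set.mem_ofPred_eq] at h h' heq
      have hm : ∀ j c, ((j = i ∧ c = b) ∨ j ∈ T) ↔ ((j = i' ∧ c = b') ∨ j ∈ T') := by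
        intro j c
        have := congrArg (fun S => (j, c) ∈ S) heq
        simpa using this
      have hT : T = T' := by
        ext j
        have ht := hm j true
        have hf := hm j false
        cases b <;> cases b' <;> simp at ht hf <;> tauto
      subst hT
      have := (hm i b).1 (Or.inl ⟨rfl, rfl⟩)
      simp only [h, or_false] at this
      simp [this.1, this.2]
    · rintro ⟨T, i, b⟩ h
      simp only [Finset.coe_filter, Finset.mem_product, Finset.mem_univ, true_and, and_true,
        Set.mem_ofPred_eq] at h ⊢
      intro h2
      have := h2 (i, b) (by simp)
      simp [mu0_apply, h] at this
    · intro S hS hS'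
      simp only [Finset.mem_filter, Finset.mem_univ, true_and, not_forall] at hS
      obtain ⟨⟨i, b⟩, ha, hb⟩ := hS
      by_contra hg0
      apply hS'
      have hu : ∀ a' ∈ S, a' ≠ (i, b) → mu0 n a' ∈ S := by
        intro a' h1 h2
        by_contra h3
        exact hg0 (hg S _ _ ha h1 h2.symm hb h3)
      have hb' : (i, !b) ∉ S := hb
      refine ⟨((S.erase (i, b)).image Prod.fst, (i, b)), ?_, ?_⟩
      · simp only [Finset.coe_filter, Finset.mem_product, Finset.mem_univ, true_and, and_true,
          Set.mem_ofPred_eq, Finset.mem_image, Finset.mem_erase, not_exists, not_and]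
        rintro ⟨j, c⟩ ⟨h1, h2⟩ rfl
        have hc : c = !b := by
          cases b <;> cases c <;> first | rfl | exact absurd rfl h1
        rw [hc] at h2
        exact hb' h2
      · ext ⟨j, c⟩
        simp only [Finset.mem_insert, Finset.mem_product, Finset.mem_univ, and_true,
          Finset.mem_image, Finset.mem_erase]
        constructor
        · rintro (h | ⟨⟨k, d⟩, ⟨h1, h2⟩, rfl⟩)
          · rw [h]; exact ha
          · have := hu _ h2 h1
            rw [mu0_apply] at this
            exact aux S k c d h2 this
        · intro h
          by_cases h3 : (j, c) = (i, b)
          · exact Or.inl h3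
          · exact Or.inr ⟨(j, c), ⟨h3, h⟩, rfl⟩
    · intro Ta _; rfl

lemma full_mu0 (n : ℕ) (x : ℝ) (hx : x ≠ 0) :
    (2 * n : ℝ) * ∑ σ : Perm (Fin n × Bool),
      (if cycleCount σ = 1 then x ^ cycleCount (mu0 n * σ⁻¹) else 0) =
    ∑ m ∈ Finset.range (n + 1), (n.choose m : ℝ) * ((-1) ^ m *
      (2 * (n - m)) * (LR x (2 * n) (2 * m) - (2 * n - 2 * m - 1) * (LR x (2 * n) (2 * m + 1) / x))) := by
  have h := full_sum (fun σ : Perm (Fin n × Bool) => x ^ cycleCount (mu0 n * σ⁻¹))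
  have hc : (Fintype.card (Fin n × Bool) : ℝ) = 2 * n := by
    simp [mul_comm]
  rw [hc] at h
  rw [h, sum_sets _ (by
    intro S a a' h1 h2 h3 h4 h5
    rw [WW_C x (mu0 n) S a a' h1 h2 h3 h4 h5, mul_zero]), ← Finset.sum_add_distrib]
  have key : ∀ T : Finset (Fin n),
      (2 * n - ((T ×ˢ (Finset.univ : Finset Bool)).card : ℝ)) *
        WW (fun σ => x ^ cycleCount (mu0 n * σ⁻¹)) (T ×ˢ Finset.univ) +
      ∑ a : Fin n × Bool, (if a.1 ∉ T then
        (2 * n - ((insert a (T ×ˢ (Finset.univ : Finset Bool))).card : ℝ)) *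
        WW (fun σ => x ^ cycleCount (mu0 n * σ⁻¹)) (insert a (T ×ˢ Finset.univ)) else 0) =
      (-1) ^ T.card *
      (2 * (n - T.card)) * (LR x (2 * n) (2 * T.card) -
        (2 * n - 2 * T.card - 1) * (LR x (2 * n) (2 * T.card + 1) / x)) := by
    intro T
    have h1 : ∀ a : Fin n × Bool, (if a.1 ∉ T then
        (2 * n - ((insert a (T ×ˢ (Finset.univ : Finset Bool))).card : ℝ)) *
        WW (fun σ => x ^ cycleCount (mu0 n * σ⁻¹)) (insert a (T ×ˢ Finset.univ)) else 0) =
        if a.1 ∉ T then (2 * n - (2 * T.card + 1)) *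
          ((-1) ^ (T.card + 1) * LR x (2 * n) (2 * T.card + 1) / x) else 0 := by
      intro a
      by_cases ha : a.1 ∈ T
      · simp [ha]
      · rw [if_pos ha, if_pos ha, ← WW_B0 x T a ha, mul_div_cancel_left₀ _ hx, Finset.card_insert_of_notMem (by simp [ha]),
          Finset.card_product]
        simp [mul_comm]
    simp_rw [h1]
    rw [WW_A0, ← Finset.sum_filter, Finset.sum_const, nsmul_eq_mul]
    have h2 : (Finset.univ.filter (fun a : Fin n × Bool => a.1 ∉ T)) = Tᶜ ×ˢ Finset.univ := by
      ext; simp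
    have h3 : T.card ≤ n := by simpa using Finset.card_le_univ T
    rw [h2, Finset.card_product, Finset.card_product, Finset.card_compl]
    simp only [Finset.card_univ, Fintype.card_bool, Fintype.card_fin]
    rw [Nat.cast_mul, Nat.cast_mul, Nat.cast_sub h3, pow_succ]
    push_cast
    ring
  rw [Finset.sum_congr rfl (fun T _ => key T)]
  rw [← Finset.powerset_univ]
  rw [Finset.sum_powerset_apply_card (fun m => (-1 : ℝ) ^ m *
      (2 * (n - m)) * (LR x (2 * n) (2 * m) -
        (2 * n - 2 * m - 1) * (LR x (2 * n) (2 * m + 1) / x)))]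
  simp


open PowerSeries in
/-- the series of `(1 - X)^(-(d+1))` -/
noncomputable def PS (d : ℕ) : ℝ⟦X⟧ := PowerSeries.mk fun n => ((d + n).choose d : ℝ)

open PowerSeries in
lemma PS_mul (d : ℕ) : PS d * (1 - X) ^ (d + 1) = 1 := by
  unfold PS
  have := mk_one_pow_eq_mk_choose_add ℝ d
  rw [← this, ← mul_pow, mk_one_mul_one_sub_eq_one, one_pow]

open PowerSeries in
lemma PS_add (d e : ℕ) : PS d = (1 - X) ^ e * PS (d + e) := by
  have h1 := PS_mul d
  have h2 := PS_mul (d + e)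
  calc PS d = PS d * (PS (d + e) * (1 - X) ^ (d + e + 1)) := by rw [h2, mul_one]
    _ = (1 - X) ^ e * PS (d + e) * (PS d * (1 - X) ^ (d + 1)) := by ring
    _ = _ := by rw [h1, mul_one]

open PowerSeries in
lemma coeff_PS (d r N : ℕ) (h : r ≤ d) :
    coeff N (X ^ r * PS d) = ((N + d - r).choose d : ℝ) := by
  rw [coeff_X_pow_mul']
  split_ifs with h1
  · rw [PS, coeff_mk]
    congr 2
    omega
  · rw [Nat.choose_eq_zero_of_lt (by omega)]
    simp

lemma sum_m {R : Type*} [CommRing R] (k : ℕ) (y : R) :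
    (∑ m ∈ Finset.range (k + 1), (k.choose m : R) * m * y ^ m) * (1 + y) = k * y * (1 + y) ^ k := by
  cases k with
  | zero => simp
  | succ k =>
    rw [Finset.sum_range_succ']
    have : ∀ m ∈ Finset.range (k + 1), ((k+1).choose (m+1) : R) * ((m + 1 : ℕ) : R) * y ^ (m+1) =
        ((k : R) + 1) * y * (y ^ m * (1 : R) ^ (k - m) * (k.choose m : R)) := by
      intro m _
      have := Nat.add_one_mul_choose_eq k m
      have h2 := congrArg (fun z : ℕ => (z : R)) this
      push_cast at h2 ⊢
      rw [← h2, one_pow]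
      ring
    rw [Finset.sum_congr rfl this, ← Finset.mul_sum, ← add_pow]
    push_cast
    ring

lemma sum_0 {R : Type*} [CommRing R] (k : ℕ) (y : R) :
    (∑ m ∈ Finset.range (k + 1), (k.choose m : R) * y ^ m) = (1 + y) ^ k := by
  rw [add_comm 1 y, add_pow]
  refine Finset.sum_congr rfl fun m _ => ?_
  simp [mul_comm]

open PowerSeries in
lemma series_id (k : ℕ) :
    ∑ m ∈ Finset.range (k + 1), C ((-1 : ℝ) ^ m * (k.choose m : ℝ)) *
      (C (2 * k + 2 : ℝ) * (X ^ (2 * m + 1) * PS (2 * k + 2)) +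
        C (2 * m : ℝ) * (X ^ (2 * m) * PS (2 * k + 1)) -
        C (2 * k + 1 - 2 * m : ℝ) * (X ^ (2 * m + 1) * PS (2 * k + 1))) =
    ∑ j ∈ Finset.range (k + 2), C (2 ^ j * ((k + 1).choose j : ℝ)) * (X ^ (j + 1) * PS (j + 1)) := by
  set P := PS (2 * k + 2) with hP
  have e1 : PS (2 * k + 1) = (1 - X) * P := by rw [PS_add (2 * k + 1) 1]; simp [hP]
  have hL : ∀ m ∈ Finset.range (k + 1), C ((-1 : ℝ) ^ m * (k.choose m : ℝ)) *
      (C (2 * k + 2 : ℝ) * (X ^ (2 * m + 1) * PS (2 * k + 2)) +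
        C (2 * m : ℝ) * (X ^ (2 * m) * PS (2 * k + 1)) -
        C (2 * k + 1 - 2 * m : ℝ) * (X ^ (2 * m + 1) * PS (2 * k + 1))) =
      P * (X + (2 * (k : ℝ⟦X⟧) + 1) * X ^ 2) * ((k.choose m : ℝ⟦X⟧) * (-X ^ 2) ^ m) +
      2 * P * ((k.choose m : ℝ⟦X⟧) * (m : ℝ⟦X⟧) * (-X ^ 2) ^ m * (1 + - X ^ 2)) := by
    intro m _
    rw [e1, ← hP]
    simp only [map_add, map_sub, map_mul, map_pow, map_neg, map_one, map_natCast, map_ofNat]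
    rw [neg_pow (X ^ 2 : ℝ⟦X⟧) m]
    ring
  rw [Finset.sum_congr rfl hL, Finset.sum_add_distrib, ← Finset.mul_sum, ← Finset.mul_sum,
    ← Finset.sum_mul, sum_m, sum_0]
  have hR : ∀ j ∈ Finset.range (k + 2),
      C (2 ^ j * ((k + 1).choose j : ℝ)) * (X ^ (j + 1) * PS (j + 1)) =
      P * X * (1 - X) ^ k * ((2 * X) ^ j * (1 - X) ^ (k + 1 - j) * ((k + 1).choose j : ℝ⟦X⟧)) := by
    intro j hj
    have hj' : j ≤ k + 1 := by simp at hj; omega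
    rw [PS_add (j + 1) (k + (k + 1 - j))]
    have : j + 1 + (k + (k + 1 - j)) = 2 * k + 2 := by omega
    rw [this, ← hP]
    simp only [map_mul, map_pow, map_natCast, map_ofNat]
    ring
  rw [Finset.sum_congr rfl hR, ← Finset.mul_sum, ← add_pow]
  have e2 : (2 * X + (1 - X) : ℝ⟦X⟧) = 1 + X := by ring
  have e3 : (1 + - X ^ 2 : ℝ⟦X⟧) = (1 - X) * (1 + X) := by ring
  rw [e2, e3, mul_pow]
  ring

lemma binom_id (k N : ℕ) :
    ∑ m ∈ Finset.range (k + 1), (-1 : ℝ) ^ m * (k.choose m : ℝ) *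
      ((N : ℝ) * ((N + (2 * k + 1) - 2 * m).choose (2 * k + 1) : ℝ) -
        (2 * k + 1 - 2 * m) * ((N + (2 * k + 1) - (2 * m + 1)).choose (2 * k + 1) : ℝ)) =
    ∑ j ∈ Finset.range (k + 2), 2 ^ j * ((k + 1).choose j : ℝ) * (N.choose (j + 1) : ℝ) := by
  have h := congrArg (PowerSeries.coeff N) (series_id k)
  have ca := (PowerSeries.coeff (R := ℝ) N).map_add
  have cs := (PowerSeries.coeff (R := ℝ) N).map_sub
  simp only [map_sum, PowerSeries.coeff_C_mul, ca, cs] at h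
  have hR : ∀ j ∈ Finset.range (k + 2), 2 ^ j * ((k + 1).choose j : ℝ) * (N.choose (j + 1) : ℝ) =
      2 ^ j * ((k + 1).choose j : ℝ) * PowerSeries.coeff N (PowerSeries.X ^ (j + 1) * PS (j + 1)) := by
    intro j _
    rw [coeff_PS _ _ _ le_rfl]
    simp
  rw [Finset.sum_congr rfl hR, ← h]
  refine Finset.sum_congr rfl fun m hm => ?_
  have hm' : m ≤ k := by simp at hm; omega
  rw [coeff_PS _ _ _ (by omega), coeff_PS _ _ _ (by omega), coeff_PS _ _ _ (by omega)]
  have e : N + (2 * k + 2) - (2 * m + 1) = N + (2 * k + 1) - 2 * m := by omega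
  rw [e]
  have key : (N : ℝ) * ((N + (2 * k + 1) - 2 * m).choose (2 * k + 1) : ℝ) =
      (2 * k + 2) * ((N + (2 * k + 1) - 2 * m).choose (2 * k + 2) : ℝ) +
        2 * m * ((N + (2 * k + 1) - 2 * m).choose (2 * k + 1) : ℝ) := by
    have := Nat.choose_succ_right_eq (N + (2 * k + 1) - 2 * m) (2 * k + 1)
    by_cases hN : 2 * m ≤ N
    · have h2 : N + (2 * k + 1) - 2 * m - (2 * k + 1) = N - 2 * m := by omega
      rw [h2] at this
      have h3 := congrArg (fun z : ℕ => (z : ℝ)) this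
      rw [Nat.cast_mul, Nat.cast_mul, Nat.cast_sub hN] at h3
      push_cast at h3
      linear_combination -h3
    · rw [Nat.choose_eq_zero_of_lt (by omega), Nat.choose_eq_zero_of_lt (by omega)]
      simp
  rw [key]

lemma LR_nat (N d r : ℕ) (h : r ≤ d) :
    LR N (d + 1) r = N * (d.factorial * ((N + d - r).choose d : ℝ)) := by
  have h1 : (∏ i ∈ Finset.range r, ((N : ℝ) - i)) = (N.descFactorial r : ℝ) := by
    rw [Nat.descFactorial_eq_prod_range]
    by_cases hr : r ≤ N
    · push_cast
      refine Finset.prod_congr rfl fun i hi => ?_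
      rw [Nat.cast_sub]
      have := Finset.mem_range.1 hi
      omega
    · rw [Finset.prod_eq_zero (i := N) (Finset.mem_range.2 (by omega)) (by simp)]
      rw [Finset.prod_eq_zero (i := N) (Finset.mem_range.2 (by omega)) (by simp)]
      simp
  have h2 : (∏ i ∈ Finset.range (d + 1 - r), ((N : ℝ) + i)) = (N.ascFactorial (d - r + 1) : ℝ) := by
    rw [Nat.ascFactorial_eq_prod_range]
    push_cast
    have : d + 1 - r = d - r + 1 := by omega
    rw [this]
  rw [LR, h1, h2]
  have h3 : N.descFactorial r * N.ascFactorial (d - r + 1) =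
      N * (d.factorial * (N + d - r).choose d) := by
    have h4 : N.ascFactorial (d - r + 1) = N * (N + 1).ascFactorial (d - r) := by
      rw [Nat.ascFactorial_succ, ← Nat.succ_ascFactorial]
    rw [← Nat.descFactorial_eq_factorial_mul_choose, h4]
    by_cases hr : r ≤ N
    · have a1 := Nat.factorial_mul_descFactorial hr
      have a2 := Nat.factorial_mul_ascFactorial N (d - r)
      have a3 := Nat.factorial_mul_descFactorial (n := N + d - r) (k := d) (by omega)
      have a4 : N + d - r - d = N - r := by omega
      have a5 : N + (d - r) = N + d - r := by omega
      rw [a4] at a3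
      rw [a5] at a2
      apply Nat.eq_of_mul_eq_mul_left (Nat.factorial_pos (N - r))
      calc _ = N * (((N - r).factorial * N.descFactorial r) * (N+1).ascFactorial (d - r)) := by ring
        _ = N * ((N - r).factorial * (N + d - r).descFactorial d) := by rw [a1, a2, a3]
        _ = _ := by ring
    · rw [Nat.descFactorial_of_lt (by omega), Nat.descFactorial_of_lt (by omega)]
      simp
  exact_mod_cast h3

/-- right-hand side at a natural number -/
noncomputable def GG (n N : ℕ) : ℝ :=
  ∑ j ∈ Finset.range (n + 1), 2 ^ j * (n.choose j : ℝ) * (N.choose (j + 1) : ℝ)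

lemma full_mu0' (n N : ℕ) (hn : 1 ≤ n) (hN : 1 ≤ N) :
    ∑ σ : Perm (Fin n × Bool),
      (if cycleCount σ = 1 then (N : ℝ) ^ cycleCount (mu0 n * σ⁻¹) else 0) =
    (2 * n - 1).factorial * GG n N := by
  obtain ⟨k, rfl⟩ : ∃ k, n = k + 1 := ⟨n - 1, by omega⟩
  have hN0 : (N : ℝ) ≠ 0 := by positivity
  have hn0 : (2 * ((k + 1 : ℕ) : ℝ)) ≠ 0 := by positivity
  have h := full_mu0 (k + 1) N hN0
  apply mul_left_cancel₀ hn0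
  rw [h, GG, ← binom_id, Finset.mul_sum, Finset.mul_sum, Finset.sum_range_succ]
  simp only [sub_self, mul_zero, zero_mul, add_zero]
  refine Finset.sum_congr rfl fun m hm => ?_
  have hm' : m ≤ k := by simp at hm; omega
  have e : 2 * (k + 1) = (2 * k + 1) + 1 := by ring
  have e' : 2 * (k + 1) - 1 = 2 * k + 1 := by omega
  rw [e', e, LR_nat _ _ _ (by omega), LR_nat _ _ _ (by omega)]
  have hc : ((k + 1).choose m : ℝ) * ((k : ℝ) + 1 - m) = (k + 1) * (k.choose m : ℝ) := by
    have := Nat.choose_mul_succ_eq k m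
    have h3 := congrArg (fun z : ℕ => (z : ℝ)) this
    rw [Nat.cast_mul, Nat.cast_mul, Nat.cast_sub (by omega)] at h3
    push_cast at h3
    linear_combination -h3
  rw [mul_div_cancel_left₀ _ hN0]
  push_cast
  linear_combination (2 * (-1) ^ m * (((2 * k + 1).factorial : ℝ) *
    ((N : ℝ) * ((N + (2 * k + 1) - 2 * m).choose (2 * k + 1) : ℝ) -
        (2 * k + 1 - 2 * m) * ((N + (2 * k + 1) - (2 * m + 1)).choose (2 * k + 1) : ℝ)))) * hc


def IsPr {α : Type*} (μ : Perm α) : Prop := (∀ i, μ (μ i) = i) ∧ (∀ i, μ i ≠ i)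

lemma pr_cycleType {α : Type*} [Fintype α] [DecidableEq α] (n : ℕ) (hc : Fintype.card α = 2 * n)
    (μ : Perm α) : IsPr μ ↔ μ.cycleType = Multiset.replicate n 2 := by
  have hp : Fact (Nat.Prime 2) := ⟨Nat.prime_two⟩
  constructor
  · rintro ⟨h1, h2⟩
    have h3 : μ ^ 2 = 1 := by
      ext i
      simp [pow_two, h1]
    rw [pow_prime_eq_one_iff] at h3
    have h4 := Multiset.eq_replicate_card.2 h3
    have h5 := sum_cycleType μ
    have h6 : μ.support = Finset.univ := by
      ext i; simp [h2]
    rw [h6, Finset.card_univ, hc, h4, Multiset.sum_replicate, smul_eq_mul] at h5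
    have h7 : μ.cycleType.card = n := by omega
    rw [h4, h7]
  · intro h
    have h3 : μ ^ 2 = 1 := by
      rw [pow_prime_eq_one_iff, h]
      intro c hc
      exact Multiset.eq_of_mem_replicate hc
    have h5 := sum_cycleType μ
    rw [h, Multiset.sum_replicate, smul_eq_mul] at h5
    have h6 : μ.support = Finset.univ := by
      apply Finset.eq_univ_of_card
      omega
    refine ⟨fun i => ?_, fun i => ?_⟩
    · have := congrArg (fun g : Perm α => g i) h3
      simpa [pow_two] using this
    · have : i ∈ μ.support := by rw [h6]; simp
      simpa using this

lemma pr_mu0 (n : ℕ) : IsPr (mu0 n) := by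
  refine ⟨fun i => ?_, fun i => ?_⟩
  · simp [mu0_apply]
  · intro h
    rw [mu0_apply] at h
    have := congrArg Prod.snd h
    simp at this

lemma pr_equiv (n : ℕ) (μ : Perm (Fin (2 * n))) (h : IsPr μ) :
    ∃ e : Fin (2 * n) ≃ Fin n × Bool, ∀ a, e (μ a) = mu0 n (e a) := by
  have hcard : Fintype.card (Fin (2 * n)) = Fintype.card (Fin n × Bool) := by
    simp [mul_comm]
  let e0 : Fin (2 * n) ≃ Fin n × Bool := Fintype.equivOfCardEq hcard
  let ν : Perm (Fin n × Bool) := e0.permCongr μ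
  have hν : IsPr ν := by
    refine ⟨fun i => ?_, fun i hi => ?_⟩
    · simp [ν, Equiv.permCongr_apply, h.1]
    · have := congrArg e0.symm hi
      simp [ν, Equiv.permCongr_apply] at this
      exact h.2 _ this
  have hc : Fintype.card (Fin n × Bool) = 2 * n := by simp [mul_comm]
  have h1 := (pr_cycleType n hc ν).1 hν
  have h2 := (pr_cycleType n hc (mu0 n)).1 (pr_mu0 n)
  obtain ⟨g, hg⟩ := isConj_iff.1 (isConj_iff_cycleType_eq.2 (h1.trans h2.symm))
  refine ⟨e0.trans g, fun a => ?_⟩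
  rw [← hg]
  simp [ν, Equiv.permCongr_apply]

lemma pr_exists (n : ℕ) : ∃ μ : Perm (Fin (2 * n)), IsPr μ := by
  have hcard : Fintype.card (Fin (2 * n)) = Fintype.card (Fin n × Bool) := by
    simp [mul_comm]
  let e0 : Fin (2 * n) ≃ Fin n × Bool := Fintype.equivOfCardEq hcard
  refine ⟨e0.symm.permCongr (mu0 n), fun i => ?_, fun i hi => ?_⟩
  · simp [Equiv.permCongr_apply, (pr_mu0 n).1]
  · have := congrArg e0 hi
    simp [Equiv.permCongr_apply] at this
    exact (pr_mu0 n).2 _ this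

lemma F_mu (n N : ℕ) (hn : 1 ≤ n) (hN : 1 ≤ N) (μ : Perm (Fin (2 * n))) (h : IsPr μ) :
    ∑ σ : Perm (Fin (2 * n)),
      (if cycleCount σ = 1 then (N : ℝ) ^ cycleCount (μ * σ⁻¹) else 0) =
    (2 * n - 1).factorial * GG n N := by
  obtain ⟨e, he⟩ := pr_equiv n μ h
  rw [← full_mu0' n N hn hN]
  refine Fintype.sum_equiv e.permCongr _ _ fun σ => ?_
  have h1 : cycleCount σ = cycleCount (e.permCongr σ) :=
    cc_of_equiv _ _ e fun a => by simp [Equiv.permCongr_apply]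
  have h2 : cycleCount (μ * σ⁻¹) = cycleCount (mu0 n * (e.permCongr σ)⁻¹) := by
    refine cc_of_equiv _ _ e fun a => ?_
    rw [Perm.mul_apply, he, Perm.mul_apply]
    congr 1
    rw [Perm.eq_inv_iff_eq]
    simp [Equiv.permCongr_apply]
  rw [h1, h2]

lemma full_conj (p : ℕ) (hp : 2 ≤ p) (σ : Perm (Fin p)) (h : cycleCount σ = 1) :
    ∃ g : Perm (Fin p), g * finRotate p * g⁻¹ = σ := by
  rw [cc_eq, Nat.card_eq_one_iff_unique] at h
  have hs : ∀ a b, σ.SameCycle a b := fun a b => by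
    have := h.1
    exact Quotient.exact (Subsingleton.elim (Quotient.mk (SameCycle.setoid σ) a) (Quotient.mk _ b))
  have hne : ∀ a, σ a ≠ a := by
    intro a ha
    have : Nontrivial (Fin p) := Fin.nontrivial_iff_two_le.2 hp
    obtain ⟨b, hb⟩ := exists_ne a
    exact hb ((hs a b).eq_of_left ha).symm
  have hsup : σ.support = Finset.univ := by ext i; simp [hne]
  have hcyc : IsCycle σ := ⟨⟨0, by omega⟩, hne _, fun b _ => hs _ b⟩
  have := (isCycle_finRotate_of_le hp).isConj hcyc (by rw [hsup, support_finRotate_of_le hp])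
  exact isConj_iff.1 this

lemma pr_conj {α : Type*} (g μ : Perm α) (h : IsPr μ) : IsPr (g * μ * g⁻¹) := by
  refine ⟨fun i => ?_, fun i hi => ?_⟩
  · simp [h.1]
  · have := congrArg (fun z => g⁻¹ z) hi
    simp at this
    exact h.2 _ this

open Classical in
/-- the generating function -/
noncomputable def AA (p : ℕ) (x : ℝ) : ℝ :=
  ∑ μ : Perm (Fin p), if IsPr μ then x ^ cycleCount (μ * (finRotate p)⁻¹) else 0

open Classical in
lemma AA_conj (p : ℕ) (hp : 2 ≤ p) (x : ℝ) (σ : Perm (Fin p)) (h : cycleCount σ = 1) :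
    ∑ μ : Perm (Fin p), (if IsPr μ then x ^ cycleCount (μ * σ⁻¹) else 0) = AA p x := by
  obtain ⟨g, rfl⟩ := full_conj p hp σ h
  symm
  rw [AA]
  refine Fintype.sum_equiv (MulAut.conj g).toEquiv _ _ fun μ => ?_
  have e : (MulAut.conj g).toEquiv μ = g * μ * g⁻¹ := rfl
  rw [e]
  have h1 : IsPr (g * μ * g⁻¹) ↔ IsPr μ := by
    refine ⟨fun h => ?_, pr_conj g μ⟩
    have := pr_conj g⁻¹ _ h
    simpa [mul_assoc] using this
  have h2 : g * μ * g⁻¹ * (g * finRotate p * g⁻¹)⁻¹ = g * (μ * (finRotate p)⁻¹) * g⁻¹ := by group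
  rw [h2, cc_conj]
  simp only [h1]

lemma GG_one (n : ℕ) : GG n 1 = 1 := by
  rw [GG, Finset.sum_range_succ']
  rw [Finset.sum_eq_zero]
  · simp
  · intro j _
    rw [Nat.choose_eq_zero_of_lt (n := 1) (by omega)]
    simp

open Classical in
lemma AA_nat (n N : ℕ) (hn : 1 ≤ n) (hN : 1 ≤ N) :
    AA (2 * n) N = (Finset.univ.filter fun μ : Perm (Fin (2 * n)) => IsPr μ).card * GG n N := by
  have hD : ∀ N : ℕ, 1 ≤ N →
      ∑ μ : Perm (Fin (2 * n)), ∑ σ : Perm (Fin (2 * n)),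
      (if IsPr μ then (if cycleCount σ = 1 then (N : ℝ) ^ cycleCount (μ * σ⁻¹) else 0) else 0) =
      (Finset.univ.filter fun μ : Perm (Fin (2 * n)) => IsPr μ).card *
        ((2 * n - 1).factorial * GG n N) := by
    intro N hN
    rw [← nsmul_eq_mul, ← Finset.sum_const, Finset.sum_filter]
    refine Finset.sum_congr rfl fun μ _ => ?_
    split_ifs with h
    · exact F_mu n N hn hN μ h
    · simp
  have hE : ∑ μ : Perm (Fin (2 * n)), ∑ σ : Perm (Fin (2 * n)),
      (if IsPr μ then (if cycleCount σ = 1 then (N : ℝ) ^ cycleCount (μ * σ⁻¹) else 0) else 0) =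
      (Finset.univ.filter fun σ : Perm (Fin (2 * n)) => cycleCount σ = 1).card * AA (2 * n) N := by
    rw [Finset.sum_comm, ← nsmul_eq_mul, ← Finset.sum_const, Finset.sum_filter]
    refine Finset.sum_congr rfl fun σ _ => ?_
    by_cases h : cycleCount σ = 1
    · simp only [h, if_true]
      exact AA_conj _ (by omega) _ σ h
    · simp [h]
  have hF : ((Finset.univ.filter fun σ : Perm (Fin (2 * n)) => cycleCount σ = 1).card : ℝ) =
      (2 * n - 1).factorial := by
    obtain ⟨μ, hμ⟩ := pr_exists n
    have := F_mu n 1 hn le_rfl μ hμ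
    rw [GG_one, mul_one] at this
    rw [← this, Finset.card_filter]
    push_cast
    simp
  have := hE.symm.trans (hD N hN)
  rw [hF] at this
  have h0 : ((2 * n - 1).factorial : ℝ) ≠ 0 := by positivity
  apply mul_left_cancel₀ h0
  rw [this]; ring

lemma dfact (n : ℕ) : ((2 * n).factorial : ℝ) =
    (∏ j ∈ Finset.Icc 1 n, (2 * (j : ℝ) - 1)) * (2 ^ n * n.factorial) := by
  induction n with
  | zero => simp
  | succ n ih =>
    rw [Finset.prod_Icc_succ_top (by omega), show 2 * (n + 1) = 2 * n + 1 + 1 by ring,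
      Nat.factorial_succ, Nat.factorial_succ, Nat.factorial_succ n]
    push_cast
    rw [ih]
    ring

open Classical in
lemma pr_card (n : ℕ) (hn : 1 ≤ n) :
    ((Finset.univ.filter fun μ : Perm (Fin (2 * n)) => IsPr μ).card : ℝ) =
      ∏ j ∈ Finset.Icc 1 n, (2 * (j : ℝ) - 1) := by
  have h := card_of_cycleType_mul_eq (Fin (2 * n)) (Multiset.replicate n 2)
  have hs : (Multiset.replicate n 2).sum = 2 * n := by simp [mul_comm]
  have ht : (Multiset.replicate n 2).toFinset = {2} := by
    rw [Multiset.toFinset_replicate, if_neg (by omega)]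
  rw [if_pos ⟨by simp [mul_comm], fun a ha => (Multiset.eq_of_mem_replicate ha).ge⟩, hs, ht,
    Fintype.card_fin, Nat.sub_self, Multiset.prod_replicate, Finset.prod_singleton,
    Multiset.count_replicate_self, Nat.factorial_zero, one_mul] at h
  have e : (Finset.univ.filter fun μ : Perm (Fin (2 * n)) => IsPr μ) =
      (Finset.univ.filter fun μ : Perm (Fin (2 * n)) => μ.cycleType = Multiset.replicate n 2) := by
    ext μ
    simp only [Finset.mem_filter, Finset.mem_univ, true_and]
    exact pr_cycleType n (by simp) μ
  rw [e]
  have h1 := congrArg (fun z : ℕ => (z : ℝ)) h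
  push_cast at h1
  rw [dfact] at h1
  have h0 : (2 ^ n * (n.factorial : ℝ)) ≠ 0 := by positivity
  apply mul_right_cancel₀ h0
  convert h1

lemma cc_bounds (p : ℕ) (hp : 1 ≤ p) (σ : Perm (Fin p)) : 1 ≤ cycleCount σ ∧ cycleCount σ ≤ p := by
  rw [cc_eq]
  constructor
  · have : Nonempty (Quotient (SameCycle.setoid σ)) := ⟨Quotient.mk _ ⟨0, by omega⟩⟩
    exact Nat.card_pos
  · have := Nat.card_le_card_of_surjective (Quotient.mk (SameCycle.setoid σ)) Quotient.mk_surjective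
    simpa using this

open Classical in
lemma hz_sum (n : ℕ) (hn : 1 ≤ n) (x : ℝ) :
    ∑ k ∈ Finset.Icc 1 (2 * n), (hzCount (2 * n) k : ℝ) * x ^ k = AA (2 * n) x := by
  rw [AA, ← Finset.sum_filter, ← Finset.sum_fiberwise_of_maps_to (t := Finset.Icc 1 (2 * n))
    (g := fun μ : Perm (Fin (2 * n)) => cycleCount (μ * (finRotate (2 * n))⁻¹))]
  · refine Finset.sum_congr rfl fun k _ => ?_
    have : ∀ μ ∈ (Finset.univ.filter fun μ : Perm (Fin (2 * n)) => IsPr μ).filter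
        (fun μ => cycleCount (μ * (finRotate (2 * n))⁻¹) = k),
        x ^ cycleCount (μ * (finRotate (2 * n))⁻¹) = x ^ k := by
      intro μ hμ
      rw [(Finset.mem_filter.1 hμ).2]
    rw [Finset.sum_congr rfl this, Finset.sum_const, nsmul_eq_mul, hzCount, Nat.card_eq_fintype_card,
      Fintype.card_subtype, Finset.filter_filter]
    congr 3
    ext μ
    simp [IsPr, and_assoc]
  · intro μ _
    exact Finset.mem_Icc.2 (cc_bounds _ (by omega) _)

lemma realChoose_nat (N k : ℕ) : realChoose N k = (N.choose k : ℝ) := by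
  have h1 : (∏ i ∈ Finset.range k, ((N : ℝ) - i)) = (N.descFactorial k : ℝ) := by
    rw [Nat.descFactorial_eq_prod_range]
    by_cases hr : k ≤ N
    · push_cast
      refine Finset.prod_congr rfl fun i hi => ?_
      rw [Nat.cast_sub]
      have := Finset.mem_range.1 hi
      omega
    · rw [Finset.prod_eq_zero (i := N) (Finset.mem_range.2 (by omega)) (by simp)]
      rw [Finset.prod_eq_zero (i := N) (Finset.mem_range.2 (by omega)) (by simp)]
      simp
  rw [realChoose, h1, Nat.descFactorial_eq_factorial_mul_choose]
  have h0 : (k.factorial : ℝ) ≠ 0 := by positivity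
  push_cast
  field_simp

lemma rhs_nat (n N : ℕ) : ∑ k ∈ Finset.Icc 1 (n + 1),
    2 ^ (k - 1) * (n.choose (k - 1) : ℝ) * realChoose N k = GG n N := by
  rw [GG, ← Finset.Ico_add_one_right_eq_Icc, Finset.sum_Ico_eq_sum_range]
  refine Finset.sum_congr (by simp) fun j _ => ?_
  rw [realChoose_nat, Nat.add_sub_cancel_left, add_comm 1 j]

lemma hz_nat (n N : ℕ) (hn : 1 ≤ n) (hN : 1 ≤ N) :
    ∑ k ∈ Finset.Icc 1 (2 * n), (hzCount (2 * n) k : ℝ) * (N : ℝ) ^ k =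
      (∏ j ∈ Finset.Icc 1 n, (2 * (j : ℝ) - 1)) *
        ∑ k ∈ Finset.Icc 1 (n + 1),
          2 ^ (k - 1) * (n.choose (k - 1) : ℝ) * realChoose N k := by
  rw [hz_sum n hn, AA_nat n N hn hN, pr_card n hn, rhs_nat]

open Polynomial in
lemma hz_real (n : ℕ) (hn : 1 ≤ n) (x : ℝ) :
    ∑ k ∈ Finset.Icc 1 (2 * n), (hzCount (2 * n) k : ℝ) * x ^ k =
      (∏ j ∈ Finset.Icc 1 n, (2 * (j : ℝ) - 1)) *
        ∑ k ∈ Finset.Icc 1 (n + 1),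
          2 ^ (k - 1) * (n.choose (k - 1) : ℝ) * realChoose x k := by
  let P : ℝ[X] := ∑ k ∈ Finset.Icc 1 (2 * n), C (hzCount (2 * n) k : ℝ) * X ^ k
  let Q : ℝ[X] := C (∏ j ∈ Finset.Icc 1 n, (2 * (j : ℝ) - 1)) *
        ∑ k ∈ Finset.Icc 1 (n + 1), C (2 ^ (k - 1) * (n.choose (k - 1) : ℝ)) *
          ((∏ t ∈ Finset.range k, (X - C (t : ℝ))) * C ((Nat.factorial k : ℝ)⁻¹))
  have hP : ∀ y, P.eval y = ∑ k ∈ Finset.Icc 1 (2 * n), (hzCount (2 * n) k : ℝ) * y ^ k := by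
    intro y
    simp only [P, eval_finsetSum, eval_mul, eval_C, eval_pow, eval_X]
  have hQ : ∀ y, Q.eval y = (∏ j ∈ Finset.Icc 1 n, (2 * (j : ℝ) - 1)) *
        ∑ k ∈ Finset.Icc 1 (n + 1),
          2 ^ (k - 1) * (n.choose (k - 1) : ℝ) * realChoose y k := by
    intro y
    simp only [Q, eval_finsetSum, eval_mul, eval_C, eval_prod, eval_sub, eval_X, realChoose,
      div_eq_mul_inv]
  rw [← hP, ← hQ]
  have : P = Q := by
    apply Polynomial.eq_of_infinite_eval_eq
    refine Set.Infinite.mono (s := Set.range fun N : ℕ => ((N + 1 : ℕ) : ℝ)) ?_ ?_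
    · rintro _ ⟨N, rfl⟩
      show P.eval _ = Q.eval _
      rw [hP, hQ]
      exact hz_nat n (N + 1) hn (by omega)
    · apply Set.infinite_range_of_injective
      intro a b h
      simpa using h
  rw [this]

end Helpers

/-- Harer–Zagier formula:
`A_p(x) = (2n-1)!! ∑_{k≥1} 2^(k-1) C(n, k-1) binom(x, k)` for `p = 2n`.
(The sums are truncated at indices beyond which all terms vanish:
a permutation of `2n` points has at most `2n` cycles, and `C(n, k-1) = 0` for `k > n+1`.) -/
theorem harer_zagier (n : ℕ) (hn : 1 ≤ n) (x : ℝ) :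
    ∑ k ∈ Finset.Icc 1 (2 * n), (hzCount (2 * n) k : ℝ) * x ^ k =
      (∏ j ∈ Finset.Icc 1 n, (2 * (j : ℝ) - 1)) *
        ∑ k ∈ Finset.Icc 1 (n + 1),
          2 ^ (k - 1) * (n.choose (k - 1) : ℝ) * realChoose x k := by
  exact hz_real n hn x
end

section
/- Let p, q, s ≥ 1 be integers of the same odd-even parity and let n = (p+q)/2. Then, as an identity of polynomials in x (equivalently, for every real number x), A^{(s)}_{p,q}(x) = p! q! Σ_{k=1}^{n+1} Σ_{i=0}^{⌊p/2⌋} Σ_{j=0}^{⌊q/2⌋} [ binom(x,k) · binom(n−i−j, k−1) / (2^{i+j} i! j! (n−i−j)!) ] · Δ^{(s)}_{k,p,q}, where Δ^{(s)}_{k,p,q} = binom(k−1, (p−s)/2 − i)·binom(k−1, (q−s)/2 − j) − binom(k−1, (p+s)/2 − i)·binom(k−1, (q+s)/2 − j), with the convention that binom(k−1, t) = 0 for integers t < 0 or t > k−1, and binom(x,k) = x(x−1)⋯(x−k+1)/k!. -/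
/-- `binom(a, b)` for integers, with the convention that it is `0` unless `0 ≤ b ≤ a`. -/
def ichoose (a b : ℤ) : ℤ := if 0 ≤ b ∧ b ≤ a then (a.toNat).choose b.toNat else 0

/-- `annCount p q s k = a^{(s)}_{p,q,k}`: the number of pairings (fixed-point-free
involutions) `μ` of `[p] ∪ [q]'` with exactly `s` mixed pairs such that
`μ ∘ γ_{p,q}⁻¹` has exactly `k` cycles, where `γ_{p,q} = (1 2 … p)(1' 2' … q')`. -/
noncomputable def annCount (p q s k : ℕ) : ℕ :=
  Nat.card {μ : Equiv.Perm (Fin p ⊕ Fin q) //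
    (∀ v, μ (μ v) = v) ∧ (∀ v, μ v ≠ v) ∧
    (Finset.univ.filter fun i : Fin p => (μ (Sum.inl i)).isRight).card = s ∧
    cycleCount (μ * (Equiv.sumCongr (finRotate p) (finRotate q))⁻¹) = k}



set_option linter.unusedSectionVars false
set_option linter.unusedSimpArgs false
set_option linter.deprecated false

namespace AGF
open MvPolynomial

section gauss
variable {I : Type} [Fintype I] [DecidableEq I]

lemma pd_comm (a b : I) (F : MvPolynomial I ℝ) :
    pderiv a (pderiv b F) = pderiv b (pderiv a F) := by
  ext m
  rw [coeff_pderiv, coeff_pderiv, coeff_pderiv, coeff_pderiv, add_right_comm]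
  by_cases h : a = b
  · subst h; rfl
  · have h' : b ≠ a := fun e => h e.symm
    simp [Finsupp.single_apply, h, h']
    ring

lemma pd_X_mul (a b : I) (F : MvPolynomial I ℝ) :
    pderiv b (X a * F) = (if a = b then F else 0) + X a * pderiv b F := by
  rw [pderiv_mul, pderiv_X]
  by_cases h : a = b
  · subst h; simp
  · simp [h, Pi.single_apply]

noncomputable def Aop (bar : I → I) (a : I) : Module.End ℝ (MvPolynomial I ℝ) :=
  LinearMap.mulLeft ℝ (X a) + (pderiv (bar a)).toLinearMap

lemma Aop_apply (bar : I → I) (a : I) (F : MvPolynomial I ℝ) :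
    Aop bar a F = X a * F + pderiv (bar a) F := rfl

lemma Aop_comm (bar : I → I) (hb : ∀ a, bar (bar a) = a) (a b : I) :
    Aop bar a * Aop bar b = Aop bar b * Aop bar a := by
  refine LinearMap.ext fun F => ?_
  simp only [Module.End.mul_apply, Aop_apply, map_add, pd_X_mul]
  rw [pd_comm (bar a) (bar b)]
  have : (b = bar a) ↔ (a = bar b) := by
    constructor <;> (intro h; rw [h, hb])
  simp only [this]
  ring

lemma exists_U (bar : I → I) (hb : ∀ a, bar (bar a) = a) :
    ∃ U : MvPolynomial I ℝ →ₗ[ℝ] MvPolynomial I ℝ, U 1 = 1 ∧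
      ∀ a F, U (X a * F) = X a * U F + pderiv (bar a) (U F) := by
  let _ : CommRing (Algebra.adjoin ℝ (Set.range (Aop bar))) :=
    Algebra.adjoinCommRingOfComm ℝ (by
      rintro _ ⟨a, rfl⟩ _ ⟨b, rfl⟩
      exact Aop_comm bar hb a b)
  let T : MvPolynomial I ℝ →ₐ[ℝ] (Algebra.adjoin ℝ (Set.range (Aop bar))) :=
    aeval (fun a => ⟨Aop bar a, Algebra.subset_adjoin ⟨a, rfl⟩⟩)
  let T' : MvPolynomial I ℝ →ₐ[ℝ] Module.End ℝ (MvPolynomial I ℝ) :=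
    (Algebra.adjoin ℝ (Set.range (Aop bar))).val.comp T
  have hT : ∀ a, T' (X a) = Aop bar a := by
    intro a
    simp [T', T]
  clear_value T'
  refine ⟨(LinearMap.applyₗ (1 : MvPolynomial I ℝ)) ∘ₗ T'.toLinearMap, ?_, ?_⟩
  · simp
  · intro a F
    simp [hT, Aop_apply]

lemma poly_ind {P : MvPolynomial I ℝ → Prop} (h1 : P 1) (hs : ∀ (c : ℝ) F, P F → P (c • F))
    (ha : ∀ F G, P F → P G → P (F + G)) (hX : ∀ a F, P F → P (X a * F)) (F) : P F := by
  induction F using MvPolynomial.induction_on with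
  | C c => rw [C_eq_smul_one]; exact hs _ _ h1
  | add F G hF hG => exact ha _ _ hF hG
  | mul_X F a hF => rw [mul_comm]; exact hX _ _ hF

variable {bar : I → I} {U : MvPolynomial I ℝ →ₗ[ℝ] MvPolynomial I ℝ}

lemma U_pd (h1 : U 1 = 1)
    (hX : ∀ a F, U (X a * F) = X a * U F + pderiv (bar a) (U F)) (b : I) (F) :
    pderiv b (U F) = U (pderiv b F) := by
  induction F using poly_ind with
  | h1 => simp [h1]
  | hs c F h => simp [h]
  | ha F G h h' => simp [h, h']
  | hX a F h =>
    rw [hX, map_add, pd_X_mul, pd_X_mul, map_add, pd_comm, h, hX, ← h]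
    split_ifs <;> simp [add_assoc]

noncomputable def Dop (bar : I → I) : MvPolynomial I ℝ →ₗ[ℝ] MvPolynomial I ℝ :=
  ∑ a, (pderiv (bar a)).toLinearMap ∘ₗ (pderiv a).toLinearMap

noncomputable def Eu : MvPolynomial I ℝ →ₗ[ℝ] MvPolynomial I ℝ :=
  ∑ a, LinearMap.mulLeft ℝ (X a) ∘ₗ (pderiv a).toLinearMap

noncomputable def Lop (bar : I → I) : MvPolynomial I ℝ →ₗ[ℝ] MvPolynomial I ℝ :=
  Eu - Dop bar

lemma Dop_apply (bar : I → I) (F : MvPolynomial I ℝ) :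
    Dop bar F = ∑ a, pderiv (bar a) (pderiv a F) := by simp [Dop]

lemma Eu_apply (F : MvPolynomial I ℝ) : Eu F = ∑ a, X a * pderiv a F := by simp [Eu]

lemma Lop_apply (bar : I → I) (F : MvPolynomial I ℝ) : Lop bar F = Eu F - Dop bar F := rfl

lemma U_L (h1 : U 1 = 1)
    (hX : ∀ a F, U (X a * F) = X a * U F + pderiv (bar a) (U F)) (F) :
    U (Lop bar F) = Eu (U F) := by
  rw [Lop_apply, map_sub, Eu_apply, Eu_apply, Dop_apply, map_sum, map_sum,
    ← Finset.sum_sub_distrib]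
  refine Finset.sum_congr rfl fun a _ => ?_
  rw [hX, U_pd h1 hX, U_pd h1 hX]; ring

lemma coeff_Eu (F : MvPolynomial I ℝ) (m : I →₀ ℕ) :
    coeff m (Eu F) = (m.degree : ℝ) * coeff m F := by
  rw [Eu_apply, coeff_sum, Finsupp.degree_eq_sum]
  push_cast
  rw [Finset.sum_mul]
  refine Finset.sum_congr rfl fun a _ => ?_
  rw [mul_comm, coeff_mul_X']
  split_ifs with h
  · rw [coeff_pderiv]
    have h0 : m a ≠ 0 := by simpa using h
    have : m - Finsupp.single a 1 + Finsupp.single a 1 = m :=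
      tsub_add_cancel_of_le (by simpa using Nat.one_le_iff_ne_zero.2 h0)
    rw [this, mul_comm]
    congr 1
    have : m a = (m a - 1) + 1 := by omega
    rw [this]; simp
  · have h0 : m a = 0 := by simpa using h
    simp [h0]

/-- degree bound -/
def DegLe (d : ℕ) (F : MvPolynomial I ℝ) : Prop := ∀ m : I →₀ ℕ, d < m.degree → coeff m F = 0

lemma exists_degLe (F : MvPolynomial I ℝ) : ∃ d, DegLe d F := by
  refine ⟨F.totalDegree, fun m hm => ?_⟩
  apply coeff_eq_zero_of_totalDegree_lt
  simpa [Finsupp.degree_apply] using hm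

lemma degLe_L {bar : I → I} {d : ℕ} {F : MvPolynomial I ℝ} (h : DegLe (d + 1) F) :
    DegLe d (Lop bar F - ((d + 1 : ℕ) : ℝ) • F) := by
  intro m hm
  rw [Lop_apply, coeff_sub, coeff_sub, coeff_Eu, coeff_smul, Dop_apply, coeff_sum]
  have : ∑ x, coeff m ((pderiv (bar x)) ((pderiv x) F)) = 0 := by
    refine Finset.sum_eq_zero fun a _ => ?_
    rw [coeff_pderiv, coeff_pderiv, h]
    · simp
    · simp; omega
  rw [this]
  rcases Nat.lt_or_ge (d + 1) m.degree with h2 | h2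
  · rw [h m h2]; simp
  · have : m.degree = d + 1 := by omega
    rw [this]; simp

lemma degLe_zero {F : MvPolynomial I ℝ} (h : DegLe 0 F) : ∃ c : ℝ, F = C c := by
  refine ⟨coeff 0 F, ?_⟩
  ext m
  rw [coeff_C]
  split_ifs with h0
  · rw [h0]
  · refine h m ?_
    rw [Nat.pos_iff_ne_zero]
    intro h1
    exact h0 ((Finsupp.degree_eq_zero_iff m).1 h1).symm

end gauss
end AGF

set_option linter.unusedSectionVars false
set_option linter.unusedSimpArgs false

namespace AGF
open MvPolynomial

section bil
variable {I : Type} [Fintype I] [DecidableEq I]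

noncomputable def Bf (bar : I → I) (E : MvPolynomial I ℝ →ₗ[ℝ] ℝ) :
    ℕ → (MvPolynomial I ℝ →ₗ[ℝ] MvPolynomial I ℝ →ₗ[ℝ] ℝ)
  | 0 => (LinearMap.mul ℝ ℝ).compl₁₂ E E
  | s + 1 => (1 / ((s : ℝ) + 1)) • ∑ e, (Bf bar E s).compl₁₂ (pderiv e).toLinearMap
      (pderiv (bar e)).toLinearMap

lemma Bf_zero (bar : I → I) (E : MvPolynomial I ℝ →ₗ[ℝ] ℝ) (F G) :
    Bf bar E 0 F G = E F * E G := rfl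

lemma Bf_succ (bar : I → I) (E : MvPolynomial I ℝ →ₗ[ℝ] ℝ) (s : ℕ) (F G) :
    Bf bar E (s + 1) F G =
      1 / ((s : ℝ) + 1) * ∑ e, Bf bar E s (pderiv e F) (pderiv (bar e) G) := by
  simp [Bf]

lemma Bf_succ' (bar : I → I) (E : MvPolynomial I ℝ →ₗ[ℝ] ℝ) (s : ℕ) (F G) :
    ∑ e, Bf bar E s (pderiv e F) (pderiv (bar e) G) = ((s : ℝ) + 1) * Bf bar E (s + 1) F G := by
  rw [Bf_succ]
  have : (s : ℝ) + 1 ≠ 0 := by positivity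
  field_simp

variable {bar : I → I} {E : MvPolynomial I ℝ →ₗ[ℝ] ℝ}

lemma E_L (hE : ∀ a F, E (X a * F) = E (pderiv (bar a) F)) (F) : E (Lop bar F) = 0 := by
  rw [Lop_apply, Eu_apply, Dop_apply, map_sub, map_sum, map_sum, ← Finset.sum_sub_distrib]
  refine Finset.sum_eq_zero fun a _ => ?_
  rw [hE, sub_self]

lemma L_pd (b : I) (F : MvPolynomial I ℝ) :
    pderiv b (Lop bar F) = Lop bar (pderiv b F) + pderiv b F := by
  rw [Lop_apply, Lop_apply, Eu_apply, Eu_apply, Dop_apply, Dop_apply, map_sub, map_sum, map_sum]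
  have h1 : ∀ a, pderiv b (X a * pderiv a F) =
      (if a = b then pderiv a F else 0) + X a * pderiv a (pderiv b F) := by
    intro a; rw [pd_X_mul, pd_comm b a]
  have h2 : ∀ a, pderiv b (pderiv (bar a) (pderiv a F)) =
      pderiv (bar a) (pderiv a (pderiv b F)) := by
    intro a; rw [pd_comm b (bar a), pd_comm b a]
  simp only [h1, h2, Finset.sum_add_distrib, Finset.sum_ite_eq', Finset.mem_univ, if_true]
  ring

lemma Bf_L (hE : ∀ a F, E (X a * F) = E (pderiv (bar a) F)) (s : ℕ) :
    ∀ F G, Bf bar E s F (Lop bar G) = (s : ℝ) * Bf bar E s F G := by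
  induction s with
  | zero => intro F G; simp [Bf_zero, E_L hE]
  | succ s ih =>
    intro F G
    rw [Bf_succ]
    simp only [L_pd, map_add, ih, Finset.sum_add_distrib, ← Finset.mul_sum]
    rw [Bf_succ']
    have : (s : ℝ) + 1 ≠ 0 := by positivity
    push_cast
    field_simp
    
lemma Bf_X_zero (hE : ∀ a F, E (X a * F) = E (pderiv (bar a) F)) (a F G) :
    Bf bar E 0 (X a * F) G = Bf bar E 0 (pderiv (bar a) F) G := by
  simp [Bf_zero, hE]

lemma Bf_X (hE : ∀ a F, E (X a * F) = E (pderiv (bar a) F)) (s : ℕ) : ∀ a F G,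
    Bf bar E (s + 1) (X a * F) G =
      Bf bar E (s + 1) (pderiv (bar a) F) G + Bf bar E s F (pderiv (bar a) G) := by
  induction s with
  | zero =>
    intro a F G
    rw [Bf_succ, Bf_succ]
    simp only [pd_X_mul, map_add, LinearMap.add_apply, Bf_X_zero hE, Finset.sum_add_distrib]
    have : ∑ x, (Bf bar E 0 (if a = x then F else 0)) ((pderiv (bar x)) G) =
        Bf bar E 0 F (pderiv (bar a) G) := by
      rw [Finset.sum_eq_single a] <;> simp +contextual [eq_comm]
    rw [this]
    simp only [pd_comm (bar a)]
    norm_num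
    ring
  | succ s ih =>
    intro a F G
    rw [Bf_succ]
    simp only [pd_X_mul, map_add, LinearMap.add_apply, ih, Finset.sum_add_distrib]
    have : ∑ x, (Bf bar E (s + 1) (if a = x then F else 0)) ((pderiv (bar x)) G) =
        Bf bar E (s + 1) F (pderiv (bar a) G) := by
      rw [Finset.sum_eq_single a] <;> simp +contextual [eq_comm]
    rw [this]
    simp only [pd_comm (bar a)]
    rw [Bf_succ', Bf_succ']
    have : (s : ℝ) + 1 + 1 ≠ 0 := by positivity
    push_cast
    field_simp
    ring

lemma Bf_one (s : ℕ) (G : MvPolynomial I ℝ) : Bf bar E (s + 1) 1 G = 0 := by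
  rw [Bf_succ]; simp

lemma degLe_pd {d : ℕ} {F : MvPolynomial I ℝ} (h : DegLe (d + 1) F) (a : I) :
    DegLe d (pderiv a F) := by
  intro m hm
  rw [coeff_pderiv, h]
  · simp
  · simp; omega

/-- generic statement: nonneg-degree induction -/
lemma deg_ind {P : ℕ → MvPolynomial I ℝ → Prop} (h1 : ∀ d, P d 1)
    (hs : ∀ d (c : ℝ) F, P d F → P d (c • F))
    (ha : ∀ d F G, P d F → P d G → P d (F + G))
    (hX : ∀ d a F, DegLe d F → (∀ F', DegLe d F' → P d F') → P (d + 1) (X a * F)) :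
    ∀ d F, DegLe d F → P d F := by
  intro d
  induction d with
  | zero =>
    intro F hF
    obtain ⟨c, rfl⟩ := degLe_zero hF
    rw [C_eq_smul_one]; exact hs _ _ _ (h1 _)
  | succ d ih =>
    intro F hF
    rw [F.as_sum]
    have key : ∀ s ⊆ F.support, P (d + 1) (∑ v ∈ s, monomial v (coeff v F)) := by
      intro s
      induction s using Finset.induction_on with
      | empty => intro _; have := hs (d + 1) 0 1 (h1 _); simpa using this
      | insert v s hv ihs =>
        intro hsub
        rw [Finset.sum_insert hv]
        refine ha _ _ _ ?_ (ihs fun x hx => hsub (Finset.mem_insert_of_mem hx))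
        have hvF : coeff v F ≠ 0 := mem_support_iff.1 (hsub (Finset.mem_insert_self _ _))
        have hdeg : v.degree ≤ d + 1 := by
          by_contra hc
          exact hvF (hF v (by omega))
        by_cases h0 : v = 0
        · subst h0
          have := hs (d + 1) (coeff 0 F) 1 (h1 _)
          rw [← C_eq_smul_one] at this
          exact this
        · obtain ⟨a, ha0⟩ := Finsupp.ne_iff.1 h0
          have hv1 : Finsupp.single a 1 + (v - Finsupp.single a 1) = v :=
            add_tsub_cancel_of_le (by simpa using Nat.one_le_iff_ne_zero.2 ha0)
          have : monomial v (coeff v F) = X a * monomial (v - Finsupp.single a 1) (coeff v F) := by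
            rw [X, monomial_mul, hv1, one_mul]
          rw [this]
          refine hX d a _ ?_ ih
          intro m hm
          rw [coeff_monomial, if_neg]
          rintro rfl
          have := congrArg Finsupp.degree hv1
          simp at this
          omega
    exact key _ subset_rfl

lemma Bf_sum (hE1 : E 1 = 1) (hE : ∀ a F, E (X a * F) = E (pderiv (bar a) F)) (d : ℕ) (F)
    (hF : DegLe d F) : ∀ K, d ≤ K → ∀ G,
      ∑ s ∈ Finset.range (K + 1), Bf bar E s F G = E (F * G) := by
  revert hF F d
  apply deg_ind
  · intro d K hK G
    rw [Finset.sum_range_succ']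
    simp [Bf_one, Bf_zero, hE1]
  · intro d c F h K hK G
    simp only [map_smul, LinearMap.smul_apply, ← Finset.smul_sum, h K hK G, smul_mul_assoc]
  · intro d F G h h' K hK G'
    simp only [map_add, LinearMap.add_apply, Finset.sum_add_distrib, h K hK, h' K hK, add_mul]
  · intro d a F hd h K hK G
    obtain ⟨K, rfl⟩ : ∃ k, K = k + 1 := ⟨K - 1, by omega⟩
    have hpd : DegLe d (pderiv (bar a) F) := by
      intro m hm
      rw [coeff_pderiv, hd]
      · simp
      · simp; omega
    have h1 := h (pderiv (bar a) F) hpd (K + 1) (by omega) G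
    have h2 := h F hd K (by omega) (pderiv (bar a) G)
    rw [Finset.sum_range_succ'] at h1 ⊢
    simp only [Bf_X hE, Bf_X_zero hE, Finset.sum_add_distrib]
    rw [mul_assoc, hE, pderiv_mul, map_add, ← h1, ← h2]
    ring

end bil
end AGF

set_option linter.unusedSectionVars false
set_option linter.unusedSimpArgs false

namespace AGF
open MvPolynomial

section gen
variable {I : Type} [Fintype I] [DecidableEq I]

noncomputable def Gam (bar : I → I) (F G : MvPolynomial I ℝ) : MvPolynomial I ℝ :=
  ∑ e, pderiv e F * pderiv (bar e) G

lemma Gam_comm {bar : I → I} (hb : ∀ a, bar (bar a) = a) (F G : MvPolynomial I ℝ) :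
    Gam bar F G = Gam bar G F := by
  unfold Gam
  rw [← Equiv.sum_comp (⟨bar, bar, hb, hb⟩ : I ≃ I)]
  refine Finset.sum_congr rfl fun e _ => ?_
  simp [hb, mul_comm]

lemma Gam_add (bar : I → I) (F G H : MvPolynomial I ℝ) :
    Gam bar F (G + H) = Gam bar F G + Gam bar F H := by
  simp [Gam, mul_add, Finset.sum_add_distrib]

lemma Gam_mul (bar : I → I) (F G H : MvPolynomial I ℝ) :
    Gam bar F (G * H) = Gam bar F G * H + G * Gam bar F H := by
  simp only [Gam, pderiv_mul, Finset.sum_mul, Finset.mul_sum, ← Finset.sum_add_distrib]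
  refine Finset.sum_congr rfl fun e _ => ?_
  ring

lemma Gam_C (bar : I → I) (F : MvPolynomial I ℝ) (c : ℝ) : Gam bar F (C c) = 0 := by
  simp [Gam]

lemma Dop_mul {bar : I → I} (hb : ∀ a, bar (bar a) = a) (F G : MvPolynomial I ℝ) :
    Dop bar (F * G) = Dop bar F * G + F * Dop bar G + 2 * Gam bar F G := by
  have h : 2 * Gam bar F G = Gam bar F G + Gam bar G F := by
    rw [Gam_comm hb G F]; ring
  rw [h]
  simp only [Gam, Dop_apply, pderiv_mul, map_add, Finset.sum_mul, Finset.mul_sum,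
    ← Finset.sum_add_distrib]
  refine Finset.sum_congr rfl fun e _ => ?_
  ring

lemma Eu_mul (F G : MvPolynomial I ℝ) : Eu (F * G) = Eu F * G + F * Eu G := by
  simp only [Eu_apply, pderiv_mul, Finset.sum_mul, Finset.mul_sum, ← Finset.sum_add_distrib]
  refine Finset.sum_congr rfl fun e _ => ?_
  ring

lemma deriv_prod {ι : Type} [DecidableEq ι] {A : Type} [CommRing A] [Algebra ℝ A]
    (d : Derivation ℝ A A) (s : Finset ι) (f g : ι → A) (h : ∀ i ∈ s, d (f i) = f i * g i) :
    d (∏ i ∈ s, f i) = (∏ i ∈ s, f i) * ∑ i ∈ s, g i := by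
  induction s using Finset.induction_on with
  | empty => simp
  | insert a s ha ih =>
    rw [Finset.prod_insert ha, Finset.sum_insert ha, Derivation.leibniz,
      ih fun i hi => h i (Finset.mem_insert_of_mem hi), h a (Finset.mem_insert_self _ _)]
    simp only [smul_eq_mul]
    ring

end gen

section mat
variable {N : ℕ}

noncomputable def MM (N : ℕ) : Matrix (Fin N) (Fin N) (MvPolynomial (Fin N × Fin N) ℝ) :=
  Matrix.of fun i j => X (i, j)

noncomputable def tt (N k : ℕ) : MvPolynomial (Fin N × Fin N) ℝ := ((MM N) ^ k).trace

lemma pd_pow (i j : Fin N) (k : ℕ) : ∀ a b, pderiv (i, j) ((MM N ^ k) a b) =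
    ∑ c ∈ Finset.range k, (MM N ^ c) a i * (MM N ^ (k - 1 - c)) j b := by
  induction k with
  | zero =>
    intro a b
    rw [pow_zero, Matrix.one_apply]
    split_ifs <;> simp
  | succ k ih =>
    intro a b
    rw [pow_succ, Matrix.mul_apply, map_sum]
    simp only [pderiv_mul, ih, Finset.sum_add_distrib]
    rw [Finset.sum_range_succ]
    congr 1
    · simp only [Finset.sum_mul]
      rw [Finset.sum_comm]
      refine Finset.sum_congr rfl fun c hc => ?_
      have hc := Finset.mem_range.1 hc
      rw [show k + 1 - 1 - c = (k - 1 - c) + 1 by omega, pow_succ, Matrix.mul_apply,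
        Finset.mul_sum]
      refine Finset.sum_congr rfl fun x _ => ?_
      ring
    · rw [Finset.sum_eq_single i]
      · simp [MM, pderiv_X, Matrix.one_apply, Pi.single_apply, eq_comm]
      · intro x _ hx
        simp [MM, pderiv_X, Pi.single_apply, hx, Ne.symm hx]
      · simp

lemma pd_tt (i j : Fin N) (k : ℕ) :
    pderiv (i, j) (tt N k) = (k : MvPolynomial (Fin N × Fin N) ℝ) * (MM N ^ (k - 1)) j i := by
  rw [tt, Matrix.trace, map_sum]
  simp only [Matrix.diag_apply, pd_pow]
  rw [Finset.sum_comm]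
  have : ∀ c ∈ Finset.range k, ∑ x, (MM N ^ c) x i * (MM N ^ (k - 1 - c)) j x =
      (MM N ^ (k - 1)) j i := by
    intro c hc
    have hc := Finset.mem_range.1 hc
    conv_rhs => rw [show k - 1 = (k - 1 - c) + c by omega, pow_add, Matrix.mul_apply]
    exact Finset.sum_congr rfl fun x _ => mul_comm _ _
  rw [Finset.sum_congr rfl this]
  simp

lemma Gam_tt (j k : ℕ) : Gam Prod.swap (tt N j) (tt N k) =
    (j : MvPolynomial (Fin N × Fin N) ℝ) * k * tt N (j - 1 + (k - 1)) := by
  rw [show tt N (j - 1 + (k - 1)) = (MM N ^ (j - 1 + (k - 1))).trace from rfl, Gam,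
    Fintype.sum_prod_type, pow_add, Matrix.trace, Finset.mul_sum]
  simp only [Prod.swap_prod_mk, pd_tt, Matrix.diag_apply, Matrix.mul_apply, Finset.mul_sum]
  rw [Finset.sum_comm]
  refine Finset.sum_congr rfl fun a _ => Finset.sum_congr rfl fun b _ => ?_
  ring

lemma Dop_tt (k : ℕ) : Dop Prod.swap (tt N k) =
    (k : MvPolynomial (Fin N × Fin N) ℝ) * ∑ c ∈ Finset.range (k - 1), tt N c * tt N (k - 1 - 1 - c) := by
  rw [Dop_apply, Fintype.sum_prod_type]
  have h : ∀ i j : Fin N, pderiv (Prod.swap (i, j)) (pderiv (i, j) (tt N k)) =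
      (k : MvPolynomial (Fin N × Fin N) ℝ) * ∑ c ∈ Finset.range (k - 1),
        (MM N ^ c) j j * (MM N ^ (k - 1 - 1 - c)) i i := by
    intro i j
    rw [pd_tt, Prod.swap_prod_mk]
    have : (k : MvPolynomial (Fin N × Fin N) ℝ) = C (k : ℝ) := by simp
    rw [this, pderiv_C_mul, pd_pow]
  simp only [h, ← Finset.mul_sum]
  congr 1
  have : ∀ i : Fin N, ∑ j : Fin N, ∑ c ∈ Finset.range (k - 1),
        (MM N ^ c) j j * (MM N ^ (k - 1 - 1 - c)) i i = ∑ c ∈ Finset.range (k - 1),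
        tt N c * (MM N ^ (k - 1 - 1 - c)) i i := by
    intro i
    rw [Finset.sum_comm]
    refine Finset.sum_congr rfl fun c _ => ?_
    rw [← Finset.sum_mul]; rfl
  simp only [this]
  rw [Finset.sum_comm]
  refine Finset.sum_congr rfl fun c _ => ?_
  rw [← Finset.mul_sum]; rfl

lemma Eu_tt (k : ℕ) : Eu (tt N k) = (k : MvPolynomial (Fin N × Fin N) ℝ) * tt N k := by
  rw [Eu_apply, Fintype.sum_prod_type]
  simp only [pd_tt]
  rcases k with _ | k
  · simp
  · rw [tt, pow_succ', Matrix.trace, Finset.mul_sum]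
    refine Finset.sum_congr rfl fun i _ => ?_
    rw [Matrix.diag_apply, Matrix.mul_apply, Finset.mul_sum]
    refine Finset.sum_congr rfl fun j _ => ?_
    simp [MM]; ring

noncomputable def ev (N : ℕ) : MvPolynomial (Fin N × Fin N) ℝ →ₐ[ℝ] MvPolynomial (Fin N) ℝ :=
  aeval fun e => if e.1 = e.2 then X e.1 else 0

noncomputable def pp (N k : ℕ) : MvPolynomial (Fin N) ℝ := ∑ i, X i ^ k

lemma ev_tt (k : ℕ) : ev N (tt N k) = pp N k := by
  have h : (ev N).mapMatrix (MM N) = Matrix.diagonal fun i => X i := by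
    ext1 i j
    simp only [AlgHom.mapMatrix_apply, Matrix.map_apply, MM, Matrix.of_apply, ev, aeval_X,
      Matrix.diagonal_apply]
  have h2 : (ev N).mapMatrix (MM N ^ k) = Matrix.diagonal fun i => X i ^ k := by
    rw [map_pow, h, Matrix.diagonal_pow]; rfl
  rw [tt, Matrix.trace, map_sum, pp]
  refine Finset.sum_congr rfl fun i _ => ?_
  have := congrFun (congrFun h2 i) i
  simpa using this

end mat
end AGF

set_option linter.unusedSectionVars false
set_option linter.unusedSimpArgs false

namespace AGF
open MvPolynomial

section vand
variable {N : ℕ}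

lemma pd_pp (i : Fin N) (k : ℕ) :
    pderiv i (pp N k) = (k : MvPolynomial (Fin N) ℝ) * X i ^ (k - 1) := by
  rw [pp, map_sum, Finset.sum_eq_single i]
  · simp [pderiv_pow]
  · intro j _ hj
    simp [pderiv_pow, pderiv_X_of_ne hj]
  · simp

lemma Gam_pp (j k : ℕ) : Gam id (pp N j) (pp N k) =
    (j : MvPolynomial (Fin N) ℝ) * k * pp N (j - 1 + (k - 1)) := by
  rw [Gam]
  simp only [id, pd_pp]
  rw [pp, Finset.mul_sum]
  refine Finset.sum_congr rfl fun i _ => ?_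
  rw [pow_add]; ring

lemma Eu_pp (k : ℕ) : Eu (pp N k) = (k : MvPolynomial (Fin N) ℝ) * pp N k := by
  rw [Eu_apply]
  simp only [pd_pp]
  rcases k with _ | k
  · simp
  · rw [pp, Finset.mul_sum]
    refine Finset.sum_congr rfl fun i _ => ?_
    simp; ring

noncomputable def VV (N : ℕ) : MvPolynomial (Fin N) ℝ :=
  (Matrix.vandermonde (fun i : Fin N => (X i : MvPolynomial (Fin N) ℝ))).det

/-- complete-type symmetric sum -/
noncomputable def hh (k : ℕ) (i j : Fin N) : MvPolynomial (Fin N) ℝ :=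
  ∑ a ∈ Finset.range k, X j ^ a * X i ^ (k - 1 - a)

lemma VV_deriv (k : ℕ) : ∑ i, X i ^ k * pderiv i (VV N) =
    VV N * ∑ i, ∑ j ∈ Finset.Ioi i, hh k i j := by
  let d : Derivation ℝ (MvPolynomial (Fin N) ℝ) (MvPolynomial (Fin N) ℝ) :=
    ∑ i, (X i ^ k : MvPolynomial (Fin N) ℝ) • pderiv i
  have hd : ∀ F, d F = ∑ i, X i ^ k * pderiv i F := by
    intro F
    have := congrFun (map_sum (Derivation.coeFnAddMonoidHom (R := ℝ) (A := MvPolynomial (Fin N) ℝ)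
      (M := MvPolynomial (Fin N) ℝ)) (fun i => (X i ^ k : MvPolynomial (Fin N) ℝ) • pderiv i)
      Finset.univ) F
    rw [Finset.sum_apply] at this
    exact this
  rw [← hd, VV, Matrix.det_vandermonde]
  refine deriv_prod d _ _ _ fun i _ => ?_
  refine deriv_prod d _ _ _ fun j _ => ?_
  have hX : ∀ a : Fin N, d (X a) = X a ^ k := by
    intro a
    rw [hd, Finset.sum_eq_single a]
    · simp
    · intro b _ hb; simp [pderiv_X_of_ne (Ne.symm hb)]
    · simp
  rw [map_sub, hX, hX, hh, mul_comm]
  exact ((Commute.all (X j : MvPolynomial (Fin N) ℝ) (X i)).geom_sum₂_mul k).symm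

/-- ground state energy -/
def E0 (N : ℕ) : ℕ := ∑ i : Fin N, (Finset.Ioi i).card

lemma Eu_VV : Eu (VV N) = (E0 N : ℝ) • VV N := by
  have := VV_deriv (N := N) 1
  rw [Eu_apply]
  simp only [pow_one] at this
  rw [this]
  simp [hh, E0, smul_eq_C_mul, mul_comm]

lemma hh_comm (k : ℕ) (i j : Fin N) : hh k i j = hh k j i := by
  unfold hh
  rw [← Finset.sum_range_reflect]
  refine Finset.sum_congr rfl fun a ha => ?_
  have := Finset.mem_range.1 ha
  rw [show k - 1 - (k - 1 - a) = a by omega, mul_comm]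

lemma hh_self (k : ℕ) (i : Fin N) : hh k i i = (k : MvPolynomial (Fin N) ℝ) * X i ^ (k - 1) := by
  unfold hh
  rw [Finset.sum_congr rfl (g := fun _ => (X i : MvPolynomial (Fin N) ℝ) ^ (k - 1))]
  · simp
  · intro a ha
    have := Finset.mem_range.1 ha
    rw [← pow_add]; congr 1; omega

lemma sum_symm {A : Type} [CommRing A] (h : Fin N → Fin N → A) (hs : ∀ i j, h i j = h j i) :
    ∑ i, ∑ j, h i j = ∑ i, h i i + 2 * ∑ i, ∑ j ∈ Finset.Ioi i, h i j := by
  have h1 : ∀ i, ∑ j, h i j = h i i + (∑ j ∈ Finset.Ioi i, h i j + ∑ j ∈ Finset.Iio i, h i j) := by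
    intro i
    rw [← Finset.sum_union, ← Finset.sum_insert]
    · refine Finset.sum_congr ?_ fun _ _ => rfl
      ext j
      simp only [Finset.mem_univ, Finset.mem_insert, Finset.mem_union, Finset.mem_Ioi,
        Finset.mem_Iio, true_iff]
      omega
    · simp
    · rw [Finset.disjoint_left]
      intro j
      simp only [Finset.mem_Ioi, Finset.mem_Iio]
      omega
  have h2 : ∑ i, ∑ j ∈ Finset.Iio i, h i j = ∑ i, ∑ j ∈ Finset.Ioi i, h i j := by
    rw [Finset.sum_comm' (t' := Finset.univ) (s' := fun j => Finset.Ioi j)]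
    · exact Finset.sum_congr rfl fun i _ => Finset.sum_congr rfl fun j _ => hs _ _
    · intro i j; simp
  simp only [h1, Finset.sum_add_distrib, h2]
  ring

lemma sum_pp (k : ℕ) : ∑ c ∈ Finset.range k, pp N c * pp N (k - 1 - c) =
    ∑ i, ∑ j, hh k i j := by
  unfold hh
  simp only [pp]
  have : ∀ c, (∑ i : Fin N, (X i : MvPolynomial (Fin N) ℝ) ^ c) * ∑ i : Fin N, X i ^ (k - 1 - c) =
      ∑ i, ∑ j, X j ^ c * X i ^ (k - 1 - c) := by
    intro c
    rw [Finset.sum_mul_sum, Finset.sum_comm]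
  simp only [this]
  rw [Finset.sum_comm]
  exact Finset.sum_congr rfl fun i _ => Finset.sum_comm

/-- exponent vector of a permutation -/
noncomputable def mexp (σ : Equiv.Perm (Fin N)) : Fin N →₀ ℕ :=
  Finsupp.equivFunOnFinite.symm fun i => (σ i : ℕ)

@[simp] lemma mexp_apply (σ : Equiv.Perm (Fin N)) (i : Fin N) : mexp σ i = (σ i : ℕ) := rfl

lemma VV_eq : VV N = ∑ σ : Equiv.Perm (Fin N),
    monomial (mexp σ) (((Equiv.Perm.sign σ : ℤ) : ℝ)) := by
  rw [VV, ← Matrix.det_transpose, Matrix.det_apply']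
  refine Finset.sum_congr rfl fun σ _ => ?_
  rw [monomial_eq, Finsupp.prod_fintype _ _ (by simp)]
  simp [Matrix.vandermonde]

lemma Dop_VV : Dop id (VV N) = 0 := by
  rw [Dop_apply, VV_eq]
  simp only [map_sum, id, pderiv_monomial]
  rw [← Fintype.sum_prod_type' (f := fun (i : Fin N) (σ : Equiv.Perm (Fin N)) =>
    monomial (mexp σ - Finsupp.single i 1 - Finsupp.single i 1)
      (((Equiv.Perm.sign σ : ℤ) : ℝ) * ((mexp σ i : ℕ) : ℝ) *
        (((mexp σ - Finsupp.single i 1 : Fin N →₀ ℕ) i : ℕ) : ℝ)))]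
  let jj : Fin N × Equiv.Perm (Fin N) → Fin N := fun x =>
    x.2.symm ⟨(x.2 x.1 : ℕ) - 2, by omega⟩
  have hjj : ∀ x : Fin N × Equiv.Perm (Fin N), ((x.2 (jj x) : Fin N) : ℕ) = (x.2 x.1 : ℕ) - 2 := by
    intro x; simp [jj]
  let g : Fin N × Equiv.Perm (Fin N) → Fin N × Equiv.Perm (Fin N) := fun x =>
    if 2 ≤ (x.2 x.1 : ℕ) then (jj x, x.2 * Equiv.swap x.1 (jj x)) else x
  have hne : ∀ x : Fin N × Equiv.Perm (Fin N), 2 ≤ (x.2 x.1 : ℕ) → jj x ≠ x.1 := by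
    intro x hx h
    have := hjj x
    rw [h] at this; omega
  refine Finset.sum_involution (fun x _ => g x) ?_ ?_ ?_ ?_
  · rintro ⟨i, σ⟩ -
    by_cases h : 2 ≤ (σ i : ℕ)
    · have h1 := hne ⟨i, σ⟩ h
      have h2 := hjj ⟨i, σ⟩
      have hg : g (i, σ) = (jj (i, σ), σ * Equiv.swap i (jj (i, σ))) := by simp [g, h]
      rw [hg]
      generalize jj (i, σ) = j at *
      simp only at h1 h2 ⊢
      have he : mexp (σ * Equiv.swap i j) - Finsupp.single j 1 - Finsupp.single j 1 =
          mexp σ - Finsupp.single i 1 - Finsupp.single i 1 := by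
        ext k
        simp only [Finsupp.coe_tsub, Pi.sub_apply, mexp_apply, Equiv.Perm.mul_apply,
          Finsupp.single_apply]
        by_cases hi : k = i
        · subst hi
          simp [h1]; omega
        · by_cases hj : k = j
          · subst hj
            simp [Ne.symm h1]; omega
          · simp [Equiv.swap_apply_of_ne_of_ne hi hj, Ne.symm hi, Ne.symm hj]
      rw [he, ← map_add]
      simp [Equiv.Perm.sign_swap (Ne.symm h1)]
    · have hg : g (i, σ) = (i, σ) := by simp [g, h]
      rw [hg]
      have : ((mexp σ i : ℕ) : ℝ) * (((mexp σ - Finsupp.single i 1 : Fin N →₀ ℕ) i : ℕ) : ℝ) = 0 := by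
        rw [← Nat.cast_mul, Nat.cast_eq_zero]
        simp; omega
      simp only [mul_assoc, this]
      simp
  · rintro ⟨i, σ⟩ - hf hgx
    by_cases h : 2 ≤ (σ i : ℕ)
    · have hg : g (i, σ) = (jj (i, σ), σ * Equiv.swap i (jj (i, σ))) := by simp [g, h]
      rw [hg] at hgx
      exact hne ⟨i, σ⟩ h (congrArg Prod.fst hgx)
    · apply hf
      have : ((mexp σ i : ℕ) : ℝ) * (((mexp σ - Finsupp.single i 1 : Fin N →₀ ℕ) i : ℕ) : ℝ) = 0 := by
        rw [← Nat.cast_mul, Nat.cast_eq_zero]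
        simp; omega
      simp only [mul_assoc, this]
      simp
  · simp
  · rintro ⟨i, σ⟩ -
    by_cases h : 2 ≤ (σ i : ℕ)
    · have hg : g (i, σ) = (jj (i, σ), σ * Equiv.swap i (jj (i, σ))) := by simp [g, h]
      have h2 := hjj ⟨i, σ⟩
      have h3 := hjj (jj (i, σ), σ * Equiv.swap i (jj (i, σ)))
      simp only [Equiv.Perm.mul_apply, Equiv.swap_apply_right] at h3
      have h4 : jj (jj (i, σ), σ * Equiv.swap i (jj (i, σ))) = i := by
        have h5 : σ (Equiv.swap i (jj (i, σ)) (jj (jj (i, σ), σ * Equiv.swap i (jj (i, σ))))) =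
            σ (jj (i, σ)) := Fin.ext (by rw [h3, h2])
        have h6 := σ.injective h5
        rw [Equiv.swap_apply_eq_iff, Equiv.swap_apply_right] at h6
        exact h6
      rw [hg]
      have h7 : g (jj (i, σ), σ * Equiv.swap i (jj (i, σ))) = (jj (jj (i, σ), σ * Equiv.swap i (jj (i, σ))),
          (σ * Equiv.swap i (jj (i, σ))) * Equiv.swap (jj (i, σ)) (jj (jj (i, σ), σ * Equiv.swap i (jj (i, σ))))) := by
        simp [g, h]
      rw [h7, h4, Equiv.swap_comm (jj (i, σ)) i, mul_assoc, Equiv.swap_mul_self, mul_one]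
    · have hg : g (i, σ) = (i, σ) := by simp [g, h]
      rw [hg, hg]

end vand
end AGF

set_option linter.unusedSectionVars false
set_option linter.unusedSimpArgs false

namespace AGF
open MvPolynomial

section cls
variable {N : ℕ}

noncomputable def CC (N : ℕ) : Subalgebra ℝ (MvPolynomial (Fin N × Fin N) ℝ) :=
  Algebra.adjoin ℝ (Set.range (tt N))

lemma tt_mem (k : ℕ) : tt N k ∈ CC N := Algebra.subset_adjoin ⟨k, rfl⟩

lemma nat_mem (k : ℕ) : (k : MvPolynomial (Fin N × Fin N) ℝ) ∈ CC N := natCast_mem _ _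

lemma C_Gam_aux (F : MvPolynomial (Fin N × Fin N) ℝ)
    (hF : ∀ k, Gam Prod.swap F (tt N k) ∈ CC N ∧
      ev N (Gam Prod.swap F (tt N k)) = Gam id (ev N F) (pp N k))
    (G : MvPolynomial (Fin N × Fin N) ℝ) (hG : G ∈ CC N) :
    Gam Prod.swap F G ∈ CC N ∧ ev N (Gam Prod.swap F G) = Gam id (ev N F) (ev N G) := by
  induction hG using Algebra.adjoin_induction with
  | mem x hx => obtain ⟨k, rfl⟩ := hx; rw [ev_tt]; exact hF k
  | algebraMap r =>
    rw [AlgHom.commutes]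
    simp only [algebraMap_eq, Gam_C, map_zero, and_true]
    exact zero_mem _
  | add x y hx hy h h' =>
    rw [Gam_add, map_add, map_add, Gam_add, h.2, h'.2]
    exact ⟨add_mem h.1 h'.1, rfl⟩
  | mul x y hx hy h h' =>
    rw [Gam_mul, map_add, map_mul, map_mul, map_mul, Gam_mul, h.2, h'.2]
    exact ⟨add_mem (mul_mem h.1 hy) (mul_mem hx h'.1), rfl⟩

lemma C_Gam {F G : MvPolynomial (Fin N × Fin N) ℝ} (hF : F ∈ CC N) (hG : G ∈ CC N) :
    Gam Prod.swap F G ∈ CC N ∧ ev N (Gam Prod.swap F G) = Gam id (ev N F) (ev N G) := by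
  refine C_Gam_aux F (fun k => ?_) G hG
  rw [Gam_comm Prod.swap_swap, Gam_comm (bar := id) (fun _ => rfl), ← ev_tt]
  refine C_Gam_aux (tt N k) (fun j => ?_) F hF
  rw [Gam_tt, ev_tt, Gam_pp, map_mul, ev_tt, map_mul, map_natCast, map_natCast]
  exact ⟨mul_mem (mul_mem (nat_mem _) (nat_mem _)) (tt_mem _), rfl⟩

lemma C_D {F : MvPolynomial (Fin N × Fin N) ℝ} (hF : F ∈ CC N) :
    Dop Prod.swap F ∈ CC N ∧ VV N * ev N (Dop Prod.swap F) = Dop id (VV N * ev N F) := by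
  have hid : ∀ a : Fin N, id (id a) = a := fun _ => rfl
  induction hF using Algebra.adjoin_induction with
  | mem x hx =>
    obtain ⟨k, rfl⟩ := hx
    constructor
    · rw [Dop_tt]
      exact mul_mem (nat_mem _) (sum_mem fun c _ => mul_mem (tt_mem _) (tt_mem _))
    · rw [Dop_tt, Dop_mul hid, Dop_VV, ev_tt, map_mul, map_natCast, map_sum]
      simp only [map_mul, ev_tt]
      rw [sum_pp, sum_symm _ (hh_comm _)]
      have h1 : Gam id (VV N) (pp N k) = (k : MvPolynomial (Fin N) ℝ) *
          (VV N * ∑ i, ∑ j ∈ Finset.Ioi i, hh (k - 1) i j) := by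
        rw [← VV_deriv, Gam, Finset.mul_sum]
        refine Finset.sum_congr rfl fun i _ => ?_
        rw [id, pd_pp]; ring
      have h2 : Dop id (pp N k) = (k : MvPolynomial (Fin N) ℝ) * ∑ i : Fin N, hh (k - 1) i i := by
        rw [Dop_apply, Finset.mul_sum]
        refine Finset.sum_congr rfl fun i _ => ?_
        have : (k : MvPolynomial (Fin N) ℝ) = C (k : ℝ) := by simp
        rw [id, pd_pp, hh_self, this, pderiv_C_mul, pderiv_pow, pderiv_X_self, mul_one]
      rw [h1, h2]
      ring
  | algebraMap r =>
    rw [AlgHom.commutes]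
    have h : Dop Prod.swap (algebraMap ℝ (MvPolynomial (Fin N × Fin N) ℝ) r) = 0 := by
      simp [Dop_apply, algebraMap_eq]
    have h' : Dop id (algebraMap ℝ (MvPolynomial (Fin N) ℝ) r) = 0 := by
      simp [Dop_apply, algebraMap_eq]
    rw [h, map_zero, Dop_mul hid, h', Dop_VV, algebraMap_eq, Gam_C]
    simp
  | add x y hx hy h h' =>
    simp only [map_add, mul_add, h.2, h'.2]
    exact ⟨add_mem h.1 h'.1, trivial⟩
  | mul x y hx hy h h' =>
    have hg := C_Gam hx hy
    rw [Dop_mul Prod.swap_swap]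
    constructor
    · exact add_mem (add_mem (mul_mem h.1 hy) (mul_mem hx h'.1)) (mul_mem (nat_mem 2) hg.1)
    · simp only [map_add, map_mul, hg.2]
      have h1 := h.2
      have h2 := h'.2
      rw [Dop_mul hid, Dop_VV] at h1 h2
      rw [Dop_mul hid, Dop_VV, Dop_mul hid, Gam_mul, map_ofNat]
      linear_combination (ev N y) * h1 + (ev N x) * h2

lemma C_Eu {F : MvPolynomial (Fin N × Fin N) ℝ} (hF : F ∈ CC N) :
    Eu F ∈ CC N ∧ ev N (Eu F) = Eu (ev N F) := by
  induction hF using Algebra.adjoin_induction with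
  | mem x hx =>
    obtain ⟨k, rfl⟩ := hx
    rw [Eu_tt, ev_tt, Eu_pp, map_mul, map_natCast, ev_tt]
    exact ⟨mul_mem (nat_mem _) (tt_mem _), rfl⟩
  | algebraMap r =>
    rw [AlgHom.commutes]
    have h : Eu (algebraMap ℝ (MvPolynomial (Fin N × Fin N) ℝ) r) = 0 := by
      simp [Eu_apply, algebraMap_eq]
    have h' : Eu (algebraMap ℝ (MvPolynomial (Fin N) ℝ) r) = 0 := by
      simp [Eu_apply, algebraMap_eq]
    rw [h, h']
    simp
  | add x y hx hy h h' =>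
    simp only [map_add, h.2, h'.2]
    exact ⟨add_mem h.1 h'.1, trivial⟩
  | mul x y hx hy h h' =>
    rw [Eu_mul, map_mul, Eu_mul, ← h.2, ← h'.2, map_add, map_mul, map_mul]
    exact ⟨add_mem (mul_mem h.1 hy) (mul_mem hx h'.1), rfl⟩

lemma C_L {F : MvPolynomial (Fin N × Fin N) ℝ} (hF : F ∈ CC N) :
    Lop Prod.swap F ∈ CC N ∧ VV N * ev N (Lop Prod.swap F) =
      Lop id (VV N * ev N F) - (E0 N : ℝ) • (VV N * ev N F) := by
  have h1 := C_D hF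
  have h2 := C_Eu hF
  refine ⟨sub_mem h2.1 h1.1, ?_⟩
  rw [Lop_apply, Lop_apply, ← h1.2, map_sub, h2.2, Eu_mul, Eu_VV, smul_mul_assoc]
  ring

lemma U_top {I : Type} [Fintype I] [DecidableEq I] {bar : I → I}
    {U : MvPolynomial I ℝ →ₗ[ℝ] MvPolynomial I ℝ} (h1 : U 1 = 1)
    (hX : ∀ a F, U (X a * F) = X a * U F + pderiv (bar a) (U F)) :
    ∀ d F, DegLe d F → ∀ m : I →₀ ℕ, d ≤ m.degree → coeff m (U F) = coeff m F := by
  apply deg_ind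
  · intro d m _; rw [h1]
  · intro d c F h m hm; rw [map_smul, coeff_smul, coeff_smul, h m hm]
  · intro d F G h h' m hm; rw [map_add, coeff_add, coeff_add, h m hm, h' m hm]
  · intro d a F hd h m hm
    rw [hX, coeff_add, coeff_pderiv, h F hd, hd, zero_mul, add_zero, coeff_X_mul', coeff_X_mul']
    · split_ifs with ha
      · apply h F hd
        have h0 : m a ≠ 0 := by simpa using ha
        have : m - Finsupp.single a 1 + Finsupp.single a 1 = m :=
          tsub_add_cancel_of_le (by simpa using Nat.one_le_iff_ne_zero.2 h0)
        have := congrArg Finsupp.degree this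
        simp at this
        omega
      · rfl
    · simp; omega
    · simp; omega

noncomputable def del (N : ℕ) : Fin N →₀ ℕ := mexp 1

lemma del_deg : (del N).degree = E0 N := by
  rw [Finsupp.degree_eq_sum, E0]
  rw [← Equiv.sum_comp Fin.revPerm]
  refine Finset.sum_congr rfl fun i _ => ?_
  simp [del, Fin.val_rev]
  omega

lemma mexp_inj : Function.Injective (mexp (N := N)) := by
  intro σ τ h
  ext i
  have := DFunLike.congr_fun h i
  simpa using this

lemma coeff_VV (σ : Equiv.Perm (Fin N)) : coeff (mexp σ) (VV N) = ((Equiv.Perm.sign σ : ℤ) : ℝ) := by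
  rw [VV_eq, coeff_sum, Finset.sum_eq_single σ]
  · simp
  · intro τ _ h
    rw [coeff_monomial, if_neg fun e => h (mexp_inj e)]
  · simp

variable {U : MvPolynomial (Fin N) ℝ →ₗ[ℝ] MvPolynomial (Fin N) ℝ}

lemma VV_hom (m : Fin N →₀ ℕ) (hm : m.degree ≠ E0 N) : coeff m (VV N) = 0 := by
  have := congrArg (coeff m) (Eu_VV (N := N))
  rw [coeff_Eu, coeff_smul, smul_eq_mul] at this
  have h2 : ((m.degree : ℝ) - E0 N) * coeff m (VV N) = 0 := by rw [sub_mul, this, sub_self]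
  rcases mul_eq_zero.1 h2 with h | h
  · exact absurd (by exact_mod_cast sub_eq_zero.1 h) hm
  · exact h

lemma U_VV (h1 : U 1 = 1) (hX : ∀ a F, U (X a * F) = X a * U F + pderiv (id a) (U F)) :
    U (VV N) = VV N := by
  have h := U_L h1 hX (VV N)
  rw [Lop_apply, Dop_VV, sub_zero, Eu_VV, map_smul] at h
  ext m
  by_cases hm : m.degree = E0 N
  · exact U_top h1 hX (E0 N) _ (fun m' h' => VV_hom m' (by omega)) m (by omega)
  · rw [VV_hom m hm]
    have := congrArg (coeff m) h
    rw [coeff_Eu, coeff_smul, smul_eq_mul] at this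
    have h2 : ((m.degree : ℝ) - E0 N) * coeff m (U (VV N)) = 0 := by rw [sub_mul, this, sub_self]
    rcases mul_eq_zero.1 h2 with h | h
    · exact absurd (by exact_mod_cast sub_eq_zero.1 h) hm
    · exact h

lemma T_L (h1 : U 1 = 1) (hX : ∀ a F, U (X a * F) = X a * U F + pderiv (id a) (U F))
    {F : MvPolynomial (Fin N × Fin N) ℝ} (hF : F ∈ CC N) (m : Fin N →₀ ℕ) :
    coeff m (U (VV N * ev N (Lop Prod.swap F))) =
      ((m.degree : ℝ) - E0 N) * coeff m (U (VV N * ev N F)) := by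
  rw [(C_L hF).2, map_sub, U_L h1 hX, map_smul, coeff_sub, coeff_Eu, coeff_smul, smul_eq_mul]
  ring

lemma E_eq (h1 : U 1 = 1) (hX : ∀ a F, U (X a * F) = X a * U F + pderiv (id a) (U F))
    {E : MvPolynomial (Fin N × Fin N) ℝ →ₗ[ℝ] ℝ} (hE1 : E 1 = 1)
    (hE : ∀ a F, E (X a * F) = E (pderiv (Prod.swap a) F)) (d : ℕ) :
    ∀ F ∈ CC N, DegLe d F → E F = coeff (del N) (U (VV N * ev N F)) := by
  induction d with
  | zero =>
    intro F hF hd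
    obtain ⟨c, rfl⟩ := degLe_zero hd
    have h : (C c : MvPolynomial (Fin N × Fin N) ℝ) = c • 1 := C_eq_smul_one
    rw [h, map_smul, map_smul, map_one (ev N), mul_smul_comm, mul_one, map_smul, U_VV h1 hX, coeff_smul,
      hE1, del, coeff_VV]
    simp
  | succ d ih =>
    intro F hF hd
    have h2 := ih _ (sub_mem (C_L hF).1 (Subalgebra.smul_mem _ hF ((d + 1 : ℕ) : ℝ))) (degLe_L hd)
    rw [map_sub, map_sub, mul_sub, map_sub, coeff_sub, T_L h1 hX hF, E_L hE, del_deg, map_smul,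
      map_smul, mul_smul_comm, map_smul, coeff_smul] at h2
    have h3 : ((d + 1 : ℕ) : ℝ) ≠ 0 := by positivity
    simp only [smul_eq_mul, sub_self, zero_mul, zero_sub, neg_inj] at h2
    exact mul_left_cancel₀ h3 h2

lemma aeval_func {M : Type} [AddCommGroup M] [Module ℝ M] (L : Module.End ℝ M) (φ : M →ₗ[ℝ] ℝ)
    (s : ℝ) (P : M → Prop) (hP : ∀ x, P x → P (L x)) (h : ∀ x, P x → φ (L x) = s * φ x)
    (c : Polynomial ℝ) (x : M) (hx : P x) : φ (Polynomial.aeval L c x) = c.eval s * φ x := by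
  have hpow : ∀ n : ℕ, P ((L ^ n) x) ∧ φ ((L ^ n) x) = s ^ n * φ x := by
    intro n
    induction n with
    | zero => simp [hx]
    | succ n ih =>
      rw [pow_succ', Module.End.mul_apply]
      refine ⟨hP _ ih.1, ?_⟩
      rw [h _ ih.1, ih.2]; ring
  induction c using Polynomial.induction_on' with
  | add p q hp hq => simp [hp, hq, add_mul]
  | monomial n a =>
    simp [Polynomial.aeval_monomial, (hpow n).2, mul_assoc]

lemma aeval_mem {M : Type} [AddCommGroup M] [Module ℝ M] (L : Module.End ℝ M) (P : Submodule ℝ M)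
    (hP : ∀ x ∈ P, L x ∈ P) (c : Polynomial ℝ) (x : M) (hx : x ∈ P) :
    Polynomial.aeval L c x ∈ P := by
  have hpow : ∀ n : ℕ, ((L ^ n) x) ∈ P := by
    intro n
    induction n with
    | zero => simpa using hx
    | succ n ih =>
      rw [pow_succ', Module.End.mul_apply]
      exact hP _ ih
  induction c using Polynomial.induction_on' with
  | add p q hp hq => simpa using add_mem hp hq
  | monomial n a =>
    simpa [Polynomial.aeval_monomial] using P.smul_mem a (hpow n)

lemma U_pp (hX : ∀ a F, U (X a * F) = X a * U F + pderiv (id a) (U F)) (p : ℕ)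
    (F : MvPolynomial (Fin N) ℝ) : U (pp N p * F) = ∑ i, ((Aop id i) ^ p) (U F) := by
  rw [pp, Finset.sum_mul, map_sum]
  refine Finset.sum_congr rfl fun i _ => ?_
  induction p with
  | zero => simp
  | succ p ih =>
    rw [pow_succ', mul_assoc, hX, ih, pow_succ', Module.End.mul_apply, Aop_apply]

theorem Bf_tt {E : MvPolynomial (Fin N × Fin N) ℝ →ₗ[ℝ] ℝ} (hE1 : E 1 = 1)
    (hE : ∀ a F, E (X a * F) = E (pderiv (Prod.swap a) F)) (p q s : ℕ) :
    Bf Prod.swap E s (tt N p) (tt N q) =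
      coeff (del N) (∑ i, ((Aop id i) ^ p)
        (homogeneousComponent (E0 N + s) (∑ j, ((Aop id j) ^ q) (VV N)))) := by
  obtain ⟨U, h1, hX⟩ := exists_U (I := Fin N) id (fun _ => rfl)
  have hT : U (VV N * ev N (tt N q)) = ∑ j, ((Aop id j) ^ q) (VV N) := by
    rw [ev_tt, mul_comm, U_pp hX, U_VV h1 hX]
  obtain ⟨d, hd⟩ := exists_degLe (tt N p)
  set K := max d s with hK
  set Q := ∑ j, ((Aop id j) ^ q) (VV N) with hQ
  let S : Finset ℝ := insert (s : ℝ) ((Finset.range (K + 1)).image (fun t : ℕ => (t : ℝ)) ∪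
    Q.support.image (fun m => (m.degree : ℝ) - E0 N))
  let c : Polynomial ℝ := Lagrange.basis S id (s : ℝ)
  have hcs : c.eval (s : ℝ) = 1 := by
    have := Lagrange.eval_basis_self (s := S) (v := id) (i := (s : ℝ))
      (fun _ _ _ _ h => h) (by simp [S])
    simpa using this
  have hct : ∀ t ∈ S, t ≠ s → c.eval t = 0 := by
    intro t ht hts
    have := Lagrange.eval_basis_of_ne (s := S) (v := id) (i := (s : ℝ)) (j := t) (Ne.symm hts) ht
    simpa using this
  let G := Polynomial.aeval (Lop Prod.swap) c (tt N q)
  have hG : G ∈ CC N := aeval_mem (Lop Prod.swap) (Subalgebra.toSubmodule (CC N))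
    (fun x hx => (C_L hx).1) c _ (tt_mem q)
  have hB : E (tt N p * G) = Bf Prod.swap E s (tt N p) (tt N q) := by
    rw [← Bf_sum hE1 hE d _ hd K (le_max_left _ _)]
    have : ∀ t ∈ Finset.range (K + 1), Bf Prod.swap E t (tt N p) G =
        c.eval (t : ℝ) * Bf Prod.swap E t (tt N p) (tt N q) := by
      intro t _
      exact aeval_func (Lop Prod.swap) (Bf Prod.swap E t (tt N p)) t (fun _ => True)
        (fun _ _ => trivial) (fun x _ => Bf_L hE t _ x) c _ trivial
    rw [Finset.sum_congr rfl this, Finset.sum_eq_single s]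
    · rw [hcs, one_mul]
    · intro t ht hts
      rw [hct t, zero_mul]
      · simp only [S, Finset.mem_insert, Finset.mem_union]
        exact Or.inr (Or.inl (Finset.mem_image_of_mem _ ht))
      · exact_mod_cast hts
    · intro h
      exact absurd (Finset.mem_range.2 (Nat.lt_succ_of_le (le_max_right d s))) h
  obtain ⟨d', hd'⟩ := exists_degLe (tt N p * G)
  rw [← hB, E_eq h1 hX hE1 hE d' _ (mul_mem (tt_mem _) hG) hd', map_mul (ev N), ev_tt,
    mul_left_comm, U_pp hX]
  have hfin : U (VV N * ev N G) = homogeneousComponent (E0 N + s) Q := by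
    ext m
    rw [coeff_homogeneousComponent]
    have := aeval_func (Lop Prod.swap)
      ((lcoeff ℝ m) ∘ₗ U ∘ₗ (LinearMap.mulLeft ℝ (VV N)) ∘ₗ (ev N).toLinearMap)
      ((m.degree : ℝ) - E0 N) (fun x => x ∈ CC N) (fun x hx => (C_L hx).1)
      (fun x hx => T_L h1 hX hx m) c (tt N q) (tt_mem q)
    have h3 : coeff m (U (VV N * ev N G)) =
      c.eval ((m.degree : ℝ) - E0 N) * coeff m (U (VV N * ev N (tt N q))) := this
    rw [h3, hT]
    by_cases hm : m.degree = E0 N + s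
    · rw [if_pos hm, hm]
      push_cast
      rw [add_sub_cancel_left, hcs, one_mul]
    · rw [if_neg hm]
      by_cases hmQ : coeff m Q = 0
      · rw [hmQ, mul_zero]
      · rw [hct, zero_mul]
        · simp only [S, Finset.mem_insert, Finset.mem_union]
          exact Or.inr (Or.inr (Finset.mem_image.2 ⟨m, mem_support_iff.2 hmQ, rfl⟩))
        · intro h
          apply hm
          have : (m.degree : ℝ) = ((E0 N + s : ℕ) : ℝ) := by push_cast; linarith
          exact_mod_cast this
  rw [hfin]

end cls
end AGF

set_option linter.unusedSectionVars false
set_option linter.unusedSimpArgs false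

namespace AGF
open MvPolynomial

noncomputable def al : ℕ → ℕ → ℕ → ℝ
  | 0, k, l => if k = l then 1 else 0
  | p + 1, k, l => (if l = 0 then 0 else al p k (l - 1)) + ((l : ℝ) + 1) * al p k (l + 1)

section ferm
variable {N : ℕ}

lemma deg_update (m : Fin N →₀ ℕ) (i : Fin N) (l : ℕ) :
    (m.update i l).degree + m i = m.degree + l := by
  rw [Finsupp.degree_eq_sum, Finsupp.degree_eq_sum, ← Finset.add_sum_erase _ _ (Finset.mem_univ i),
    ← Finset.add_sum_erase _ (fun t => m t) (Finset.mem_univ i)]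
  have : ∑ x ∈ Finset.univ.erase i, (m.update i l) x = ∑ x ∈ Finset.univ.erase i, m x := by
    refine Finset.sum_congr rfl fun t ht => ?_
    have : t ≠ i := by simpa using ht
    simp [Finsupp.update_apply, this]
  rw [this]
  simp [Finsupp.update_apply]
  omega

lemma update_self' (m : Fin N →₀ ℕ) (i : Fin N) (l k : ℕ) :
    (m.update i l).update i k = m.update i k := by
  ext t; by_cases h : t = i <;> simp [Finsupp.update_apply, h]

lemma coeff_A (m : Fin N →₀ ℕ) (i : Fin N) (F : MvPolynomial (Fin N) ℝ) :
    coeff m (Aop id i F) = (if m i = 0 then 0 else coeff (m.update i (m i - 1)) F) +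
      ((m i : ℝ) + 1) * coeff (m.update i (m i + 1)) F := by
  rw [Aop_apply, coeff_add, coeff_X_mul', id, coeff_pderiv, mul_comm]
  have h1 : m - Finsupp.single i 1 = m.update i (m i - 1) := by
    ext t; by_cases h : t = i
    · subst h; simp [Finsupp.update_apply]
    · simp [Finsupp.update_apply, h, Finsupp.single_apply, Ne.symm h]
  have h2 : m + Finsupp.single i 1 = m.update i (m i + 1) := by
    ext t; by_cases h : t = i
    · subst h; simp [Finsupp.update_apply]
    · simp [Finsupp.update_apply, h, Finsupp.single_apply, Ne.symm h]
  rw [h1, h2]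
  congr 1
  by_cases h : m i = 0 <;> simp [h]

lemma coeff_Apow (i : Fin N) (F : MvPolynomial (Fin N) ℝ) (p : ℕ) :
    ∀ (m : Fin N →₀ ℕ) (L : ℕ), m i + p < L → coeff m ((Aop id i ^ p) F) =
      ∑ l ∈ Finset.range L, al p l (m i) * coeff (m.update i l) F := by
  induction p with
  | zero =>
    intro m L hL
    rw [Finset.sum_eq_single (m i)]
    · simp [al, Finsupp.update_self]
    · intro l _ h
      simp [al, h]
    · intro h
      simp at h; omega
  | succ p ih =>
    intro m L hL
    rw [pow_succ', Module.End.mul_apply, coeff_A, ih (m.update i (m i + 1)) L (by simp [Finsupp.update_apply]; omega)]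
    simp only [al, add_mul, Finset.sum_add_distrib, update_self']
    congr 1
    · split_ifs with h
      · simp
      · rw [ih (m.update i (m i - 1)) L (by simp [Finsupp.update_apply]; omega)]
        simp [Finsupp.update_apply, update_self']
    · simp [Finsupp.update_apply, Finset.mul_sum, mul_assoc]

lemma del_apply (i : Fin N) : del N i = (i : ℕ) := by simp [del]

lemma coeff_two (i j : Fin N) (hij : j ≠ i) (s : ℕ) (hs : 1 ≤ s) (l : ℕ) :
    coeff (((del N).update i (i + s)).update j l) (VV N) =
      if (j : ℕ) = i + s ∧ l = i then -1 else 0 := by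
  split_ifs with h
  · obtain ⟨h, rfl⟩ := h
    have : ((del N).update i (i + s)).update j i = mexp (Equiv.swap i j) := by
      ext t
      by_cases h1 : t = j
      · subst h1; simp [Finsupp.update_apply]
      · by_cases h2 : t = i
        · subst h2; simp [Finsupp.update_apply, h1, h]
        · simp [Finsupp.update_apply, h1, h2, del_apply, Equiv.swap_apply_of_ne_of_ne h2 h1]
    rw [this, coeff_VV, Equiv.Perm.sign_swap (Ne.symm hij)]
    simp
  · by_contra hne
    have hd : (((del N).update i (i + s)).update j l).degree = E0 N := by
      by_contra h2; exact hne (VV_hom _ h2)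
    have h1 := deg_update ((del N).update i (i + s)) j l
    have h2 := deg_update (del N) i (i + s)
    rw [hd] at h1
    rw [del_deg, del_apply] at h2
    simp only [Finsupp.update_apply, hij, if_false, del_apply] at h1
    rw [VV_eq, coeff_sum] at hne
    obtain ⟨σ, _, hσ⟩ := Finset.exists_ne_zero_of_sum_ne_zero hne
    rw [coeff_monomial] at hσ
    have he : mexp σ = ((del N).update i (i + s)).update j l := by
      by_contra h3; exact hσ (if_neg h3)
    have hi : (σ i : ℕ) = i + s := by
      have := DFunLike.congr_fun he i
      simpa [Finsupp.update_apply, Ne.symm hij] using this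
    apply h
    have hj : σ i = j := by
      by_contra h4
      have hii : σ i ≠ i := by
        intro h5; rw [h5] at hi; omega
      have := DFunLike.congr_fun he (σ i)
      simp [Finsupp.update_apply, h4, hii, del_apply] at this
      exact hii (σ.injective (Fin.ext this))
    rw [hj] at hi
    exact ⟨hi, by omega⟩

theorem Bf_tt_eq {E : MvPolynomial (Fin N × Fin N) ℝ →ₗ[ℝ] ℝ} (hE1 : E 1 = 1)
    (hE : ∀ a F, E (X a * F) = E (pderiv (Prod.swap a) F)) (p q s : ℕ) (hs : 1 ≤ s) :
    Bf Prod.swap E s (tt N p) (tt N q) =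
      ∑ i ∈ Finset.range N, if N ≤ i + s then al p (i + s) i * al q i (i + s) else 0 := by
  rw [Bf_tt hE1 hE, coeff_sum, ← Fin.sum_univ_eq_sum_range
    (fun i => if N ≤ i + s then al p (i + s) i * al q i (i + s) else 0)]
  refine Finset.sum_congr rfl fun i _ => ?_
  rw [coeff_Apow i _ p (del N) (i + p + s + 1) (by rw [del_apply]; omega),
    Finset.sum_eq_single ((i : ℕ) + s)]
  rotate_left
  · intro l _ hl
    rw [coeff_homogeneousComponent, if_neg, mul_zero]
    intro h
    have := deg_update (del N) i l
    rw [h, del_deg, del_apply] at this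
    omega
  · intro h; exact absurd (Finset.mem_range.2 (by omega)) h
  have hdeg : ((del N).update i (i + s)).degree = E0 N + s := by
    have := deg_update (del N) i (i + s)
    rw [del_deg, del_apply] at this
    omega
  rw [coeff_homogeneousComponent, if_pos hdeg, del_apply, coeff_sum]
  have hj : ∀ j : Fin N, coeff ((del N).update i (i + s)) ((Aop id j ^ q) (VV N)) =
      (if j = i then al q i (i + s) else 0) - if (j : ℕ) = i + s then al q i (i + s) else 0 := by
    intro j
    rw [coeff_Apow j _ q _ (i + j + s + q + 1) (by
      by_cases h : j = i <;> simp [Finsupp.update_apply, h, del_apply] <;> omega)]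
    by_cases h : j = i
    · subst h
      simp only [update_self']
      rw [if_pos trivial, if_neg (by omega), sub_zero, Finset.sum_eq_single (j : ℕ)]
      · have : (del N).update j j = mexp 1 := by
          ext t; by_cases h : t = j
          · subst h; simp [Finsupp.update_apply]
          · simp [Finsupp.update_apply, h, del]
        rw [this, coeff_VV]
        simp [Finsupp.update_apply]
      · intro l _ hl
        rw [VV_hom, mul_zero]
        intro h
        have := deg_update (del N) j l
        rw [h, del_deg, del_apply] at this
        omega
      · intro h; exact absurd (Finset.mem_range.2 (by omega)) h
    · simp only [coeff_two i j h s hs]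
      rw [if_neg h, Finset.sum_eq_single (i : ℕ)]
      · simp only [and_true, Finsupp.update_apply, if_neg h, del_apply]
        split_ifs with h2
        · rw [h2]; ring
        · simp
      · intro l _ hl
        rw [if_neg (by tauto), mul_zero]
      · intro h; exact absurd (Finset.mem_range.2 (by omega)) h
  rw [Finset.sum_congr rfl fun j _ => hj j, Finset.sum_sub_distrib, Finset.sum_ite_eq' Finset.univ i]
  simp only [Finset.mem_univ, if_true]
  split_ifs with h
  · rw [Finset.sum_eq_zero, sub_zero]
    intro j _
    rw [if_neg]; omega
  · rw [Finset.sum_eq_single (⟨i + s, by omega⟩ : Fin N)]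
    · simp
    · intro j _ hj
      rw [if_neg]
      intro h2; exact hj (Fin.ext h2)
    · simp

end ferm
end AGF

set_option linter.unusedSectionVars false
set_option linter.unusedSimpArgs false

namespace AGF

noncomputable def w (n : ℕ) : ℝ := ((n.factorial : ℕ) : ℝ)⁻¹

lemma w_succ (n : ℕ) : ((n : ℝ) + 1) * w (n + 1) = w n := by
  unfold w
  rw [Nat.factorial_succ]
  have : ((n.factorial : ℕ) : ℝ) ≠ 0 := by positivity
  push_cast
  field_simp

noncomputable def w2 (n : ℕ) : ℝ := (2 ^ n : ℝ)⁻¹ * w n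

lemma w2_succ (n : ℕ) : 2 * ((n : ℝ) + 1) * w2 (n + 1) = w2 n := by
  unfold w2
  rw [← w_succ n, pow_succ]
  field_simp

noncomputable def cc (p k l i u v : ℕ) : ℝ :=
  if 2 * i + u + v = p ∧ l + v = k + u then w2 i * w u * w v * (k.descFactorial v : ℝ) else 0

noncomputable def bb (M p k l : ℕ) : ℝ :=
  ∑ i ∈ Finset.range M, ∑ u ∈ Finset.range M, ∑ v ∈ Finset.range M, cc p k l i u v

lemma shift (f : ℕ → ℝ) (M : ℕ) (h0 : f 0 = 0) (hM : f M = 0) :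
    ∑ u ∈ Finset.range M, f u = ∑ u ∈ Finset.range M, f (u + 1) := by
  have h1 := Finset.sum_range_succ f M
  have h2 := Finset.sum_range_succ' f M
  rw [h1, h0, hM] at h2
  simpa using h2

lemma bb_rec (M p k l : ℕ) (hM : p + 1 < M) :
    ((p : ℝ) + 1) * bb M (p + 1) k l = (if l = 0 then 0 else bb M p k (l - 1)) +
      ((l : ℝ) + 1) * bb M p k (l + 1) := by
  have e1 : ((p : ℝ) + 1) * bb M (p + 1) k l =
      (∑ i ∈ Finset.range M, ∑ u ∈ Finset.range M, ∑ v ∈ Finset.range M, 2 * (i : ℝ) * cc (p+1) k l i u v) +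
      (∑ i ∈ Finset.range M, ∑ u ∈ Finset.range M, ∑ v ∈ Finset.range M, (u : ℝ) * cc (p+1) k l i u v) +
      (∑ i ∈ Finset.range M, ∑ u ∈ Finset.range M, ∑ v ∈ Finset.range M, (v : ℝ) * cc (p+1) k l i u v) := by
    simp only [bb, Finset.mul_sum, ← Finset.sum_add_distrib]
    refine Finset.sum_congr rfl fun i _ => Finset.sum_congr rfl fun u _ =>
      Finset.sum_congr rfl fun v _ => ?_
    unfold cc
    split_ifs with h
    · have : (p : ℝ) + 1 = 2 * i + u + v := by exact_mod_cast h.1.symm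
      rw [this]; ring
    · simp
  have e2 : (∑ i ∈ Finset.range M, ∑ u ∈ Finset.range M, ∑ v ∈ Finset.range M, 2 * (i : ℝ) * cc (p+1) k l i u v) =
      ∑ i ∈ Finset.range M, ∑ u ∈ Finset.range M, ∑ v ∈ Finset.range M, (u : ℝ) * cc p k (l + 1) i u v := by
    rw [shift (fun i => ∑ u ∈ Finset.range M, ∑ v ∈ Finset.range M, 2 * (i : ℝ) * cc (p+1) k l i u v)]
    · refine Finset.sum_congr rfl fun i _ => ?_
      rw [shift (fun u => ∑ v ∈ Finset.range M, (u : ℝ) * cc p k (l + 1) i u v)]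
      · refine Finset.sum_congr rfl fun u _ => Finset.sum_congr rfl fun v _ => ?_
        unfold cc
        by_cases h : 2 * (i + 1) + u + v = p + 1 ∧ l + v = k + u
        · rw [if_pos h, if_pos (by omega), ← w2_succ i, ← w_succ u]
          push_cast; ring
        · rw [if_neg h, if_neg (by omega)]; simp
      · simp
      · refine Finset.sum_eq_zero fun v _ => ?_
        unfold cc; rw [if_neg (by omega), mul_zero]
    · simp
    · refine Finset.sum_eq_zero fun u _ => Finset.sum_eq_zero fun v _ => ?_
      unfold cc; rw [if_neg (by omega), mul_zero]
  have e3 : (∑ i ∈ Finset.range M, ∑ u ∈ Finset.range M, ∑ v ∈ Finset.range M, (u : ℝ) * cc (p+1) k l i u v) =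
      if l = 0 then 0 else bb M p k (l - 1) := by
    have : (∑ i ∈ Finset.range M, ∑ u ∈ Finset.range M, ∑ v ∈ Finset.range M, (u : ℝ) * cc (p+1) k l i u v) =
      ∑ i ∈ Finset.range M, ∑ u ∈ Finset.range M, ∑ v ∈ Finset.range M,
        if l = 0 then 0 else cc p k (l - 1) i u v := by
      refine Finset.sum_congr rfl fun i _ => ?_
      rw [shift (fun u => ∑ v ∈ Finset.range M, (u : ℝ) * cc (p+1) k l i u v)]
      · refine Finset.sum_congr rfl fun u _ => Finset.sum_congr rfl fun v _ => ?_
        unfold cc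
        by_cases h : 2 * i + (u + 1) + v = p + 1 ∧ l + v = k + (u + 1)
        · rw [if_pos h]
          by_cases hl : l = 0
          · rw [if_pos hl, Nat.descFactorial_of_lt (by omega)]; simp
          · rw [if_neg hl, if_pos (by omega), ← w_succ u]; push_cast; ring
        · rw [if_neg h]
          by_cases hl : l = 0
          · rw [if_pos hl]; simp
          · rw [if_neg hl, if_neg (by omega)]; simp
      · simp
      · refine Finset.sum_eq_zero fun v _ => ?_
        unfold cc; rw [if_neg (by omega), mul_zero]
    rw [this]
    split_ifs
    · simp
    · rfl
  have e4 : (∑ i ∈ Finset.range M, ∑ u ∈ Finset.range M, ∑ v ∈ Finset.range M, (v : ℝ) * cc (p+1) k l i u v) =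
      ∑ i ∈ Finset.range M, ∑ u ∈ Finset.range M, ∑ v ∈ Finset.range M,
        ((k : ℝ) - v) * cc p k (l + 1) i u v := by
    refine Finset.sum_congr rfl fun i _ => Finset.sum_congr rfl fun u _ => ?_
    rw [shift (fun v => (v : ℝ) * cc (p+1) k l i u v)]
    · refine Finset.sum_congr rfl fun v _ => ?_
      unfold cc
      by_cases h : 2 * i + u + (v + 1) = p + 1 ∧ l + (v + 1) = k + u
      · rw [if_pos h, if_pos (by omega), ← w_succ v]
        have : ((k.descFactorial (v + 1) : ℕ) : ℝ) = ((k : ℝ) - v) * (k.descFactorial v : ℝ) := by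
          rcases Nat.lt_or_ge k v with hk | hk
          · rw [Nat.descFactorial_of_lt hk, Nat.descFactorial_of_lt (by omega)]; simp
          · rw [Nat.descFactorial_succ]; push_cast [Nat.cast_sub hk]; ring
        rw [this]; push_cast; ring
      · rw [if_neg h, if_neg (by omega)]; simp
    · simp
    · show (M : ℝ) * _ = 0
      unfold cc; rw [if_neg (by omega), mul_zero]
  rw [e1, e2, e3, e4]
  have e5 : ((l : ℝ) + 1) * bb M p k (l + 1) =
      (∑ i ∈ Finset.range M, ∑ u ∈ Finset.range M, ∑ v ∈ Finset.range M, (u : ℝ) * cc p k (l + 1) i u v) +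
      ∑ i ∈ Finset.range M, ∑ u ∈ Finset.range M, ∑ v ∈ Finset.range M,
        ((k : ℝ) - v) * cc p k (l + 1) i u v := by
    simp only [bb, Finset.mul_sum, ← Finset.sum_add_distrib]
    refine Finset.sum_congr rfl fun i _ => Finset.sum_congr rfl fun u _ =>
      Finset.sum_congr rfl fun v _ => ?_
    unfold cc
    split_ifs with h
    · have : (l : ℝ) + 1 + v = k + u := by exact_mod_cast h.2
      have : (l : ℝ) + 1 = u + (k - v) := by linarith
      rw [this]; ring
    · simp
  rw [e5]; ring

lemma bb_zero (M k l : ℕ) (hM : 0 < M) : bb M 0 k l = if k = l then 1 else 0 := by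
  unfold bb
  rw [Finset.sum_eq_single 0, Finset.sum_eq_single 0, Finset.sum_eq_single 0]
  · unfold cc
    by_cases h : k = l
    · subst h; simp [w, w2]
    · rw [if_neg (by omega), if_neg h]
  · intro v _ hv; unfold cc; rw [if_neg (by omega)]
  · intro h; exact absurd (Finset.mem_range.2 hM) h
  · intro v _ hv; refine Finset.sum_eq_zero fun u _ => ?_; unfold cc; rw [if_neg (by omega)]
  · intro h; exact absurd (Finset.mem_range.2 hM) h
  · intro v _ hv; refine Finset.sum_eq_zero fun u _ => Finset.sum_eq_zero fun u _ => ?_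
    unfold cc; rw [if_neg (by omega)]
  · intro h; exact absurd (Finset.mem_range.2 hM) h

lemma al_eq (k M p : ℕ) : ∀ l, p < M → al p k l = (p.factorial : ℝ) * bb M p k l := by
  induction p with
  | zero => intro l h; rw [bb_zero M k l h]; simp [al]
  | succ p ih =>
    intro l h
    rw [Nat.factorial_succ, al, ih _ (by omega), ih _ (by omega)]
    push_cast
    rw [mul_comm ((p : ℝ) + 1), mul_assoc, bb_rec M p k l h]
    split_ifs <;> ring

lemma al_down (p s j : ℕ) (hps : p % 2 = s % 2) : al p (j + s) j = (p.factorial : ℝ) *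
    ∑ i ∈ Finset.range (p / 2 + 1), if 2 * i + s ≤ p then
      w2 i * w ((p - s) / 2 - i) * w ((p - s) / 2 - i + s) *
        ((j + s).descFactorial ((p - s) / 2 - i + s) : ℝ) else 0 := by
  rw [al_eq _ (p + 1) p _ (by omega), bb]
  congr 1
  have hsub : Finset.range (p / 2 + 1) ⊆ Finset.range (p + 1) := by
    intro x; simp only [Finset.mem_range]; omega
  rw [← Finset.sum_subset hsub]
  · refine Finset.sum_congr rfl fun i _ => ?_
    split_ifs with h
    · rw [Finset.sum_eq_single ((p - s) / 2 - i), Finset.sum_eq_single ((p - s) / 2 - i + s)]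
      · unfold cc; rw [if_pos (by omega)]
      · intro v _ hv; unfold cc; rw [if_neg (by omega)]
      · intro h; exact absurd (Finset.mem_range.2 (by omega)) h
      · intro u _ hu; refine Finset.sum_eq_zero fun v _ => ?_; unfold cc; rw [if_neg (by omega)]
      · intro h; exact absurd (Finset.mem_range.2 (by omega)) h
    · refine Finset.sum_eq_zero fun u _ => Finset.sum_eq_zero fun v _ => ?_
      unfold cc; rw [if_neg (by omega)]
  · intro i _ hi
    rw [Finset.mem_range] at hi
    refine Finset.sum_eq_zero fun u _ => Finset.sum_eq_zero fun v _ => ?_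
    unfold cc; rw [if_neg (by omega)]

lemma al_up (p s j : ℕ) (hps : p % 2 = s % 2) : al p j (j + s) = (p.factorial : ℝ) *
    ∑ i ∈ Finset.range (p / 2 + 1), if 2 * i + s ≤ p then
      w2 i * w ((p - s) / 2 - i) * w ((p - s) / 2 - i + s) *
        (j.descFactorial ((p - s) / 2 - i) : ℝ) else 0 := by
  rw [al_eq _ (p + 1) p _ (by omega), bb]
  congr 1
  have hsub : Finset.range (p / 2 + 1) ⊆ Finset.range (p + 1) := by
    intro x; simp only [Finset.mem_range]; omega
  rw [← Finset.sum_subset hsub]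
  · refine Finset.sum_congr rfl fun i _ => ?_
    split_ifs with h
    · rw [Finset.sum_eq_single ((p - s) / 2 - i + s), Finset.sum_eq_single ((p - s) / 2 - i)]
      · unfold cc; rw [if_pos (by omega)]; ring
      · intro v _ hv; unfold cc; rw [if_neg (by omega)]
      · intro h; exact absurd (Finset.mem_range.2 (by omega)) h
      · intro u _ hu; refine Finset.sum_eq_zero fun v _ => ?_; unfold cc; rw [if_neg (by omega)]
      · intro h; exact absurd (Finset.mem_range.2 (by omega)) h
    · refine Finset.sum_eq_zero fun u _ => Finset.sum_eq_zero fun v _ => ?_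
      unfold cc; rw [if_neg (by omega)]
  · intro i _ hi
    rw [Finset.mem_range] at hi
    refine Finset.sum_eq_zero fun u _ => Finset.sum_eq_zero fun v _ => ?_
    unfold cc; rw [if_neg (by omega)]

end AGF

set_option linter.unusedSectionVars false
set_option linter.unusedSimpArgs false

namespace AGF

lemma vand (j m a b L : ℕ) (ha : a ≤ j) (hb : b ≤ j) (hbm : b ≤ m) (hL : m < L) :
    ∑ l ∈ Finset.range L, j.choose l * m.choose l * l.choose a * l.choose b =
      j.choose a * m.choose b * (j - a + (m - b)).choose (j - b) := by
  have hz : ∀ l, (m < l ∨ j < l ∨ l < b) →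
      j.choose l * m.choose l * l.choose a * l.choose b = 0 := by
    rintro l (h | h | h) <;> simp [Nat.choose_eq_zero_of_lt h]
  have h1 : ∑ l ∈ Finset.range L, j.choose l * m.choose l * l.choose a * l.choose b =
      ∑ l ∈ Finset.range (L + j + 1), j.choose l * m.choose l * l.choose a * l.choose b := by
    apply Finset.sum_subset
    · intro x; simp only [Finset.mem_range]; omega
    · intro x _ hx
      rw [Finset.mem_range] at hx
      exact hz x (by omega)
  have h2 : ∑ l ∈ Finset.Ico b (j + 1), j.choose l * m.choose l * l.choose a * l.choose b =
      ∑ l ∈ Finset.range (L + j + 1), j.choose l * m.choose l * l.choose a * l.choose b := by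
    apply Finset.sum_subset
    · intro x; simp only [Finset.mem_range, Finset.mem_Ico]; omega
    · intro x _ hx
      rw [Finset.mem_Ico] at hx
      exact hz x (by omega)
  rw [h1, ← h2, Finset.sum_Ico_eq_sum_range, Nat.add_choose_eq,
    Finset.Nat.antidiagonal_eq_map', Finset.sum_map, Finset.mul_sum,
    show j + 1 - b = (j - b).succ by omega]
  refine Finset.sum_congr rfl fun t ht => ?_
  rw [Finset.mem_range] at ht
  show _ = _ * ((j - a).choose (j - b - t) * (m - b).choose t)
  have htj : b + t ≤ j := by omega
  rw [show j - b - t = j - (b + t) by omega]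
  by_cases hm : b + t ≤ m
  · have e2 := Nat.choose_mul (n := m) (Nat.le_add_right b t)
    rw [show b + t - b = t by omega] at e2
    by_cases hat : a ≤ b + t
    · have e1 := Nat.choose_mul (n := j) hat
      have e3 : (j - a).choose (b + t - a) = (j - a).choose (j - (b + t)) := by
        rw [← Nat.choose_symm (by omega : b + t - a ≤ j - a)]
        congr 1; omega
      rw [e3] at e1
      calc _ = (j.choose (b + t) * (b + t).choose a) * (m.choose (b + t) * (b + t).choose b) := by ring
        _ = _ := by rw [e1, e2]; ring
    · rw [Nat.choose_eq_zero_of_lt (show b + t < a by omega),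
        Nat.choose_eq_zero_of_lt (show j - a < j - (b + t) by omega)]
      simp
  · rw [Nat.choose_eq_zero_of_lt (show m < b + t by omega),
        Nat.choose_eq_zero_of_lt (show m - b < t by omega)]
    simp

noncomputable def gg (a b s j : ℕ) : ℝ :=
  w a * w (a + s) * ((j + s).descFactorial (a + s) : ℝ) * (w b * w (b + s) * (j.descFactorial b : ℝ))

lemma choose_w {n k : ℕ} (h : k ≤ n) :
    ((n.choose k : ℕ) : ℝ) = (n.factorial : ℝ) * w k * w (n - k) := by
  rw [Nat.cast_choose ℝ h, w, w]; field_simp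

lemma desc_w {n k : ℕ} (h : k ≤ n) :
    ((n.descFactorial k : ℕ) : ℝ) = (n.factorial : ℝ) * w (n - k) := by
  rw [← Nat.factorial_mul_descFactorial h, w]
  have : ((n-k).factorial : ℝ) ≠ 0 := by positivity
  push_cast
  field_simp

lemma fw (n : ℕ) : (n.factorial : ℝ) * w n = 1 := by
  rw [w]; apply mul_inv_cancel₀; positivity

lemma G1 (a b s j L : ℕ) (hL : a + b + s < L) :
    ∑ l ∈ Finset.range L, (j.choose l : ℝ) * ((a + b + s).choose l : ℝ) * (l.choose a : ℝ) *
      (l.choose b : ℝ) = ((a + b + s).factorial : ℝ) * gg a b s j := by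
  by_cases ha : a ≤ j
  · by_cases hb : b ≤ j
    · have := vand j (a + b + s) a b L ha hb (by omega) hL
      have h2 := congrArg (Nat.cast (R := ℝ)) this
      push_cast at h2
      rw [h2, show j - a + (a + b + s - b) = j + s by omega, choose_w ha, choose_w (show b ≤ a + b + s by omega),
        choose_w (show j - b ≤ j + s by omega), gg, desc_w (show a + s ≤ j + s by omega), desc_w hb,
        show a + b + s - b = a + s by omega, show j + s - (j - b) = b + s by omega,
        show j + s - (a + s) = j - a by omega]
      ring
    · rw [gg, Nat.descFactorial_of_lt (show j < b by omega)]
      rw [Finset.sum_eq_zero]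
      · simp
      · intro l _
        rcases Nat.lt_or_ge j l with h | h
        · rw [Nat.choose_eq_zero_of_lt h]; simp
        · rw [Nat.choose_eq_zero_of_lt (show l < b by omega)]; simp
  · rw [gg, Nat.descFactorial_of_lt (show j + s < a + s by omega)]
    rw [Finset.sum_eq_zero]
    · simp
    · intro l _
      rcases Nat.lt_or_ge j l with h | h
      · rw [Nat.choose_eq_zero_of_lt h]; simp
      · rw [Nat.choose_eq_zero_of_lt (show l < a by omega)]; simp

lemma G2 (a b s j L : ℕ) (hL : a + b + s < L) :
    ∑ l ∈ Finset.range L, (j.choose l : ℝ) * ((a + b + s).choose l : ℝ) * (l.choose (a + s) : ℝ) *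
      (l.choose (b + s) : ℝ) = if s ≤ j then ((a + b + s).factorial : ℝ) * gg a b s (j - s) else 0 := by
  by_cases ha : a + s ≤ j
  · by_cases hb : b + s ≤ j
    · have := vand j (a + b + s) (a + s) (b + s) L ha hb (by omega) hL
      have h2 := congrArg (Nat.cast (R := ℝ)) this
      push_cast at h2
      rw [if_pos (by omega), h2, show j - (a + s) + (a + b + s - (b + s)) = j - s by omega, choose_w ha,
        choose_w (show b + s ≤ a + b + s by omega),
        choose_w (show j - (b + s) ≤ j - s by omega), gg, desc_w (show a + s ≤ j - s + s by omega),
        desc_w (show b ≤ j - s by omega),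
        show a + b + s - (b + s) = a by omega, show j - s - (j - (b + s)) = b by omega,
        show j - s + s - (a + s) = j - (a + s) by omega, show j - s + s = j by omega,
        show j - s - b = j - (b + s) by omega]
      ring
    · rw [Finset.sum_eq_zero]
      · split_ifs with h
        · rw [gg, Nat.descFactorial_of_lt (show j - s < b by omega)]; simp
        · rfl
      · intro l _
        rcases Nat.lt_or_ge j l with h | h
        · rw [Nat.choose_eq_zero_of_lt h]; simp
        · rw [Nat.choose_eq_zero_of_lt (show l < b + s by omega)]; simp
  · rw [Finset.sum_eq_zero]
    · split_ifs with h
      · rw [gg, Nat.descFactorial_of_lt (show j - s + s < a + s by omega)]; simp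
      · rfl
    · intro l _
      rcases Nat.lt_or_ge j l with h | h
      · rw [Nat.choose_eq_zero_of_lt h]; simp
      · rw [Nat.choose_eq_zero_of_lt (show l < a + s by omega)]; simp

lemma hockey (N l : ℕ) : (N.choose (l + 1) : ℝ) = ∑ j ∈ Finset.range N, (j.choose l : ℝ) := by
  induction N with
  | zero => simp
  | succ N ih => rw [Finset.sum_range_succ, ← ih, Nat.choose_succ_succ]; push_cast; ring

lemma tele (g : ℕ → ℝ) (s N : ℕ) :
    ∑ j ∈ Finset.range N, (g j - if s ≤ j then g (j - s) else 0) =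
      ∑ j ∈ Finset.range N, if N ≤ j + s then g j else 0 := by
  have h : ∑ j ∈ Finset.range N, (if s ≤ j then g (j - s) else 0) =
      ∑ j ∈ Finset.range N, if N ≤ j + s then 0 else g j := by
    rcases Nat.lt_or_ge N s with h | h
    · rw [Finset.sum_eq_zero, Finset.sum_eq_zero]
      · intro j _; rw [if_pos (by omega)]
      · intro j hj; rw [Finset.mem_range] at hj; rw [if_neg (by omega)]
    · obtain ⟨t, rfl⟩ := Nat.exists_eq_add_of_le h
      rw [Finset.sum_range_add, Nat.add_comm s t, Finset.sum_range_add]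
      rw [Finset.sum_eq_zero, zero_add]
      · rw [Finset.sum_eq_zero (s := Finset.range s), add_zero]
        · refine Finset.sum_congr rfl fun x hx => ?_
          rw [Finset.mem_range] at hx
          rw [if_pos (by omega), if_neg (by omega)]
          congr 1; omega
        · intro j _; rw [if_pos (by omega)]
      · intro j hj; rw [Finset.mem_range] at hj; rw [if_neg (by omega)]
  rw [Finset.sum_sub_distrib, h, ← Finset.sum_sub_distrib]
  refine Finset.sum_congr rfl fun j _ => ?_
  split_ifs <;> simp

lemma G3 (a b s N L : ℕ) (hL : a + b + s < L) :
    ∑ l ∈ Finset.range L, (N.choose (l + 1) : ℝ) * ((a + b + s).choose l : ℝ) *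
      ((l.choose a : ℝ) * (l.choose b : ℝ) - (l.choose (a + s) : ℝ) * (l.choose (b + s) : ℝ)) =
    ((a + b + s).factorial : ℝ) * ∑ j ∈ Finset.range N, if N ≤ j + s then gg a b s j else 0 := by
  rw [← tele, Finset.mul_sum]
  have : ∀ j ∈ Finset.range N, ((a + b + s).factorial : ℝ) *
      (gg a b s j - if s ≤ j then gg a b s (j - s) else 0) =
      ∑ l ∈ Finset.range L, (j.choose l : ℝ) * ((a + b + s).choose l : ℝ) *
      ((l.choose a : ℝ) * (l.choose b : ℝ) - (l.choose (a + s) : ℝ) * (l.choose (b + s) : ℝ)) := by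
    intro j _
    rw [mul_sub, ← G1 a b s j L hL, mul_ite, mul_zero, ← G2 a b s j L hL, ← Finset.sum_sub_distrib]
    refine Finset.sum_congr rfl fun l _ => ?_
    ring
  rw [Finset.sum_congr rfl this, Finset.sum_comm]
  refine Finset.sum_congr rfl fun l _ => ?_
  rw [hockey, Finset.sum_mul, Finset.sum_mul]

end AGF

set_option linter.unusedSectionVars false
set_option linter.unusedSimpArgs false

namespace AGF

lemma desc_prod (N k : ℕ) : ∏ t ∈ Finset.range k, ((N : ℝ) - t) = (N.descFactorial k : ℝ) := by
  induction k with
  | zero => simp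
  | succ k ih =>
    rw [Finset.prod_range_succ, ih, Nat.descFactorial_succ]
    rcases Nat.lt_or_ge N k with h | h
    · rw [Nat.descFactorial_of_lt h]; simp
    · push_cast [Nat.cast_sub h]; ring

lemma realChoose_nat (N k : ℕ) : realChoose (N : ℝ) k = (N.choose k : ℝ) := by
  rw [realChoose, desc_prod, Nat.descFactorial_eq_factorial_mul_choose]
  have : (k.factorial : ℝ) ≠ 0 := by positivity
  push_cast; field_simp

lemma ichoose_nat (l a : ℕ) : ichoose (l : ℤ) (a : ℤ) = (l.choose a : ℤ) := by
  unfold ichoose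
  split_ifs with h
  · simp
  · rw [Nat.choose_eq_zero_of_lt (by omega)]; simp

lemma ichoose_neg (l a : ℤ) (h : a < 0 ∨ l < a) : ichoose l a = 0 := by
  unfold ichoose; rw [if_neg (by omega)]

lemma inner_eq (p q s n N i j : ℕ) (hs : 1 ≤ s)
    (hps : p % 2 = s % 2) (hqs : q % 2 = s % 2) (hn : p + q = 2 * n)
    (hi : i < p / 2 + 1) (hj : j < q / 2 + 1) :
    ∑ k ∈ Finset.range (n + 1),
            (realChoose N (k + 1) * ((n - i - j).choose k : ℝ)) /
              (2 ^ (i + j) * (Nat.factorial i : ℝ) * (Nat.factorial j : ℝ) *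
                (Nat.factorial (n - i - j) : ℝ)) *
            ((ichoose (k : ℤ) (((p : ℤ) - s) / 2 - i) *
                ichoose (k : ℤ) (((q : ℤ) - s) / 2 - j) -
              ichoose (k : ℤ) (((p : ℤ) + s) / 2 - i) *
                ichoose (k : ℤ) (((q : ℤ) + s) / 2 - j) : ℤ) : ℝ) =
    ∑ t ∈ Finset.range N, if N ≤ t + s then
      (if 2 * i + s ≤ p then
      w2 i * w ((p - s) / 2 - i) * w ((p - s) / 2 - i + s) *
        ((t + s).descFactorial ((p - s) / 2 - i + s) : ℝ) else 0) *
      (if 2 * j + s ≤ q then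
      w2 j * w ((q - s) / 2 - j) * w ((q - s) / 2 - j + s) *
        (t.descFactorial ((q - s) / 2 - j) : ℝ) else 0) else 0 := by
  by_cases h1 : 2 * i + s ≤ p
  · by_cases h2 : 2 * j + s ≤ q
    · obtain ⟨a, ha⟩ : ∃ a, a = (p - s) / 2 - i := ⟨_, rfl⟩
      obtain ⟨b, hb⟩ : ∃ b, b = (q - s) / 2 - j := ⟨_, rfl⟩
      simp only [if_pos h1, if_pos h2, ← ha, ← hb]
      rw [show ((p : ℤ) - s) / 2 - i = (a : ℕ) by omega, show ((q : ℤ) - s) / 2 - j = (b : ℕ) by omega,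
        show ((p : ℤ) + s) / 2 - i = ((a + s : ℕ) : ℤ) by omega,
        show ((q : ℤ) + s) / 2 - j = ((b + s : ℕ) : ℤ) by omega, show n - i - j = a + b + s by omega]
      simp only [ichoose_nat, realChoose_nat]
      have h := G3 a b s N (n + 1) (by omega)
      have hm : ((a + b + s).factorial : ℝ) ≠ 0 := by positivity
      have e1 : ∀ t ∈ Finset.range N, (if N ≤ t + s then
          w2 i * w a * w (a + s) * ((t + s).descFactorial (a + s) : ℝ) *
          (w2 j * w b * w (b + s) * (t.descFactorial b : ℝ)) else 0) =
          w2 i * w2 j * if N ≤ t + s then gg a b s t else 0 := by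
        intro t _
        split_ifs
        · rw [gg]; ring
        · simp
      rw [Finset.sum_congr rfl e1, ← Finset.mul_sum]
      have e2 : ∑ j ∈ Finset.range N, (if N ≤ j + s then gg a b s j else 0) =
          w (a + b + s) * ∑ l ∈ Finset.range (n + 1), (N.choose (l + 1) : ℝ) * ((a + b + s).choose l : ℝ) *
      ((l.choose a : ℝ) * (l.choose b : ℝ) - (l.choose (a + s) : ℝ) * (l.choose (b + s) : ℝ)) := by
        rw [h, ← mul_assoc, mul_comm (w _), fw, one_mul]
      rw [e2, Finset.mul_sum, Finset.mul_sum]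
      refine Finset.sum_congr rfl fun l _ => ?_
      push_cast
      rw [w2, w2, w, w, w]
      field_simp
      ring
    · simp only [if_neg h2]
      rw [Finset.sum_eq_zero, Finset.sum_eq_zero]
      · intro t _; simp
      · intro k _
        rw [ichoose_neg _ (((q : ℤ) - s) / 2 - j) (by omega)]
        rcases Nat.lt_or_ge (n - i - j) k with h | h
        · rw [Nat.choose_eq_zero_of_lt h]; simp
        · rw [ichoose_neg _ (((p : ℤ) + s) / 2 - i) (by omega)]; simp
  · simp only [if_neg h1]
    rw [Finset.sum_eq_zero, Finset.sum_eq_zero]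
    · intro t _; simp
    · intro k _
      rw [ichoose_neg _ (((p : ℤ) - s) / 2 - i) (by omega)]
      rcases Nat.lt_or_ge (n - i - j) k with h | h
      · rw [Nat.choose_eq_zero_of_lt h]; simp
      · rw [ichoose_neg _ (((q : ℤ) + s) / 2 - j) (by omega)]; simp

theorem rhs_nat (p q s n N : ℕ) (hs : 1 ≤ s)
    (hps : p % 2 = s % 2) (hqs : q % 2 = s % 2) (hn : p + q = 2 * n) :
      (p.factorial : ℝ) * (q.factorial : ℝ) *
        ∑ k ∈ Finset.Icc 1 (n + 1), ∑ i ∈ Finset.range (p / 2 + 1),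
          ∑ j ∈ Finset.range (q / 2 + 1),
            (realChoose (N : ℝ) k * ((n - i - j).choose (k - 1) : ℝ)) /
              (2 ^ (i + j) * (Nat.factorial i : ℝ) * (Nat.factorial j : ℝ) *
                (Nat.factorial (n - i - j) : ℝ)) *
            ((ichoose ((k : ℤ) - 1) (((p : ℤ) - s) / 2 - i) *
                ichoose ((k : ℤ) - 1) (((q : ℤ) - s) / 2 - j) -
              ichoose ((k : ℤ) - 1) (((p : ℤ) + s) / 2 - i) *
                ichoose ((k : ℤ) - 1) (((q : ℤ) + s) / 2 - j) : ℤ) : ℝ) =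
      ∑ i ∈ Finset.range N, if N ≤ i + s then al p (i + s) i * al q i (i + s) else 0 := by
  rw [show Finset.Icc 1 (n + 1) = Finset.Ico 1 (n + 1 + 1) by rfl, Finset.sum_Ico_eq_sum_range]
  simp only [Nat.add_sub_cancel, Nat.add_comm 1, Nat.cast_add, Nat.cast_one, add_sub_cancel_right]
  rw [Finset.sum_comm]
  have : ∀ i ∈ Finset.range (p / 2 + 1), ∀ j ∈ Finset.range (q / 2 + 1), _ := fun i hi j hj =>
    inner_eq p q s n N i j hs hps hqs hn (Finset.mem_range.1 hi) (Finset.mem_range.1 hj)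
  rw [Finset.sum_congr rfl fun i hi => (Finset.sum_comm.trans (Finset.sum_congr rfl fun j hj => this i hi j hj))]
  rw [Finset.sum_congr rfl fun i hi => Finset.sum_comm, Finset.sum_comm, Finset.mul_sum]
  refine Finset.sum_congr rfl fun t _ => ?_
  by_cases h : N ≤ t + s
  · simp only [if_pos h]
    rw [al_down p s t hps, al_up q s t hqs, mul_mul_mul_comm, Finset.sum_mul_sum]
  · simp only [if_neg h]
    simp
end AGF

set_option linter.unusedSectionVars false
set_option linter.unusedSimpArgs false

namespace AGF
open MvPolynomial

section wick
variable {A : Type} [Fintype A] [DecidableEq A]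

def PP (S : Finset A) : Finset (Equiv.Perm A) :=
  Finset.univ.filter fun μ => (∀ v, μ (μ v) = v) ∧ ∀ v, μ v ≠ v ↔ v ∈ S

lemma mem_PP {S : Finset A} {μ : Equiv.Perm A} :
    μ ∈ PP S ↔ (∀ v, μ (μ v) = v) ∧ ∀ v, μ v ≠ v ↔ v ∈ S := by simp [PP]

lemma sw_app {S : Finset A} {a b : A} (hab : b ≠ a) {μ : Equiv.Perm A}
    (h : μ ∈ PP ((S.erase a).erase b)) (v : A) :
    (Equiv.swap a b * μ) v = if v = a then b else if v = b then a else μ v := by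
  rw [mem_PP] at h
  have ha : μ a = a := by
    by_contra h'; have := (h.2 a).1 h'; simp at this
  have hb : μ b = b := by
    by_contra h'; have := (h.2 b).1 h'; simp at this
  rw [Equiv.Perm.mul_apply]
  split_ifs with h1 h2
  · subst h1; rw [ha]; simp
  · subst h2; rw [hb]; simp
  · apply Equiv.swap_apply_of_ne_of_ne
    · intro h3; apply h1; rw [← h.1 v, h3, ha]
    · intro h3; apply h2; rw [← h.1 v, h3, hb]

lemma sw_mem {S : Finset A} {a b : A} (ha : a ∈ S) (hb : b ∈ S) (hab : b ≠ a) {μ : Equiv.Perm A}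
    (h : μ ∈ PP ((S.erase a).erase b)) : Equiv.swap a b * μ ∈ PP S := by
  have hs := sw_app hab h
  rw [mem_PP] at h ⊢
  constructor
  · intro v
    rw [hs v]
    split_ifs with h1 h2
    · rw [hs b, if_neg hab, if_pos rfl, h1]
    · rw [hs a, if_pos rfl, h2]
    · rw [hs, if_neg, if_neg, h.1]
      · intro h3; apply h2
        have := (h.2 b).not.1; rw [← h.1 v, h3]
        by_contra h'
        have := (h.2 b).1 h'; simp at this
      · intro h3; apply h1
        rw [← h.1 v, h3]
        by_contra h'
        have := (h.2 a).1 h'; simp at this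
  · intro v
    rw [hs v]
    split_ifs with h1 h2
    · subst h1; simp [hab, ha]
    · subst h2; simp [Ne.symm hab, hb]
    · rw [h.2 v]; simp [h1, h2]

lemma sum_PP {R : Type} [AddCommMonoid R] {S : Finset A} {a : A} (ha : a ∈ S)
    (Φ : Equiv.Perm A → R) :
    ∑ μ ∈ PP S, Φ μ = ∑ b ∈ S.erase a, ∑ μ ∈ PP ((S.erase a).erase b), Φ (Equiv.swap a b * μ) := by
  rw [Finset.sum_sigma']
  symm
  refine Finset.sum_bij' (fun x _ => Equiv.swap a x.1 * x.2)
    (fun μ _ => ⟨μ a, Equiv.swap a (μ a) * μ⟩) ?_ ?_ ?_ ?_ ?_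
  · rintro ⟨b, μ⟩ h
    rw [Finset.mem_sigma, Finset.mem_erase] at h
    exact sw_mem ha h.1.2 h.1.1 h.2
  · intro μ h
    rw [mem_PP] at h
    have h1 : μ a ≠ a := (h.2 a).2 ha
    rw [Finset.mem_sigma]
    refine ⟨?_, ?_⟩
    · rw [Finset.mem_erase]
      exact ⟨h1, (h.2 _).1 (by rw [h.1]; exact Ne.symm h1)⟩
    · have hs : ∀ v, (Equiv.swap a (μ a) * μ) v = if v = a then a else if v = μ a then μ a else μ v := by
        intro v
        rw [Equiv.Perm.mul_apply]
        split_ifs with h2 h3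
        · rw [h2]; simp
        · rw [h3, h.1]; simp
        · apply Equiv.swap_apply_of_ne_of_ne
          · intro h4; apply h3; rw [← h.1 v, h4]
          · intro h4; apply h2; exact μ.injective h4
      rw [mem_PP]
      simp only [hs]
      constructor
      · intro v
        by_cases h2 : v = a
        · simp [h2]
        · by_cases h3 : v = μ a
          · simp [h3, h1]
          · have h4 : μ v ≠ a := by intro h4; apply h3; rw [← h4, h.1]
            have h5 : μ v ≠ μ a := fun h5 => h2 (μ.injective h5)
            simp [h2, h3, h4, h5, h.1]
      · intro v
        by_cases h2 : v = a
        · simp [h2]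
        · by_cases h3 : v = μ a
          · simp [h3, h1]
          · have := h.2 v
            simp [h2, h3]
            simpa using this
  · rintro ⟨b, μ⟩ h
    rw [Finset.mem_sigma, Finset.mem_erase] at h
    have hs := sw_app h.1.1 h.2
    have hb : (Equiv.swap a b * μ) a = b := by rw [hs, if_pos rfl]
    simp only [hb]
    rw [← mul_assoc, Equiv.swap_mul_self, one_mul]
  · intro μ h
    simp only
    rw [← mul_assoc, Equiv.swap_mul_self, one_mul]
  · intros; rfl

variable (c : A → Bool)

def mix (μ : Equiv.Perm A) : ℕ :=
  (Finset.univ.filter fun v => c v = false ∧ c (μ v) = true).card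

lemma mix_swap {S : Finset A} {a b : A} (hab : b ≠ a) {μ : Equiv.Perm A}
    (h : μ ∈ PP ((S.erase a).erase b)) :
    mix c (Equiv.swap a b * μ) = mix c μ + if c a = c b then 0 else 1 := by
  have hs := sw_app hab h
  rw [mem_PP] at h
  have ha : μ a = a := by
    by_contra h'; have := (h.2 a).1 h'; simp at this
  have hb : μ b = b := by
    by_contra h'; have := (h.2 b).1 h'; simp at this
  unfold mix
  rw [Finset.card_filter, Finset.card_filter, ← Finset.add_sum_erase _ _ (Finset.mem_univ a),
    ← Finset.add_sum_erase _ (fun v => if c v = false ∧ c (μ v) = true then 1 else 0) (Finset.mem_univ a),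
    ← Finset.add_sum_erase _ _ (show b ∈ Finset.univ.erase a by simp [hab]),
    ← Finset.add_sum_erase _ (fun v => if c v = false ∧ c (μ v) = true then 1 else 0)
      (show b ∈ Finset.univ.erase a by simp [hab])]
  have : ∑ v ∈ (Finset.univ.erase a).erase b,
      (if c v = false ∧ c ((Equiv.swap a b * μ) v) = true then 1 else 0) =
      ∑ v ∈ (Finset.univ.erase a).erase b, if c v = false ∧ c (μ v) = true then 1 else 0 := by
    refine Finset.sum_congr rfl fun v hv => ?_
    simp only [Finset.mem_erase] at hv
    rw [hs, if_neg hv.2.1, if_neg hv.1]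
  rw [this, hs, hs, if_pos rfl, if_neg hab, if_pos rfl, ha, hb]
  rcases hca : c a <;> rcases hcb : c b <;> simp <;> omega

variable {I : Type} [Fintype I] [DecidableEq I] (bar : I → I) (e : A → I)

noncomputable def WW (s : ℕ) (S : Finset A) : ℝ :=
  ∑ μ ∈ PP S, if mix c μ = s ∧ ∀ v ∈ S, e (μ v) = bar (e v) then 1 else 0

lemma WW_rec (hb : ∀ a, bar (bar a) = a) {S : Finset A} {a : A} (ha : a ∈ S) (s : ℕ) :
    WW c bar e s S = ∑ b ∈ S.erase a, if e b = bar (e a) then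
      (if c a = c b then WW c bar e s ((S.erase a).erase b) else
        if s = 0 then 0 else WW c bar e (s - 1) ((S.erase a).erase b)) else 0 := by
  rw [WW, sum_PP ha]
  refine Finset.sum_congr rfl fun b hbm => ?_
  rw [Finset.mem_erase] at hbm
  have key : ∀ μ ∈ PP ((S.erase a).erase b), (∀ v ∈ S, e ((Equiv.swap a b * μ) v) = bar (e v)) ↔
      e b = bar (e a) ∧ ∀ v ∈ (S.erase a).erase b, e (μ v) = bar (e v) := by
    intro μ hμ
    have hs := sw_app hbm.1 hμ
    constructor
    · intro h
      refine ⟨?_, ?_⟩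
      · have := h a ha
        rwa [hs, if_pos rfl] at this
      · intro v hv
        simp only [Finset.mem_erase] at hv
        have := h v hv.2.2
        rwa [hs, if_neg hv.2.1, if_neg hv.1] at this
    · rintro ⟨h1, h2⟩ v hv
      rw [hs]
      split_ifs with h3 h4
      · rw [h3]; exact h1
      · rw [h4, h1, hb]
      · exact h2 v (by simp [h3, h4, hv])
  have key2 : ∀ μ ∈ PP ((S.erase a).erase b),
      (if mix c (Equiv.swap a b * μ) = s ∧ ∀ v ∈ S, e ((Equiv.swap a b * μ) v) = bar (e v) then (1:ℝ) else 0) =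
      if (mix c μ + if c a = c b then 0 else 1) = s ∧ e b = bar (e a) ∧
        ∀ v ∈ (S.erase a).erase b, e (μ v) = bar (e v) then 1 else 0 := by
    intro μ hμ
    simp only [key μ hμ, mix_swap c hbm.1 hμ]
  rw [Finset.sum_congr rfl key2]
  by_cases h1 : e b = bar (e a)
  · rw [if_pos h1]
    by_cases h2 : c a = c b
    · simp only [if_pos h2, h1, true_and, add_zero]; rfl
    · simp only [if_neg h2, h1, true_and]
      by_cases h3 : s = 0
      · subst h3; simp
      · rw [if_neg h3, WW]
        refine Finset.sum_congr rfl fun μ _ => ?_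
        have : mix c μ + 1 = s ↔ mix c μ = s - 1 := by omega
        simp only [this]
  · simp [h1]

lemma pd_prod (T : Finset A) (i : I) :
    pderiv i (∏ v ∈ T, (X (e v) : MvPolynomial I ℝ)) =
      ∑ b ∈ T, if e b = i then ∏ v ∈ T.erase b, X (e v) else 0 := by
  induction T using Finset.induction_on with
  | empty => simp
  | insert a T ha ih =>
    rw [Finset.prod_insert ha, Derivation.leibniz, ih, Finset.sum_insert ha, Finset.erase_insert ha,
      add_comm, pderiv_X, Pi.single_apply, smul_eq_mul, smul_eq_mul, Finset.mul_sum]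
    congr 1
    · by_cases h : i = e a
      · simp [h]
      · simp [h, Ne.symm h]
    · refine Finset.sum_congr rfl fun b hb => ?_
      have hab : a ≠ b := fun h => ha (h ▸ hb)
      rw [Finset.erase_insert_of_ne hab, Finset.prod_insert (by simp [ha]), mul_ite, mul_zero]

noncomputable def HH (d : Bool) (T : Finset A) : MvPolynomial I ℝ :=
  ∏ v ∈ T.filter (fun v => c v = d), X (e v)

lemma pd_HH (d : Bool) (T : Finset A) (i : I) :
    pderiv i (HH c e d T) = ∑ b ∈ T, if e b = i then (if c b = d then HH c e d (T.erase b) else 0) else 0 := by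
  rw [HH, pd_prod, Finset.sum_filter]
  refine Finset.sum_congr rfl fun b _ => ?_
  rw [HH, Finset.filter_erase]
  split_ifs <;> rfl

lemma HH_ne (d : Bool) (T : Finset A) (b : A) (h : c b ≠ d) :
    HH c e d (T.erase b) = HH c e d T := by
  rw [HH, HH, Finset.filter_erase, Finset.erase_eq_of_notMem (by simp [h])]

lemma HH_X (d : Bool) (T : Finset A) (a : A) (ha : a ∈ T) (h : c a = d) :
    HH c e d T = X (e a) * HH c e d (T.erase a) := by
  rw [HH, HH, Finset.filter_erase, Finset.mul_prod_erase _ (fun v => X (e v)) (by simp [ha, h])]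

variable {bar}

theorem wick {E : MvPolynomial I ℝ →ₗ[ℝ] ℝ} (hb : ∀ a, bar (bar a) = a) (hE1 : E 1 = 1)
    (hE : ∀ a F, E (X a * F) = E (pderiv (bar a) F)) (n : ℕ) : ∀ (S : Finset A), S.card ≤ n → ∀ s,
    WW c bar e s S = Bf bar E s (HH c e false S) (HH c e true S) := by
  induction n with
  | zero => 
    intro S hS s
    have : S = ∅ := by simpa using hS
    subst this
    have h1 : PP (∅ : Finset A) = {1} := by
      ext μ; rw [mem_PP]; simp only [Finset.notMem_empty, iff_false, not_not, Finset.mem_singleton]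
      constructor
      · intro h; ext v; exact h.2 v
      · rintro rfl; simp
    rw [WW, h1, Finset.sum_singleton]
    cases s with
    | zero => simp [mix, HH, Bf_zero, hE1]
    | succ s => simp [mix, HH, Bf_one]
  | succ n ih =>
    intro S hS s
    by_cases hL : ∃ a ∈ S, c a = false
    · obtain ⟨a, ha, hca⟩ := hL
      have hcard : ∀ b ∈ S.erase a, ((S.erase a).erase b).card ≤ n := by
        intro b hb
        rw [Finset.card_erase_of_mem hb, Finset.card_erase_of_mem ha]; omega
      rw [WW_rec c bar e hb ha, HH_X c e false S a ha hca, ← HH_ne c e true S a (by simp [hca])]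
      have e1 : ∀ s, Bf bar E s (pderiv (bar (e a)) (HH c e false (S.erase a))) (HH c e true (S.erase a)) =
          ∑ b ∈ S.erase a, if e b = bar (e a) then
            (if c a = c b then WW c bar e s ((S.erase a).erase b) else 0) else 0 := by
        intro s
        rw [pd_HH, map_sum, LinearMap.sum_apply]
        refine Finset.sum_congr rfl fun b hb => ?_
        by_cases h1 : e b = bar (e a)
        · rw [if_pos h1, if_pos h1, hca]
          by_cases h2 : c b = false
          · rw [if_pos h2, if_pos h2.symm, ih _ (hcard b hb), HH_ne c e true _ b (by simp [h2])]
          · rw [if_neg h2, if_neg (Ne.symm h2)]; simp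
        · simp [h1]
      have e2 : ∀ s, Bf bar E s (HH c e false (S.erase a)) (pderiv (bar (e a)) (HH c e true (S.erase a))) =
          ∑ b ∈ S.erase a, if e b = bar (e a) then
            (if c a = c b then 0 else WW c bar e s ((S.erase a).erase b)) else 0 := by
        intro s
        rw [pd_HH, map_sum]
        refine Finset.sum_congr rfl fun b hb => ?_
        by_cases h1 : e b = bar (e a)
        · rw [if_pos h1, if_pos h1, hca]
          by_cases h2 : c b = true
          · rw [if_pos h2, if_neg (by simp [h2]), ih _ (hcard b hb), HH_ne c e false _ b (by simp [h2])]
          · rw [if_neg h2, if_pos (by simpa using Ne.symm h2)]; simp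
        · simp [h1]
      cases s with
      | zero =>
        rw [Bf_X_zero hE, e1]
        simp
      | succ s =>
        rw [Bf_X hE, e1, e2, ← Finset.sum_add_distrib]
        refine Finset.sum_congr rfl fun b _ => ?_
        by_cases h1 : e b = bar (e a) <;> by_cases h2 : c a = c b <;> simp [h1, h2]
    · push Not at hL
      have hF : HH c e false S = 1 := by
        rw [HH, Finset.filter_false_of_mem (fun v hv => hL v hv), Finset.prod_empty]
      have hm : ∀ v ∈ S, c v = true := fun v hv => by simpa using hL v hv
      rw [hF]
      cases s with
      | succ s =>
        rw [Bf_one, WW]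
        refine Finset.sum_eq_zero fun μ hμ => ?_
        rw [if_neg]
        rintro ⟨h1, -⟩
        have : mix c μ = 0 := by
          rw [mix, Finset.card_eq_zero, Finset.filter_eq_empty_iff]
          rintro v - ⟨h2, h3⟩
          rw [mem_PP] at hμ
          have : μ v ≠ v := by intro h; rw [h, h2] at h3; simp at h3
          exact hL v ((hμ.2 v).1 this) h2
        omega
      | zero =>
        by_cases hS0 : S = ∅
        · exact (ih S (by simp [hS0]) 0).trans (by rw [hF])
        · obtain ⟨a, ha⟩ := Finset.nonempty_iff_ne_empty.2 hS0
          have hca := hm a ha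
          have hcard : ∀ b ∈ S.erase a, ((S.erase a).erase b).card ≤ n := by
            intro b hb
            rw [Finset.card_erase_of_mem hb, Finset.card_erase_of_mem ha]; omega
          rw [WW_rec c bar e hb ha, Bf_zero, hE1, one_mul, HH_X c e true S a ha hca, hE, pd_HH, map_sum]
          refine Finset.sum_congr rfl fun b hb => ?_
          have hcb := hm b (Finset.mem_of_mem_erase hb)
          by_cases h1 : e b = bar (e a)
          · rw [if_pos h1, if_pos h1, if_pos hcb, if_pos (by rw [hca, hcb]), ih _ (hcard b hb), Bf_zero]
            have : HH c e false ((S.erase a).erase b) = 1 := by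
              rw [HH_ne c e false _ b (by simp [hcb]), HH_ne c e false _ a (by simp [hca]), hF]
            rw [this, hE1, one_mul]
          · simp [h1]

end wick
end AGF

set_option linter.unusedSectionVars false
set_option linter.unusedSimpArgs false

namespace AGF
open MvPolynomial

section tr
variable {R : Type} [CommRing R] {N : ℕ}

lemma pow_path (M : Matrix (Fin N) (Fin N) R) (m : ℕ) : ∀ x y,
    (M ^ (m + 1)) x y = ∑ f : Fin m → Fin N,
      (∏ i : Fin m, M ((Fin.cons x f : Fin (m + 1) → Fin N) i.castSucc) (f i)) *
        M ((Fin.cons x f : Fin (m + 1) → Fin N) (Fin.last m)) y := by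
  induction m with
  | zero => intro x y; simp
  | succ m ih =>
    intro x y
    rw [pow_succ', Matrix.mul_apply, ← (Fin.consEquiv (fun _ => Fin N)).sum_comp,
      Fintype.sum_prod_type]
    refine Finset.sum_congr rfl fun z _ => ?_
    rw [ih, Finset.mul_sum]
    refine Finset.sum_congr rfl fun f _ => ?_
    rw [Fin.prod_univ_succ, mul_assoc]
    rfl

lemma trace_path (M : Matrix (Fin N) (Fin N) R) (p : ℕ) (hp : 1 ≤ p) :
    (M ^ p).trace = ∑ f : Fin p → Fin N, ∏ i, M (f i) (f (finRotate p i)) := by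
  obtain ⟨m, rfl⟩ := Nat.exists_eq_add_of_le' hp
  rw [Matrix.trace, ← (Fin.consEquiv (fun _ => Fin N)).sum_comp, Fintype.sum_prod_type]
  refine Finset.sum_congr rfl fun x _ => ?_
  rw [Matrix.diag_apply, pow_path]
  refine Finset.sum_congr rfl fun f _ => ?_
  rw [Fin.prod_univ_castSucc]
  congr 1
  · refine Finset.prod_congr rfl fun i _ => ?_
    rw [finRotate_apply, Fin.coeSucc_eq_succ]
    rfl
  · rw [finRotate_last]
    rfl

end tr

section cyc

lemma card_inv {A : Type} [Fintype A] [DecidableEq A] (σ : Equiv.Perm A) (N : ℕ) :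
    (Finset.univ.filter fun F : A → Fin N => ∀ v, F (σ v) = F v).card = N ^ cycleCount σ := by
  rw [cycleCount, ← Fintype.card_subtype]
  have hz : ∀ F : A → Fin N, (∀ v, F (σ v) = F v) → ∀ (k : ℤ) v, F ((σ ^ k) v) = F v := by
    intro F h k
    induction k using Int.induction_on with
    | zero => simp
    | succ k ih => intro v; rw [zpow_add_one, Equiv.Perm.mul_apply, ih, h]
    | pred k ih =>
      intro v
      rw [zpow_sub_one, Equiv.Perm.mul_apply, ih, ← h (σ⁻¹ v)]; simp
  let eq : {F : A → Fin N // ∀ v, F (σ v) = F v} ≃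
      (Quotient (MulAction.orbitRel (Subgroup.zpowers σ) A) → Fin N) :=
    { toFun := fun F => Quotient.lift F.1 (by
        rintro a b ⟨⟨g, k, rfl⟩, rfl⟩
        exact hz F.1 F.2 k b)
      invFun := fun G => ⟨fun v => G (Quotient.mk _ v), fun v => by
        exact congrArg G (Quotient.sound ⟨⟨σ, Subgroup.mem_zpowers σ⟩, rfl⟩)⟩
      left_inv := fun F => rfl
      right_inv := fun G => by
        funext x
        induction x using Quotient.inductionOn
        rfl }
  rw [← Nat.card_eq_fintype_card, Nat.card_congr eq, Nat.card_fun, Nat.card_fin]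

lemma cyc_pos {A : Type} [Fintype A] [Nonempty A] (σ : Equiv.Perm A) : 1 ≤ cycleCount σ := by
  rw [cycleCount]
  have : Nonempty (Quotient (MulAction.orbitRel (Subgroup.zpowers σ) A)) :=
    ⟨Quotient.mk _ (Classical.arbitrary A)⟩
  have : Finite (Quotient (MulAction.orbitRel (Subgroup.zpowers σ) A)) := inferInstance
  exact Nat.card_pos

lemma cyc_le {A : Type} [Fintype A] (σ : Equiv.Perm A) : cycleCount σ ≤ Fintype.card A := by
  rw [cycleCount, ← Nat.card_eq_fintype_card]
  exact Nat.card_le_card_of_surjective (Quotient.mk _) Quotient.mk_surjective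

end cyc

section main
variable {N : ℕ}

lemma exists_E (N : ℕ) : ∃ E : MvPolynomial (Fin N × Fin N) ℝ →ₗ[ℝ] ℝ, E 1 = 1 ∧
    ∀ a F, E (X a * F) = E (pderiv (Prod.swap a) F) := by
  obtain ⟨U, h1, hX⟩ := exists_U (I := Fin N × Fin N) Prod.swap (fun _ => Prod.swap_swap _)
  refine ⟨(lcoeff ℝ 0).comp U, ?_, ?_⟩
  · simp [h1]
  · intro a F
    simp [hX, U_pd h1 hX, coeff_X_mul']

lemma mix_eq (p q : ℕ) (μ : Equiv.Perm (Fin p ⊕ Fin q)) :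
    mix (fun v => v.isRight) μ = (Finset.univ.filter fun i : Fin p => (μ (Sum.inl i)).isRight).card := by
  rw [mix, Finset.card_filter, Finset.card_filter, Fintype.sum_sum_type]
  simp

lemma Bf_count {E : MvPolynomial (Fin N × Fin N) ℝ →ₗ[ℝ] ℝ} (hE1 : E 1 = 1)
    (hE : ∀ a F, E (X a * F) = E (pderiv (Prod.swap a) F)) (p q s : ℕ) (hp : 1 ≤ p) (hq : 1 ≤ q) :
    Bf Prod.swap E s (tt N p) (tt N q) =
      ∑ μ ∈ PP (Finset.univ : Finset (Fin p ⊕ Fin q)),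
        if mix (fun v => v.isRight) μ = s then
          (N : ℝ) ^ cycleCount (μ * (Equiv.sumCongr (finRotate p) (finRotate q))⁻¹) else 0 := by
  set γ := Equiv.sumCongr (finRotate p) (finRotate q) with hγ
  have h1 : Bf Prod.swap E s (tt N p) (tt N q) =
      ∑ F : Fin p ⊕ Fin q → Fin N, WW (fun v => v.isRight) Prod.swap (fun v => (F v, F (γ v))) s Finset.univ := by
    rw [tt, tt, trace_path _ p hp, trace_path _ q hq, map_sum (Bf Prod.swap E s), LinearMap.sum_apply,
      ← (Equiv.sumArrowEquivProdArrow (Fin p) (Fin q) (Fin N)).symm.sum_comp, Fintype.sum_prod_type]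
    refine Finset.sum_congr rfl fun f _ => ?_
    rw [map_sum]
    refine Finset.sum_congr rfl fun g _ => ?_
    rw [wick _ _ (fun _ => Prod.swap_swap _) hE1 hE _ _ le_rfl]
    congr 1
    · congr 1
      rw [HH, Finset.prod_filter, Fintype.prod_sum_type]
      simp [MM, hγ, Equiv.sumArrowEquivProdArrow]
    · rw [HH, Finset.prod_filter, Fintype.prod_sum_type]
      simp [MM, hγ, Equiv.sumArrowEquivProdArrow]
  rw [h1]
  simp only [WW]
  rw [Finset.sum_comm]
  refine Finset.sum_congr rfl fun μ hμ => ?_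
  rw [mem_PP] at hμ
  by_cases hm : mix (fun v => v.isRight) μ = s
  · rw [if_pos hm]
    have := card_inv (μ * γ⁻¹) N
    have h2 : ((N ^ cycleCount (μ * γ⁻¹) : ℕ) : ℝ) = (N : ℝ) ^ cycleCount (μ * γ⁻¹) := by push_cast; rfl
    rw [← h2, ← this, Finset.card_filter]
    rw [Nat.cast_sum]
    refine Finset.sum_congr rfl fun F _ => ?_
    rw [Nat.cast_ite, Nat.cast_one, Nat.cast_zero]
    refine if_congr ?_ rfl rfl
    simp only [hm, true_and, Finset.mem_univ, true_imp_iff, Prod.swap_prod_mk, Prod.mk.injEq]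
    constructor
    · intro h v
      have := (h (γ⁻¹ v)).1
      rw [Equiv.Perm.mul_apply, this]; simp
    · intro h
      have h3 : ∀ v, F (μ v) = F (γ v) := by
        intro v
        have := h (γ v)
        rw [Equiv.Perm.mul_apply] at this
        simpa using this
      intro v
      refine ⟨h3 v, ?_⟩
      rw [← h3, hμ.1]
  · simp [hm]

theorem lhs_nat (p q s : ℕ) (hp : 1 ≤ p) (hq : 1 ≤ q) (hs : 1 ≤ s) (N : ℕ) :
    ∑ k ∈ Finset.Icc 1 (p + q), (annCount p q s k : ℝ) * (N : ℝ) ^ k =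
      ∑ i ∈ Finset.range N, if N ≤ i + s then al p (i + s) i * al q i (i + s) else 0 := by
  obtain ⟨E, hE1, hE⟩ := exists_E N
  rw [← Bf_tt_eq hE1 hE p q s hs, Bf_count hE1 hE p q s hp hq, ← Finset.sum_filter]
  set T := (PP (Finset.univ : Finset (Fin p ⊕ Fin q))).filter
    (fun μ => mix (fun v => v.isRight) μ = s) with hT
  set cy : Equiv.Perm (Fin p ⊕ Fin q) → ℕ :=
    fun μ => cycleCount (μ * (Equiv.sumCongr (finRotate p) (finRotate q))⁻¹) with hcy
  have hne : Nonempty (Fin p ⊕ Fin q) := ⟨Sum.inl ⟨0, hp⟩⟩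
  rw [← Finset.sum_fiberwise_of_maps_to (g := cy) (t := Finset.Icc 1 (p + q))]
  · refine Finset.sum_congr rfl fun k _ => ?_
    have h1 : annCount p q s k = (T.filter fun μ => cy μ = k).card := by
      rw [annCount, Nat.card_eq_fintype_card, Fintype.card_subtype]
      congr 1
      ext μ
      simp only [Finset.mem_filter, Finset.mem_univ, true_and, hT, mem_PP, mix_eq, iff_true]
      tauto
    rw [h1, Finset.sum_congr rfl (g := fun _ => (N : ℝ) ^ k), Finset.sum_const, nsmul_eq_mul]
    intro μ hμ
    rw [Finset.mem_filter] at hμ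
    rw [← hμ.2]
  · intro μ _
    rw [Finset.mem_Icc]
    refine ⟨cyc_pos _, (cyc_le _).trans ?_⟩
    simp

end main

lemma poly_ext (P Q : Polynomial ℝ) (h : ∀ N : ℕ, P.eval (N : ℝ) = Q.eval (N : ℝ)) : P = Q := by
  apply Polynomial.eq_of_infinite_eval_eq
  apply Set.Infinite.mono (s := Set.range (fun N : ℕ => (N : ℝ)))
  · rintro _ ⟨N, rfl⟩; exact h N
  · exact Set.infinite_range_of_injective Nat.cast_injective

noncomputable def pch (k : ℕ) : Polynomial ℝ :=
  Polynomial.C ((k.factorial : ℝ)⁻¹) * ∏ t ∈ Finset.range k, (Polynomial.X - Polynomial.C (t : ℝ))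

lemma pch_eval (k : ℕ) (x : ℝ) : (pch k).eval x = realChoose x k := by
  rw [pch, realChoose, Polynomial.eval_mul, Polynomial.eval_C, Polynomial.eval_prod]
  simp only [Polynomial.eval_sub, Polynomial.eval_X, Polynomial.eval_C]
  rw [div_eq_inv_mul]

end AGF

/-- Main theorem: the explicit formula for `A^{(s)}_{p,q}(x)`.
(The sums are truncated at indices beyond which all terms vanish: a permutation of
`p + q` points has at most `p + q` cycles.) -/
theorem annular_genus_formula (p q s n : ℕ) (hp : 1 ≤ p) (hq : 1 ≤ q) (hs : 1 ≤ s)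
    (hps : p % 2 = s % 2) (hqs : q % 2 = s % 2) (hn : p + q = 2 * n) (x : ℝ) :
    ∑ k ∈ Finset.Icc 1 (p + q), (annCount p q s k : ℝ) * x ^ k =
      (p.factorial : ℝ) * (q.factorial : ℝ) *
        ∑ k ∈ Finset.Icc 1 (n + 1), ∑ i ∈ Finset.range (p / 2 + 1),
          ∑ j ∈ Finset.range (q / 2 + 1),
            (realChoose x k * ((n - i - j).choose (k - 1) : ℝ)) /
              (2 ^ (i + j) * (Nat.factorial i : ℝ) * (Nat.factorial j : ℝ) *
                (Nat.factorial (n - i - j) : ℝ)) *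
            ((ichoose ((k : ℤ) - 1) (((p : ℤ) - s) / 2 - i) *
                ichoose ((k : ℤ) - 1) (((q : ℤ) - s) / 2 - j) -
              ichoose ((k : ℤ) - 1) (((p : ℤ) + s) / 2 - i) *
                ichoose ((k : ℤ) - 1) (((q : ℤ) + s) / 2 - j) : ℤ) : ℝ) := by
  let P : Polynomial ℝ := ∑ k ∈ Finset.Icc 1 (p + q),
    Polynomial.C (annCount p q s k : ℝ) * Polynomial.X ^ k
  let Q : Polynomial ℝ := Polynomial.C ((p.factorial : ℝ) * (q.factorial : ℝ)) *
        ∑ k ∈ Finset.Icc 1 (n + 1), ∑ i ∈ Finset.range (p / 2 + 1),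
          ∑ j ∈ Finset.range (q / 2 + 1),
            AGF.pch k * Polynomial.C (((n - i - j).choose (k - 1) : ℝ) /
              (2 ^ (i + j) * (Nat.factorial i : ℝ) * (Nat.factorial j : ℝ) *
                (Nat.factorial (n - i - j) : ℝ)) *
            ((ichoose ((k : ℤ) - 1) (((p : ℤ) - s) / 2 - i) *
                ichoose ((k : ℤ) - 1) (((q : ℤ) - s) / 2 - j) -
              ichoose ((k : ℤ) - 1) (((p : ℤ) + s) / 2 - i) *
                ichoose ((k : ℤ) - 1) (((q : ℤ) + s) / 2 - j) : ℤ) : ℝ))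
  have hP : ∀ y : ℝ, P.eval y = ∑ k ∈ Finset.Icc 1 (p + q), (annCount p q s k : ℝ) * y ^ k := by
    intro y
    simp [P, Polynomial.eval_finsetSum]
  have hQ : ∀ y : ℝ, Q.eval y = (p.factorial : ℝ) * (q.factorial : ℝ) *
        ∑ k ∈ Finset.Icc 1 (n + 1), ∑ i ∈ Finset.range (p / 2 + 1),
          ∑ j ∈ Finset.range (q / 2 + 1),
            (realChoose y k * ((n - i - j).choose (k - 1) : ℝ)) /
              (2 ^ (i + j) * (Nat.factorial i : ℝ) * (Nat.factorial j : ℝ) *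
                (Nat.factorial (n - i - j) : ℝ)) *
            ((ichoose ((k : ℤ) - 1) (((p : ℤ) - s) / 2 - i) *
                ichoose ((k : ℤ) - 1) (((q : ℤ) - s) / 2 - j) -
              ichoose ((k : ℤ) - 1) (((p : ℤ) + s) / 2 - i) *
                ichoose ((k : ℤ) - 1) (((q : ℤ) + s) / 2 - j) : ℤ) : ℝ) := by
    intro y
    simp only [Q, Polynomial.eval_mul, Polynomial.eval_C, Polynomial.eval_finsetSum, AGF.pch_eval]
    congr 1
    refine Finset.sum_congr rfl fun k _ => Finset.sum_congr rfl fun i _ =>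
      Finset.sum_congr rfl fun j _ => ?_
    ring
  rw [← hP, ← hQ]
  congr 1
  apply AGF.poly_ext
  intro N
  rw [hP, hQ, AGF.lhs_nat p q s hp hq hs N, AGF.rhs_nat p q s n N hs hps hqs hn]
end

section
/- Let p, q, s ≥ 1 be integers of the same odd-even parity, let n = (p+q)/2, and let k ≥ 1, 0 ≤ i ≤ ⌊p/2⌋, 0 ≤ j ≤ ⌊q/2⌋ be integers with k−1 ≤ n−i−j. Then Δ^{(s)}_{k,p,q} = binom(k−1, (p−s)/2 − i)·binom(k−1, (q−s)/2 − j) − binom(k−1, (p+s)/2 − i)·binom(k−1, (q+s)/2 − j) is nonnegative, with the convention that binom(k−1, t) = 0 for integers t < 0 or t > k−1. -/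
theorem choose_aux (N x y e : ℕ) (h : x + y + e ≤ N) :
    N.choose x * N.choose y ≤ N.choose (x + e) * N.choose (y + e) := by
  have h1 := Nat.choose_mul (n := N) (k := x + e) (s := x) (by omega)
  have h2 := Nat.choose_mul (n := N) (k := y + e) (s := y) (by omega)
  rw [Nat.add_sub_cancel_left, Nat.choose_symm_add] at h1 h2
  have h3 : (y + e).choose e ≤ (N - x).choose e := Nat.choose_le_choose e (by omega)
  have h4 : (x + e).choose e ≤ (N - y).choose e := Nat.choose_le_choose e (by omega)
  have hA : 0 < (x + e).choose e := Nat.choose_pos (by omega)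
  have hB : 0 < (y + e).choose e := Nat.choose_pos (by omega)
  refine Nat.le_of_mul_le_mul_right ?_ (Nat.mul_pos hA hB)
  calc N.choose x * N.choose y * ((x + e).choose e * (y + e).choose e)
      ≤ N.choose x * N.choose y * ((N - y).choose e * (N - x).choose e) :=
        Nat.mul_le_mul_left _ (Nat.mul_le_mul h4 h3)
    _ = (N.choose x * (N - x).choose e) * (N.choose y * (N - y).choose e) := by ring
    _ = _ := by rw [← h1, ← h2]; ring

theorem ichoose_nonneg (a b : ℤ) : 0 ≤ ichoose a b := by
  unfold ichoose; split_ifs <;> positivity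

theorem ichoose_zero (a b : ℤ) (h : b < 0 ∨ a < b) : ichoose a b = 0 := by
  unfold ichoose; rw [if_neg]; omega

theorem ichoose_nat (a b : ℕ) (h : b ≤ a) : ichoose a b = (a.choose b : ℕ) := by
  unfold ichoose; rw [if_pos (by omega)]; simp

theorem ichoose_aux (N s : ℕ) (a b : ℤ) (h : (N : ℤ) ≤ a + b + s) :
    ichoose N (a + s) * ichoose N (b + s) ≤ ichoose N a * ichoose N b := by
  have hR := mul_nonneg (ichoose_nonneg N a) (ichoose_nonneg N b)
  by_cases h1 : a + s < 0 ∨ (N : ℤ) < a + s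
  · rwa [ichoose_zero N (a + s) h1, zero_mul]
  by_cases h2 : b + s < 0 ∨ (N : ℤ) < b + s
  · rwa [ichoose_zero N (b + s) h2, mul_zero]
  lift a to ℕ using (by omega)
  lift b to ℕ using (by omega)
  have e1 := ichoose_nat N (a + s) (by omega)
  have e2 := ichoose_nat N (b + s) (by omega)
  push_cast at e1 e2
  rw [e1, e2, ichoose_nat N a (by omega), ichoose_nat N b (by omega)]
  have := choose_aux N (N - (b + s)) (N - (a + s)) (a + b + s - N) (by omega)
  rw [Nat.choose_symm (by omega), Nat.choose_symm (by omega),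
    show N - (b + s) + (a + b + s - N) = a by omega,
    show N - (a + s) + (a + b + s - N) = b by omega] at this
  rw [mul_comm]
  exact_mod_cast this

/-- Nonnegativity of `Δ^{(s)}_{k,p,q}`: for `p, q, s ≥ 1` of the same parity,
`n = (p+q)/2`, `k ≥ 1`, `0 ≤ i ≤ ⌊p/2⌋`, `0 ≤ j ≤ ⌊q/2⌋` with `k - 1 ≤ n - i - j`,
`binom(k-1,(p-s)/2-i)·binom(k-1,(q-s)/2-j) - binom(k-1,(p+s)/2-i)·binom(k-1,(q+s)/2-j) ≥ 0`. -/
theorem delta_nonneg (p q s n k i j : ℕ) (hp : 1 ≤ p) (hq : 1 ≤ q) (hs : 1 ≤ s)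
    (hps : p % 2 = s % 2) (hqs : q % 2 = s % 2) (hn : p + q = 2 * n)
    (hk : 1 ≤ k) (hi : i ≤ p / 2) (hj : j ≤ q / 2) (hkn : k - 1 ≤ n - i - j) :
    ichoose ((k : ℤ) - 1) (((p : ℤ) + s) / 2 - i) *
        ichoose ((k : ℤ) - 1) (((q : ℤ) + s) / 2 - j) ≤
      ichoose ((k : ℤ) - 1) (((p : ℤ) - s) / 2 - i) *
        ichoose ((k : ℤ) - 1) (((q : ℤ) - s) / 2 - j) := by
  have h := ichoose_aux (k - 1) s (((p : ℤ) - s) / 2 - i) (((q : ℤ) - s) / 2 - j) (by omega)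
  rw [show (((k - 1 : ℕ) : ℤ)) = (k : ℤ) - 1 by omega,
    show ((p : ℤ) - s) / 2 - i + s = ((p : ℤ) + s) / 2 - i by omega,
    show ((q : ℤ) - s) / 2 - j + s = ((q : ℤ) + s) / 2 - j by omega] at h
  exact h
end
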